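/- arXiv:1807.07482 — 3 statements merged into one kernel-verified Lean document; each statement's English description precedes it below -/
import Mathlib

section
/- Let k be a finite field of characteristic p ≠ 2 and R an algebraically closed field of characteristic 0. If n = 1 or n is even, then there exists a selfdual supercuspidal irreducible R-representation of GL_n(k). -/
open Matrix

section InvariantForms

variable {R : Type} [CommRing R] {G : Type} [Monoid G] {V : Type} [AddCommGroup V] [Module R V]

/-- The space of `H`-invariant `R`-linear forms on a representation `ρ`. -/
def invariantForms (ρ : Representation R G V) (H : Set G) : Submodule R (V →ₗ[R] R) where
  carrier := {φ | ∀ g ∈ H, ∀ v : V, φ (ρ g v) = φ v}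
  add_mem' := by
    intro φ ψ hφ hψ g hg v
    simp only [LinearMap.add_apply, hφ g hg v, hψ g hg v]
  zero_mem' := by intro g hg v; simp
  smul_mem' := by
    intro c φ hφ g hg v
    simp only [LinearMap.smul_apply, hφ g hg v]

/-- A representation is irreducible if it is nonzero and its only invariant submodules
are `⊥` and `⊤`. -/
def IsIrreducibleRep (ρ : Representation R G V) : Prop :=
  (⊥ : Submodule R V) ≠ ⊤ ∧
    ∀ W : Submodule R V, (∀ g : G, ∀ v ∈ W, ρ g v ∈ W) → W = ⊥ ∨ W = ⊤

/-- Two representations are isomorphic if there is an equivariant linear equivalence. -/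
def RepIso {W : Type} [AddCommGroup W] [Module R W]
    (ρ : Representation R G V) (τ : Representation R G W) : Prop :=
  ∃ e : V ≃ₗ[R] W, ∀ (g : G) (v : V), e (ρ g v) = τ g (e v)

/-- `ρ` is (isomorphic to) a subquotient of `τ`:  there is a `τ`-invariant submodule `q`
together with an equivariant surjection from `q` onto the space of `ρ`. -/
def IsSubquotientOf {W : Type} [AddCommGroup W] [Module R W]
    (ρ : Representation R G V) (τ : Representation R G W) : Prop :=
  ∃ (q : Submodule R W) (hq : ∀ g : G, ∀ w ∈ q, τ g w ∈ q) (f : ↥q →ₗ[R] V),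
    Function.Surjective f ∧
      ∀ (g : G) (w : ↥q), f ⟨τ g w.1, hq g w.1 w.2⟩ = ρ g (f w)

end InvariantForms
section RightRegular

variable {R : Type} [CommRing R] {G : Type} [Group G] {V : Type} [AddCommGroup V] [Module R V]

/-- The right-translation representation of `G` on a translation-invariant submodule of
the space of `V`-valued functions on `G`. -/
def rightRegular (C : Submodule R (G → V))
    (hC : ∀ g : G, ∀ f ∈ C, (fun x => f (x * g)) ∈ C) :
    Representation R G ↥C where
  toFun g := LinearMap.restrict
    { toFun := fun (f : G → V) => (fun x => f (x * g))
      map_add' := fun _ _ => rfl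
      map_smul' := fun _ _ => by rfl } (fun f hf => hC g f hf)
  map_one' := by
    apply LinearMap.ext
    intro f
    apply Subtype.ext
    funext x
    simp [LinearMap.restrict_apply]
  map_mul' := by
    intro g g'
    apply LinearMap.ext
    intro f
    apply Subtype.ext
    funext x
    simp [LinearMap.restrict_apply, mul_assoc]

/-- The space of the representation of `G` induced from a representation `τ` of a
subgroup `P`. -/
def indCarrier {W : Type} [AddCommGroup W] [Module R W]
    (P : Subgroup G) (τ : Representation R ↥P W) : Submodule R (G → W) where
  carrier := {f | ∀ (p : ↥P) (g : G), f (↑p * g) = τ p (f g)}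
  add_mem' := by
    intro f₁ f₂ h₁ h₂ p g
    simp [h₁ p g, h₂ p g]
  zero_mem' := by intro p g; simp
  smul_mem' := by
    intro c f hf p g
    simp [hf p g]

/-- The representation of `G` induced from a representation `τ` of a subgroup `P`,
realized on functions `f : G → W` with `f (p * g) = τ p (f g)`, with `G` acting by right
translation. -/
def inducedRep {W : Type} [AddCommGroup W] [Module R W]
    (P : Subgroup G) (τ : Representation R ↥P W) :
    Representation R G ↥(indCarrier P τ) :=
  rightRegular (indCarrier P τ) (by
    intro g f hf p x
    simpa [mul_assoc] using hf p (x * g))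

end RightRegular
section Parabolic

variable (k : Type) [Field k]

/-- The block upper-triangular parabolic subgroup of `GL n k` attached to a
block function `B`. -/
def parabolic (n r : ℕ) (B : Fin n → Fin r) : Subgroup (GL (Fin n) k) where
  carrier := {g | Matrix.BlockTriangular (g : Matrix (Fin n) (Fin n) k) B}
  one_mem' := by
    simpa using Matrix.blockTriangular_one (b := B)
  mul_mem' := by
    intro a b ha hb
    have h : ((a * b : GL (Fin n) k) : Matrix (Fin n) (Fin n) k)
        = (a : Matrix (Fin n) (Fin n) k) * (b : Matrix (Fin n) (Fin n) k) := rfl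
    simpa [Set.mem_setOf_eq, h] using Matrix.BlockTriangular.mul ha hb
  inv_mem' := by
    intro a ha
    have h : ((a⁻¹ : GL (Fin n) k) : Matrix (Fin n) (Fin n) k)
        = (a : Matrix (Fin n) (Fin n) k)⁻¹ := by
      simp [Matrix.coe_units_inv]
    haveI : Invertible (a : Matrix (Fin n) (Fin n) k) := a.invertible
    simpa [Set.mem_setOf_eq, h] using Matrix.blockTriangular_inv_of_blockTriangular ha

/-- A representation of `GL n k` is supercuspidal if it does not occur as a subquotient of
any representation induced from a proper parabolic subgroup, from a representation inflated
from the corresponding block-diagonal Levi subgroup (i.e. trivial on the unipotent radical). -/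
def IsSupercuspidal {R : Type} [CommRing R] {n : ℕ} {V : Type} [AddCommGroup V] [Module R V]
    (ρ : Representation R (GL (Fin n) k) V) : Prop :=
  ∀ (r : ℕ), 2 ≤ r → ∀ B : Fin n → Fin r, Monotone B → Function.Surjective B →
    ∀ (W : Type) [AddCommGroup W] [Module R W],
      ∀ τ : Representation R ↥(parabolic k n r B) W,
        (∀ u : ↥(parabolic k n r B),
            (∀ i j : Fin n, B i = B j →
              ((u : GL (Fin n) k) : Matrix (Fin n) (Fin n) k) i j
                = (1 : Matrix (Fin n) (Fin n) k) i j) → τ u = 1) →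
        ¬ IsSubquotientOf ρ (inducedRep (parabolic k n r B) τ)

end Parabolic

section VirtualCharacters

open Representation Module

/-- The trace of an endomorphism is the sum of the traces on an invariant subspace and on the
quotient. -/
lemma LinearMap.trace_eq_trace_restrict_add_trace_mapQ {R V : Type*} [Field R] [AddCommGroup V]
    [Module R V] [FiniteDimensional R V] (W : Submodule R V) (f : V →ₗ[R] V)
    (h : W ≤ W.comap f) :
    LinearMap.trace R V f
      = LinearMap.trace R W (f.restrict h) + LinearMap.trace R (V ⧸ W) (W.mapQ W f h) := by
  obtain ⟨s, hs⟩ := W.mkQ.exists_rightInverse_of_surjective W.range_mkQ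
  obtain ⟨q, hq⟩ := W.subtype.exists_leftInverse_of_injective W.ker_subtype
  set P : V →ₗ[R] W := (LinearMap.id - s ∘ₗ W.mkQ).codRestrict W (by
    intro v
    rw [← Submodule.Quotient.mk_eq_zero, ← Submodule.mkQ_apply]
    have := LinearMap.congr_fun hs (W.mkQ v)
    simp only [LinearMap.comp_apply, LinearMap.id_apply] at this
    simp only [LinearMap.sub_apply, LinearMap.id_apply, LinearMap.comp_apply, map_sub, this,
      sub_self]) with hP
  have hdec : f = f ∘ₗ (W.subtype ∘ₗ P) + f ∘ₗ (s ∘ₗ W.mkQ) := by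
    ext v; simp [hP]
  have h1 : P ∘ₗ (f ∘ₗ W.subtype) = f.restrict h := by
    ext w
    have hw : W.mkQ (f w) = 0 := by
      rw [Submodule.mkQ_apply, Submodule.Quotient.mk_eq_zero]; exact h w.2
    simp [hP, -Submodule.mkQ_apply, hw]
  have h2 : W.mkQ ∘ₗ (f ∘ₗ s) = W.mapQ W f h := by
    have : W.mkQ ∘ₗ f = W.mapQ W f h ∘ₗ W.mkQ := by ext v; simp
    rw [← LinearMap.comp_assoc, this, LinearMap.comp_assoc, hs, LinearMap.comp_id]
  conv_lhs => rw [hdec]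
  rw [map_add, ← LinearMap.comp_assoc, ← LinearMap.comp_assoc, LinearMap.trace_comp_comm',
    LinearMap.trace_comp_comm' W.mkQ, h1, h2]

variable {R : Type} [Field R] {G : Type} [Group G]

lemma Representation.character_eq_subrepresentation_add_quotient {V : Type} [AddCommGroup V]
    [Module R V] [FiniteDimensional R V] (ρ : Representation R G V) (W : Submodule R V)
    (h : ∀ g, W ≤ W.comap (ρ g)) (g : G) :
    ρ.character g = (ρ.subrepresentation W h).character g + (ρ.quotient W h).character g :=
  LinearMap.trace_eq_trace_restrict_add_trace_mapQ W (ρ g) (h g)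

/-- A class function is a virtual character if it is a difference of two characters. -/
def IsVirtualChar (f : G → R) : Prop :=
  ∃ (A : Type) (_ : AddCommGroup A) (_ : Module R A) (_ : FiniteDimensional R A)
    (α : Representation R G A)
    (B : Type) (_ : AddCommGroup B) (_ : Module R B) (_ : FiniteDimensional R B)
    (β : Representation R G B), ∀ g, f g = α.character g - β.character g

lemma Representation.character_prod {A B : Type} [AddCommGroup A] [Module R A]
    [FiniteDimensional R A] [AddCommGroup B] [Module R B] [FiniteDimensional R B]
    (α : Representation R G A) (β : Representation R G B) (g : G) :
    (α.prod β).character g = α.character g + β.character g :=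
  LinearMap.trace_prodMap' (α g) (β g)

lemma IsVirtualChar.of_character {A : Type} [AddCommGroup A] [Module R A]
    [FiniteDimensional R A] (α : Representation R G A) : IsVirtualChar α.character :=
  ⟨A, inferInstance, inferInstance, inferInstance, α, (Fin 0 → R), inferInstance, inferInstance,
    inferInstance, trivial R G _, fun g => by
      have : (trivial R G (Fin 0 → R)).character g = 0 := by
        rw [character, Subsingleton.elim (trivial R G (Fin 0 → R) g) 0, map_zero]
      rw [this, sub_zero]⟩

lemma IsVirtualChar.neg {f : G → R} (hf : IsVirtualChar f) : IsVirtualChar (-f) := by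
  obtain ⟨A, iA, iA', iA'', α, B, iB, iB', iB'', β, h⟩ := hf
  exact ⟨B, iB, iB', iB'', β, A, iA, iA', iA'', α, fun g => by simp [h]⟩

lemma IsVirtualChar.add {f f' : G → R} (hf : IsVirtualChar f) (hf' : IsVirtualChar f') :
    IsVirtualChar (f + f') := by
  obtain ⟨A, iA, iA', iA'', α, B, iB, iB', iB'', β, h⟩ := hf
  obtain ⟨A', jA, jA', jA'', α', B', jB, jB', jB'', β', h'⟩ := hf'
  refine ⟨A × A', inferInstance, inferInstance, inferInstance, α.prod α', B × B', inferInstance,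
    inferInstance, inferInstance, β.prod β', fun g => ?_⟩
  rw [character_prod, character_prod, Pi.add_apply, h, h']
  ring

lemma IsVirtualChar.sub {f f' : G → R} (hf : IsVirtualChar f) (hf' : IsVirtualChar f') :
    IsVirtualChar (f - f') := by
  rw [sub_eq_add_neg]; exact hf.add hf'.neg

lemma IsVirtualChar.zero : IsVirtualChar (0 : G → R) := by
  have := IsVirtualChar.of_character (trivial R G R)
  simpa using this.sub this

lemma IsVirtualChar.nsmul {f : G → R} (hf : IsVirtualChar f) (N : ℕ) :
    IsVirtualChar (N • f) := by
  induction N with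
  | zero => simpa using IsVirtualChar.zero
  | succ N ih => rw [succ_nsmul]; exact ih.add hf

lemma IsVirtualChar.zsmul {f : G → R} (hf : IsVirtualChar f) (N : ℤ) :
    IsVirtualChar (N • f) := by
  obtain ⟨N, rfl | rfl⟩ := N.eq_nat_or_neg
  · simpa using hf.nsmul N
  · simpa using (hf.nsmul N).neg

lemma IsVirtualChar.sum {ι : Type*} (s : Finset ι) {f : ι → G → R}
    (hf : ∀ i ∈ s, IsVirtualChar (f i)) : IsVirtualChar (∑ i ∈ s, f i) :=
  Finset.sum_induction f IsVirtualChar (fun _ _ => IsVirtualChar.add) IsVirtualChar.zero hf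

lemma Representation.IntertwiningMap.finrank_pos_of_ne_zero {A B : Type} [AddCommGroup A] [Module R A]
    [FiniteDimensional R A] [AddCommGroup B] [Module R B] [FiniteDimensional R B]
    {α : Representation R G A} {β : Representation R G B} {f : IntertwiningMap α β}
    (hf : f ≠ 0) : 0 < finrank R (IntertwiningMap α β) := by
  have : FiniteDimensional R (invariants (linHom α β)) := inferInstance
  have : FiniteDimensional R (IntertwiningMap α β) :=
    (invariantsEquivIntertwiningMap α β).finiteDimensional
  have : Nontrivial (IntertwiningMap α β) := ⟨⟨f, 0, hf⟩⟩
  exact Module.finrank_pos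

variable [Fintype G] [CharZero R]

lemma Representation.sum_char_mul_char_inv {A B : Type} [AddCommGroup A] [Module R A]
    [FiniteDimensional R A] [AddCommGroup B] [Module R B] [FiniteDimensional R B]
    (α : Representation R G A) (β : Representation R G B) :
    ∑ g, β.character g * α.character g⁻¹
      = (Nat.card G : R) * (finrank R (IntertwiningMap α β) : R) := by
  have hG : (Nat.card G : R) ≠ 0 := Nat.cast_ne_zero.2 Nat.card_pos.ne'
  let := invertibleOfNonzero hG
  rw [← card_inv_mul_sum_char_mul_char_eq_finrank α β, mul_inv_cancel_left₀ hG]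

/-- A representation with one-dimensional commutant is irreducible. -/
lemma isIrreducibleRep_of_sum_char {A : Type} [AddCommGroup A] [Module R A]
    [FiniteDimensional R A] (α : Representation R G A)
    (h : ∑ g, α.character g * α.character g⁻¹ = Nat.card G) : IsIrreducibleRep α := by
  have hG : (Nat.card G : R) ≠ 0 := Nat.cast_ne_zero.2 Nat.card_pos.ne'
  have key : ∀ W : Submodule R A, (∀ g : G, ∀ v ∈ W, α g v ∈ W) → W = ⊥ ∨ W = ⊤ := by
    intro W hW
    by_contra! hne
    set σ := α.subrepresentation W hW
    set τ := α.quotient W hW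
    have hs : ∀ g, α.character g = σ.character g + τ.character g :=
      character_eq_subrepresentation_add_quotient α W hW
    have h1 := sum_char_mul_char_inv σ σ
    have h2 := sum_char_mul_char_inv σ τ
    have h3 := sum_char_mul_char_inv τ σ
    have h4 := sum_char_mul_char_inv τ τ
    have : (Nat.card G : R) * (finrank R (IntertwiningMap σ σ) + finrank R (IntertwiningMap σ τ)
        + finrank R (IntertwiningMap τ σ) + finrank R (IntertwiningMap τ τ) : ℕ)
        = Nat.card G * (1 : ℕ) := by
      push_cast
      rw [mul_add, mul_add, mul_add, ← h1, ← h2, ← h3, ← h4, mul_one, ← h,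
        ← Finset.sum_add_distrib, ← Finset.sum_add_distrib, ← Finset.sum_add_distrib]
      refine Finset.sum_congr rfl fun g _ => ?_
      rw [hs, hs]; ring
    have := Nat.cast_injective (mul_left_cancel₀ hG this)
    have p1 : 0 < finrank R (IntertwiningMap σ σ) := by
      apply IntertwiningMap.finrank_pos_of_ne_zero (f := IntertwiningMap.id σ)
      intro h0
      obtain ⟨w, hw, hw0⟩ := W.exists_mem_ne_zero_of_ne_bot hne.1
      have := congrArg (fun f : IntertwiningMap σ σ => f ⟨w, hw⟩) h0
      simp only [IntertwiningMap.id_apply, IntertwiningMap.coe_zero, Pi.zero_apply] at this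
      exact hw0 (congrArg Subtype.val this)
    have p2 : 0 < finrank R (IntertwiningMap τ τ) := by
      apply IntertwiningMap.finrank_pos_of_ne_zero (f := IntertwiningMap.id τ)
      intro h0
      apply hne.2
      rw [Submodule.eq_top_iff']
      intro v
      have := congrArg (fun f : IntertwiningMap τ τ => f (Submodule.Quotient.mk v)) h0
      simpa using this
    omega
  refine ⟨fun hbot => ?_, key⟩
  have : Subsingleton A := (Submodule.subsingleton_iff R).1 (subsingleton_of_bot_eq_top hbot)
  have h0 : ∀ g, α.character g = 0 := fun g => by
    rw [character, Subsingleton.elim (α g) 0, map_zero]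
  simp only [h0, mul_zero, Finset.sum_const_zero] at h
  exact hG h.symm

/-- A virtual character of norm one is, up to sign, the character of an irreducible
representation. -/
theorem IsVirtualChar.exists_irreducible {f : G → R} (hf : IsVirtualChar f)
    (h : ∑ g, f g * f g⁻¹ = Nat.card G) :
    ∃ (V : Type) (_ : AddCommGroup V) (_ : Module R V) (_ : FiniteDimensional R V)
      (ρ : Representation R G V), IsIrreducibleRep ρ ∧
        (ρ.character = f ∨ ρ.character = -f) := by
  have hG : (Nat.card G : R) ≠ 0 := Nat.cast_ne_zero.2 Nat.card_pos.ne'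
  obtain ⟨A, iA, iA', iA'', α, B, iB, iB', iB'', β, hαβ⟩ := hf
  induction hN : finrank R A + finrank R B using Nat.strong_induction_on generalizing A B with
  | _ N ih =>
  by_cases hhom : ∃ φ : IntertwiningMap α β, φ ≠ 0
  · obtain ⟨φ, hφ⟩ := hhom
    have hK : ∀ g, LinearMap.ker φ.toLinearMap ≤ (LinearMap.ker φ.toLinearMap).comap (α g) := by
      intro g v hv
      have hv' : φ v = 0 := hv
      change φ (α g v) = 0
      rw [φ.isIntertwining, hv', map_zero]
    have hI : ∀ g, LinearMap.range φ.toLinearMap ≤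
        (LinearMap.range φ.toLinearMap).comap (β g) := by
      rintro g _ ⟨v, rfl⟩
      exact ⟨α g v, φ.isIntertwining _ _ g v⟩
    set K := LinearMap.ker φ.toLinearMap
    set I := LinearMap.range φ.toLinearMap
    have hIpos : 0 < finrank R I := by
      rw [Module.finrank_pos_iff, Submodule.nontrivial_iff_ne_bot]
      intro hbot
      exact hφ (IntertwiningMap.toLinearMap_injective _ _ (LinearMap.range_eq_bot.1 hbot))
    have hdim : finrank R K + finrank R (B ⧸ I) < N := by
      have h1 : finrank R I + finrank R K = finrank R A :=
        LinearMap.finrank_range_add_finrank_ker φ.toLinearMap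
      have h2 := Submodule.finrank_quotient_add_finrank I
      omega
    refine ih _ hdim K inferInstance inferInstance inferInstance (α.subrepresentation K hK)
      (B ⧸ I) inferInstance inferInstance inferInstance (β.quotient I hI) (fun g => ?_) rfl
    have hiso : (α.quotient K hK).character g = (β.subrepresentation I hI).character g := by
      refine congrFun (char_iso (Representation.Equiv.mk
        (LinearMap.quotKerEquivRange φ.toLinearMap) fun g => ?_)) g
      refine Submodule.linearMap_qext _ (LinearMap.ext fun v => Subtype.ext ?_)
      exact φ.isIntertwining _ _ g v
    rw [hαβ, character_eq_subrepresentation_add_quotient α K hK,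
      character_eq_subrepresentation_add_quotient β I hI, hiso]
    ring
  · push Not at hhom
    have h0 : ∑ g, β.character g * α.character g⁻¹ = 0 := by
      rw [sum_char_mul_char_inv]
      have : Subsingleton (IntertwiningMap α β) :=
        ⟨fun a b => (hhom a).trans (hhom b).symm⟩
      rw [Module.finrank_zero_of_subsingleton]
      simp
    have h0' : ∑ g, α.character g * β.character g⁻¹ = 0 := by
      rw [← h0, ← Equiv.sum_comp (Equiv.inv G)]
      refine Finset.sum_congr rfl fun g _ => ?_
      simp [mul_comm]
    have h1 := sum_char_mul_char_inv α α
    have h2 := sum_char_mul_char_inv β β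
    have hsum : ∑ g, f g * f g⁻¹ = ∑ g, α.character g * α.character g⁻¹
        + ∑ g, β.character g * β.character g⁻¹ - ∑ g, β.character g * α.character g⁻¹
        - ∑ g, α.character g * β.character g⁻¹ := by
      rw [← Finset.sum_add_distrib, ← Finset.sum_sub_distrib, ← Finset.sum_sub_distrib]
      refine Finset.sum_congr rfl fun g _ => ?_
      rw [hαβ, hαβ]; ring
    rw [h, h0, h0', sub_zero, sub_zero] at hsum
    have hdim : finrank R (IntertwiningMap α α) + finrank R (IntertwiningMap β β) = 1 := by
      have : (Nat.card G : R) * (finrank R (IntertwiningMap α α)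
          + finrank R (IntertwiningMap β β) : ℕ) = Nat.card G * (1 : ℕ) := by
        push_cast
        rw [mul_add, ← h1, ← h2, ← hsum, mul_one]
      exact Nat.cast_injective (mul_left_cancel₀ hG this)
    have hzero : ∀ {C : Type} [AddCommGroup C] [Module R C] [FiniteDimensional R C]
        (γ : Representation R G C), finrank R (IntertwiningMap γ γ) = 0 →
        ∀ g, γ.character g = 0 := by
      intro C _ _ _ γ hγ g
      have hid : IntertwiningMap.id γ = 0 := by
        by_contra hne
        exact (IntertwiningMap.finrank_pos_of_ne_zero hne).ne' hγ
      have : (LinearMap.id : C →ₗ[R] C) = 0 := congrArg IntertwiningMap.toLinearMap hid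
      rw [character, ← LinearMap.comp_id (γ g), this, LinearMap.comp_zero, map_zero]
    rcases Nat.eq_zero_or_pos (finrank R (IntertwiningMap β β)) with hβ | hβ
    · refine ⟨A, iA, iA', iA'', α, isIrreducibleRep_of_sum_char α ?_, Or.inl ?_⟩
      · rw [h1, show finrank R (IntertwiningMap α α) = 1 by omega]; simp
      · funext g; rw [hαβ, hzero β hβ, sub_zero]
    · refine ⟨B, iB, iB', iB'', β, isIrreducibleRep_of_sum_char β ?_, Or.inr ?_⟩
      · rw [h2, show finrank R (IntertwiningMap β β) = 1 by omega]; simp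
      · funext g; rw [Pi.neg_apply, hαβ, hzero α (by omega)]; simp

end VirtualCharacters

section Cuspidality

open Representation Module

variable {R : Type} [Field R] [CharZero R] {G : Type} [Group G] [Fintype G]

/-- An irreducible representation with real-valued character is selfdual. -/
lemma repIso_dual_of_character_inv {V : Type} [AddCommGroup V] [Module R V]
    [FiniteDimensional R V] {ρ : Representation R G V} (hρ : IsIrreducibleRep ρ)
    (h : ∀ g, ρ.character g⁻¹ = ρ.character g) : RepIso ρ ρ.dual := by
  have hG : (Nat.card G : R) ≠ 0 := Nat.cast_ne_zero.2 Nat.card_pos.ne'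
  have h1 := sum_char_mul_char_inv ρ ρ
  have h2 := sum_char_mul_char_inv ρ ρ.dual
  have hd : ∀ g, ρ.dual.character g = ρ.character g := fun g => by rw [char_dual, h]
  simp only [hd] at h2
  have heq := Nat.cast_injective (mul_left_cancel₀ hG (h1.symm.trans h2))
  have hid : IntertwiningMap.id ρ ≠ 0 := by
    intro h0
    apply hρ.1
    rw [eq_comm, Submodule.eq_bot_iff]
    intro v _
    have := congrArg (fun f : IntertwiningMap ρ ρ => f v) h0
    simpa using this
  have hpos := IntertwiningMap.finrank_pos_of_ne_zero hid
  rw [heq] at hpos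
  obtain ⟨φ, hφ⟩ : ∃ φ : IntertwiningMap ρ ρ.dual, φ ≠ 0 := by
    by_contra! hall
    have : Subsingleton (IntertwiningMap ρ ρ.dual) := ⟨fun a b => (hall a).trans (hall b).symm⟩
    rw [Module.finrank_zero_of_subsingleton] at hpos
    exact hpos.false
  have hinj : Function.Injective φ.toLinearMap := by
    rw [← LinearMap.ker_eq_bot]
    refine (hρ.2 (LinearMap.ker φ.toLinearMap) fun g v hv => ?_).resolve_right fun htop => ?_
    · have hv' : φ v = 0 := hv
      change φ (ρ g v) = 0
      rw [φ.isIntertwining, hv', map_zero]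
    · exact hφ (IntertwiningMap.toLinearMap_injective _ _ (LinearMap.ker_eq_top.1 htop))
  refine ⟨LinearEquiv.ofInjectiveOfFinrankEq φ.toLinearMap hinj
    (Subspace.dual_finrank_eq).symm, fun g v => ?_⟩
  exact φ.isIntertwining _ _ g v

/-- If the character of `ρ` sums to zero over a subgroup, then `ρ` has no nonzero invariants under
that subgroup. -/
lemma sum_apply_eq_zero_of_sum_char {V : Type} [AddCommGroup V] [Module R V]
    [FiniteDimensional R V] (ρ : Representation R G V) (U : Subgroup G) [Fintype U]
    (h : ∑ u : U, ρ.character u = 0) (v : V) : ∑ u : U, ρ u v = 0 := by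
  have hU : (Nat.card U : R) ≠ 0 := Nat.cast_ne_zero.2 Nat.card_pos.ne'
  let := invertibleOfNonzero hU
  have h1 := card_inv_mul_sum_char_eq_finrank (ρ.comp U.subtype)
  have h2 : ∑ g : U, Representation.character (ρ.comp U.subtype) g = 0 := h
  rw [h2, mul_zero, eq_comm, Nat.cast_eq_zero, Submodule.finrank_eq_zero] at h1
  rw [← Submodule.mem_bot R, ← h1, mem_invariants]
  intro u
  have := self_norm_apply (ρ.comp U.subtype) u v
  simpa [Representation.norm] using this

/-- A nonzero representation without invariants under `U` is not a subquotient of a representation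
induced from a representation on which `U` acts trivially. -/
lemma not_isSubquotientOf_inducedRep {V : Type} [AddCommGroup V] [Module R V]
    {ρ : Representation R G V} (hρ : (⊥ : Submodule R V) ≠ ⊤) {P : Subgroup G}
    {W : Type} [AddCommGroup W] [Module R W] (τ : Representation R P W)
    (U : Subgroup G) [Fintype U] (hUP : U ≤ P) (hτ : ∀ (u : G) (hu : u ∈ U), τ ⟨u, hUP hu⟩ = 1)
    (hU : ∀ v, ∑ u : U, ρ u v = 0) : ¬ IsSubquotientOf ρ (inducedRep P τ) := by
  rintro ⟨q, hq, f, hf, hfe⟩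
  set ι := inducedRep P τ with hι
  obtain ⟨s₀, hs₀⟩ := f.exists_rightInverse_of_surjective (LinearMap.range_eq_top.2 hf)
  let Q : Representation R G q := ι.subrepresentation q hq
  have hfQ : ∀ g w, f (Q g w) = ρ g (f w) := hfe
  let s : V → q := fun v => ∑ g : G, Q g⁻¹ (s₀ (ρ g v))
  have hs_add : ∀ {ι : Type} [Fintype ι] (F : ι → V), s (∑ i, F i) = ∑ i, s (F i) := by
    intro ι _ F
    simp only [s, map_sum]
    exact Finset.sum_comm
  have hs_zero : s 0 = 0 := by simp [s]
  have hfs : ∀ v, f (s v) = (Nat.card G : R) • v := by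
    intro v
    have : ∀ g, f (Q g⁻¹ (s₀ (ρ g v))) = v := fun g => by
      have h := LinearMap.congr_fun hs₀ (ρ g v)
      simp only [LinearMap.comp_apply, LinearMap.id_apply] at h
      rw [hfQ, h, inv_self_apply]
    simp only [s, map_sum, this]
    simp [Nat.cast_smul_eq_nsmul]
  have hse : ∀ h v, s (ρ h v) = Q h (s v) := by
    intro h v
    simp only [s, map_sum]
    rw [← Equiv.sum_comp (Equiv.mulRight h⁻¹)]
    refine Finset.sum_congr rfl fun g _ => ?_
    simp [map_mul]
  have hval : ∀ v x, (s v).1.1 x = (s (ρ x v)).1.1 1 := by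
    intro v x
    rw [hse]
    change _ = (s v).1.1 (1 * x)
    rw [one_mul]
  have hone : ∀ v, (s v).1.1 1 = 0 := by
    intro v
    have h1 : ∀ u : U, (s (ρ u v)).1.1 1 = (s v).1.1 1 := by
      intro u
      rw [← hval]
      have := (s v).1.2 ⟨u, hUP u.2⟩ 1
      rw [mul_one, hτ _ u.2] at this
      exact this
    have h2 : (∑ u : U, s (ρ u v)).1.1 1 = Nat.card U • (s v).1.1 1 := by
      let L : q →ₗ[R] W := (LinearMap.proj 1 ∘ₗ (indCarrier P τ).subtype) ∘ₗ q.subtype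
      change L _ = Nat.card U • L (s v)
      have h1' : ∀ u : U, L (s (ρ u v)) = L (s v) := h1
      rw [map_sum]
      simp [h1']
    rw [← hs_add, hU, hs_zero] at h2
    have h3 : (Nat.card U : R) • (s v).1.1 1 = 0 := by
      rw [Nat.cast_smul_eq_nsmul]; exact h2.symm
    exact (smul_eq_zero.1 h3).resolve_left (Nat.cast_ne_zero.2 Nat.card_pos.ne')
  apply hρ
  rw [eq_comm, Submodule.eq_bot_iff]
  intro v _
  have hsv : s v = 0 := by
    ext x
    rw [hval, hone]; rfl
  have := hfs v
  rw [hsv, map_zero, eq_comm] at this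
  exact (smul_eq_zero.1 this).resolve_left (Nat.cast_ne_zero.2 Nat.card_pos.ne')

end Cuspidality

section UnipotentRadical

variable {k V : Type*} [Field k] [AddCommGroup V] [Module k V]

/-- The automorphisms which act trivially on a subspace and on the quotient by it. -/
def unipotentRadical (W : Submodule k V) : Subgroup (V ≃ₗ[k] V) where
  carrier := {g | (∀ v, g v - v ∈ W) ∧ ∀ w ∈ W, g w = w}
  one_mem' := by simp
  mul_mem' := by
    rintro a b ⟨ha, ha'⟩ ⟨hb, hb'⟩
    refine ⟨fun v => ?_, fun w hw => ?_⟩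
    · have := W.add_mem (ha (b v)) (hb v)
      rwa [sub_add_sub_cancel] at this
    · rw [LinearEquiv.mul_apply, hb' w hw, ha' w hw]
  inv_mem' := by
    rintro a ⟨ha, ha'⟩
    have hinv : ∀ v, a (a⁻¹ v) = v := a.apply_symm_apply
    refine ⟨fun v => ?_, fun w hw => ?_⟩
    · have := W.neg_mem (ha (a⁻¹ v))
      rwa [hinv, neg_sub] at this
    · apply a.injective
      rw [hinv, ha' w hw]

end UnipotentRadical

section Transfer

open Representation Module

/-- The identification of the general linear group with the automorphisms of a vector space
with a given basis. -/
noncomputable def glEquivOfBasis {k V : Type} [Field k] [AddCommGroup V] [Module k V] {n : ℕ}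
    (b : Basis (Fin n) k V) : GL (Fin n) k ≃* (V ≃ₗ[k] V) :=
  (Units.mapEquiv (Matrix.toLinAlgEquiv b).toMulEquiv).trans
    (LinearMap.GeneralLinearGroup.generalLinearEquiv k V)

lemma glEquivOfBasis_repr {k V : Type} [Field k] [AddCommGroup V] [Module k V] {n : ℕ}
    (b : Basis (Fin n) k V) (g : GL (Fin n) k) (i j : Fin n) :
    b.repr (glEquivOfBasis b g (b j)) i = (g : Matrix (Fin n) (Fin n) k) i j := by
  change b.repr (Matrix.toLinAlgEquiv b (g : Matrix (Fin n) (Fin n) k) (b j)) i = _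
  simp [Matrix.toLinAlgEquiv_self, Finsupp.single_apply]

lemma IsIrreducibleRep.comp_mulEquiv {G H : Type} [Group G] [Group H] {M : Type} [AddCommGroup M]
    {R : Type} [Field R] [Module R M] {ρ : Representation R H M} (hρ : IsIrreducibleRep ρ) (e : G ≃* H) :
    IsIrreducibleRep (ρ.comp e.toMonoidHom) := by
  refine ⟨hρ.1, fun W hW => hρ.2 W fun h v hv => ?_⟩
  have := hW (e.symm h) v hv
  simpa using this

variable {k : Type} [Field k] {R : Type} [Field R] [CharZero R]

/-- An irreducible representation without invariants under unipotent radicals is supercuspidal. -/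
lemma isSupercuspidal_of_sum_char {n : ℕ} {V : Type} [AddCommGroup V] [Module k V]
    (b : Basis (Fin n) k V) {M : Type} [AddCommGroup M] [Module R M] [FiniteDimensional R M]
    [Fintype (V ≃ₗ[k] V)]
    (ρ : Representation R (V ≃ₗ[k] V) M) (hρ : IsIrreducibleRep ρ)
    (h : ∀ W : Submodule k V, W ≠ ⊥ → W ≠ ⊤ → ∀ [Fintype (unipotentRadical W)],
      ∑ u : unipotentRadical W, ρ.character u = 0) :
    IsSupercuspidal k (ρ.comp (glEquivOfBasis b).toMonoidHom) := by
  classical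
  intro r hr B _ hBs W _ _ τ hτ
  set e := glEquivOfBasis b
  let E : Submodule k V := ⨅ i ∈ {i | (B i : ℕ) ≠ 0}, LinearMap.ker (b.coord i)
  have hE : ∀ v, v ∈ E ↔ ∀ i, (B i : ℕ) ≠ 0 → b.repr v i = 0 := by
    intro v; simp [E, Submodule.mem_iInf]
  have hbE : ∀ j, (B j : ℕ) = 0 → b j ∈ E := by
    intro j hj
    rw [hE]
    intro i hi
    rw [b.repr_self, Finsupp.single_apply, if_neg]
    rintro rfl; exact hi hj
  have hE0 : E ≠ ⊥ := by
    obtain ⟨j, hj⟩ := hBs ⟨0, by omega⟩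
    intro h0
    have := hbE j (by rw [hj])
    rw [h0, Submodule.mem_bot] at this
    exact b.ne_zero j this
  have hE1 : E ≠ ⊤ := by
    obtain ⟨j, hj⟩ := hBs ⟨1, by omega⟩
    intro h1
    have : b j ∈ E := by rw [h1]; trivial
    have := (hE _).1 this j (by rw [hj]; simp)
    simp at this
  let U : Subgroup (GL (Fin n) k) := (unipotentRadical E).comap e.toMonoidHom
  have hent : ∀ u ∈ U, ∀ i j, ((B i : ℕ) ≠ 0 ∨ (B j : ℕ) = 0) →
      (u : Matrix (Fin n) (Fin n) k) i j = (1 : Matrix (Fin n) (Fin n) k) i j := by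
    intro u hu i j hij
    obtain ⟨hu1, hu2⟩ : e u ∈ unipotentRadical E := hu
    rw [← glEquivOfBasis_repr b, Matrix.one_apply]
    have hsing : b.repr (b j) i = if i = j then 1 else 0 := by
      rw [b.repr_self, Finsupp.single_apply]; simp [eq_comm]
    rw [← hsing]
    rcases hij with hi | hj
    · have := (hE _).1 (hu1 (b j)) i hi
      rw [map_sub, Finsupp.sub_apply, sub_eq_zero] at this
      exact this
    · exact congrArg (fun v => b.repr v i) (hu2 (b j) (hbE j hj))
  have hUP : U ≤ parabolic k n r B := by
    intro u hu i j hij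
    have hij' : (B j : ℕ) < B i := hij
    rw [hent u hu i j (Or.inl (by omega)), Matrix.one_apply, if_neg]
    rintro rfl; exact lt_irrefl _ hij
  have hfin : Finite (GL (Fin n) k) := Finite.of_equiv _ e.symm.toEquiv
  let := Fintype.ofFinite (GL (Fin n) k)
  let := Fintype.ofFinite U
  let := Fintype.ofFinite (unipotentRadical E)
  refine not_isSubquotientOf_inducedRep hρ.1 τ U hUP (fun u hu => hτ _ fun i j hij => ?_) ?_
  · refine hent u hu i j ?_
    rw [hij]; tauto
  · intro v
    rw [← sum_apply_eq_zero_of_sum_char ρ (unipotentRadical E) (h E hE0 hE1) v]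
    refine Fintype.sum_equiv ((e.subgroupMap U).trans
      (MulEquiv.subgroupCongr ?_)).toEquiv _ _ fun u => ?_
    · exact Subgroup.map_comap_eq_self_of_surjective e.surjective _
    · rfl

end Transfer

section CyclotomicNumber

open Polynomial

/-- A number, the value of a cyclotomic polynomial, dividing `q ^ n - 1` but no earlier term, in a
strong sense. -/
lemma exists_cyclotomic_divisor {q m : ℕ} (hq : 3 ≤ q) (hm : 0 < m) :
    ∃ N : ℕ, (∀ d, d ∣ 2 * m → d < 2 * m → N * (q ^ d - 1) ∣ q ^ (2 * m) - 1) ∧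
      N ∣ q ^ m + 1 ∧ ∀ i, 0 < i → i < 2 * m → ¬ N ∣ q ^ i - 1 := by
  set n := 2 * m with hn
  have hbound : (2 : ℝ) ^ n.totient < ((cyclotomic n ℤ).eval (q : ℤ) : ℤ) := by
    have h1 : (((cyclotomic n ℤ).eval (q : ℤ) : ℤ) : ℝ) = (cyclotomic n ℝ).eval (q : ℝ) := by
      have := eval_intCast_map (Int.castRingHom ℝ) (cyclotomic n ℤ) (q : ℤ)
      rw [map_cyclotomic_int] at this
      simpa using this.symm
    have hq' : (3 : ℝ) ≤ q := by exact_mod_cast hq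
    rw [h1]
    refine lt_of_le_of_lt ?_ (sub_one_pow_totient_lt_cyclotomic_eval (n := n) (q := q) (by omega)
      (by linarith))
    gcongr
    linarith
  have hpos : 0 < (cyclotomic n ℤ).eval (q : ℤ) := by
    have : (0 : ℝ) < ((cyclotomic n ℤ).eval (q : ℤ) : ℤ) := lt_trans (by positivity) hbound
    exact_mod_cast this
  obtain ⟨N, hN⟩ := Int.eq_ofNat_of_zero_le hpos.le
  have hbd : 2 ^ n.totient < N := by
    rw [hN] at hbound
    exact_mod_cast hbound
  have hone : ∀ d, 1 ≤ q ^ d := fun d => Nat.one_le_pow _ _ (by omega)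
  have hdvd : ∀ d, d ∣ n → d < n → N * (q ^ d - 1) ∣ q ^ n - 1 := by
    intro d hd hdn
    have h1 := map_dvd (evalRingHom (q : ℤ)) (X_pow_sub_one_mul_cyclotomic_dvd_X_pow_sub_one_of_dvd
      ℤ (Nat.mem_properDivisors.2 ⟨hd, hdn⟩))
    simp only [map_mul, coe_evalRingHom, eval_sub, eval_pow, eval_X, eval_one, hN] at h1
    rw [mul_comm] at h1
    have h2 : ((N * (q ^ d - 1) : ℕ) : ℤ) ∣ ((q ^ n - 1 : ℕ) : ℤ) := by
      push_cast [hone d, hone n]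
      exact h1
    exact Int.natCast_dvd_natCast.1 h2
  have hpos' : ∀ d, 0 < d → 0 < q ^ d - 1 := by
    intro d hd
    have : q ^ 1 ≤ q ^ d := Nat.pow_le_pow_right (by omega) hd
    rw [pow_one] at this
    omega
  have hNm : N ∣ q ^ m + 1 := by
    have h1 := hdvd m ⟨2, by omega⟩ (by omega)
    have h2 : q ^ n - 1 = (q ^ m + 1) * (q ^ m - 1) := by
      rw [hn, mul_comm 2 m, pow_mul, sq]
      have := Nat.mul_self_sub_mul_self_eq (q ^ m) 1
      simpa using this
    rw [h2] at h1
    exact Nat.dvd_of_mul_dvd_mul_right (hpos' m hm) h1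
  refine ⟨N, hdvd, hNm, fun i hi hin hNi => ?_⟩
  have hNn : N ∣ q ^ n - 1 := (Dvd.intro _ rfl).trans (hdvd 1 (one_dvd _) (by omega))
  set d := i.gcd n with hd
  have hNd : N ∣ q ^ d - 1 := by
    rw [hd, ← Nat.pow_sub_one_gcd_pow_sub_one]
    exact Nat.dvd_gcd hNi hNn
  have hdn : d ∣ n := Nat.gcd_dvd_right _ _
  have hd0 : 0 < d := Nat.gcd_pos_of_pos_left _ hi
  have hdlt : d < n := (Nat.le_of_dvd hi (Nat.gcd_dvd_left _ _)).trans_lt hin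
  obtain ⟨l, hl⟩ := hdn
  have hNl : N ∣ l := by
    have h1 := hdvd d ⟨l, hl⟩ hdlt
    have hgeom : (∑ j ∈ Finset.range l, (q ^ d) ^ j) * (q ^ d - 1) = q ^ n - 1 := by
      have := Nat.geomSum_eq (m := q ^ d) (by have := hpos' d hd0; omega) l
      rw [this, hl, pow_mul]
      refine Nat.div_mul_cancel ?_
      simpa using Nat.sub_dvd_pow_sub_pow (q ^ d) 1 l
    rw [← hgeom] at h1
    have h2 := Nat.dvd_of_mul_dvd_mul_right (hpos' d hd0) h1
    have h3 : q ^ d ≡ 1 [MOD N] := ((Nat.modEq_iff_dvd' (hone d)).2 hNd).symm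
    have h4 : ∑ j ∈ Finset.range l, (q ^ d) ^ j ≡ l [MOD N] := by
      have : ∑ j ∈ Finset.range l, (q ^ d) ^ j ≡ ∑ j ∈ Finset.range l, 1 [MOD N] := by
        refine Nat.ModEq.sum fun j _ => ?_
        simpa using h3.pow j
      simpa using this
    exact (h4.dvd_iff dvd_rfl).1 h2
  have hl0 : 0 < l := by
    rcases Nat.eq_zero_or_pos l with rfl | h
    · omega
    · exact h
  have hNl' : N ≤ l := Nat.le_of_dvd hl0 hNl
  rcases Nat.even_or_odd l with hev | hodd
  · obtain ⟨l', rfl⟩ := hev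
    have hdm : d ∣ m := by
      have : n = 2 * (d * l') := by rw [hl]; ring
      exact ⟨l', by omega⟩
    have h1 : N ∣ q ^ m - 1 := hNd.trans (Nat.pow_sub_one_dvd_pow_sub_one q hdm)
    have h2 : N ∣ 2 := by
      have := Nat.dvd_sub hNm h1
      have h3 : q ^ m + 1 - (q ^ m - 1) = 2 := by have := hone m; omega
      rwa [h3] at this
    have h3 := Nat.le_of_dvd two_pos h2
    have h4 : 2 ^ 1 ≤ 2 ^ n.totient :=
      Nat.pow_le_pow_right two_pos (Nat.totient_pos.2 (by omega))
    omega
  · have h1 : 2 ^ l.totient ≡ 1 [MOD l] := Nat.ModEq.pow_totient (Nat.coprime_two_left.2 hodd)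
    have h2 : l ∣ 2 ^ l.totient - 1 := (Nat.modEq_iff_dvd' Nat.one_le_two_pow).1 h1.symm
    have h3 : 0 < 2 ^ l.totient - 1 := by
      have : 2 ^ 1 ≤ 2 ^ l.totient := Nat.pow_le_pow_right two_pos (Nat.totient_pos.2 hl0)
      omega
    have h4 := Nat.le_of_dvd h3 h2
    have h5 : 2 ^ l.totient ≤ 2 ^ n.totient :=
      Nat.pow_le_pow_right two_pos (Nat.le_of_dvd (Nat.totient_pos.2 (by omega))
        (Nat.totient_dvd_of_dvd ⟨d, by rw [hl, mul_comm]⟩))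
    omega

/-- Existence of a character of the multiplicative group of a finite field which is conjugate
selfdual and in general position, and trivial on the non-generators of a given field extension. -/
lemma exists_selfdual_regular_character {k K R : Type} [Field k] [Fintype k] [Field K] [Fintype K]
    [Algebra k K] [Field R] [IsAlgClosed R] [CharZero R] {m : ℕ} (hq : 3 ≤ Fintype.card k)
    (hm : 0 < m) (hrank : Module.finrank k K = 2 * m) :
    ∃ θ : Kˣ →* Rˣ,
      (∀ t : Kˣ, IntermediateField.adjoin k {(t : K)} ≠ ⊤ → θ t = 1) ∧
      (∀ σ : K ≃ₐ[k] K, (∀ t : Kˣ, θ (Units.map (σ : K →* K) t) = θ t) → σ = 1) ∧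
      ∃ σ : K ≃ₐ[k] K, ∀ t : Kˣ, θ (Units.map (σ : K →* K) t) = (θ t)⁻¹ := by
  obtain ⟨N, hN1, hN2, hN3⟩ := exists_cyclotomic_divisor hq hm
  set q := Fintype.card k
  have hcardK : Fintype.card K = q ^ (2 * m) := by
    rw [Module.card_eq_pow_finrank (K := k), hrank]
  have hcard : Nat.card Kˣ = q ^ (2 * m) - 1 := by
    rw [Nat.card_units, Nat.card_eq_fintype_card, hcardK]
  have hN0 : N ≠ 0 := by rintro rfl; simp at hN2
  obtain ⟨γ, hγ⟩ := IsCyclic.exists_generator (α := Kˣ)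
  have hγo : orderOf γ = q ^ (2 * m) - 1 := by
    rw [orderOf_eq_card_of_forall_mem_zpowers hγ, hcard]
  have : NeZero (N : R) := ⟨Nat.cast_ne_zero.2 hN0⟩
  obtain ⟨ζ', hζ'⟩ := HasEnoughRootsOfUnity.exists_primitiveRoot R N
  obtain ⟨ζ, rfl⟩ := hζ'.isUnit hN0
  have hζ := IsPrimitiveRoot.coe_units_iff.1 hζ'
  have hNn : N ∣ q ^ (2 * m) - 1 :=
    (Dvd.intro _ rfl).trans (hN1 1 (one_dvd _) (by omega))
  have hdiv : orderOf ζ ∣ orderOf γ := by rw [← hζ.eq_orderOf, hγo]; exact hNn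
  set θ : Kˣ →* Rˣ := monoidHomOfForallMemZpowers hγ hdiv
  have hθγ : θ γ = ζ := monoidHomOfForallMemZpowers_apply_gen hγ hdiv
  have hone : ∀ d, 1 ≤ q ^ d := fun d => Nat.one_le_pow _ _ (by omega)
  have hθN : ∀ t, θ t ^ N = 1 := by
    intro t
    obtain ⟨a, rfl⟩ := Subgroup.mem_zpowers_iff.1 (hγ t)
    rw [map_zpow, hθγ, ← zpow_natCast, ← _root_.zpow_mul, mul_comm, _root_.zpow_mul, zpow_natCast,
      hζ.pow_eq_one, _root_.one_zpow]
  refine ⟨θ, fun t ht => ?_, fun σ hσ => ?_, ?_⟩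
  · set F := IntermediateField.adjoin k {(t : K)}
    have hFr : Module.finrank k F * Module.finrank F K = 2 * m := by
      rw [Module.finrank_mul_finrank, hrank]
    set d := Module.finrank k F with hd
    have hdd : d ∣ 2 * m := Dvd.intro _ hFr
    have hdlt : d < 2 * m := by
      refine lt_of_le_of_ne (Nat.le_of_dvd (by omega) hdd) fun h => ht ?_
      exact IntermediateField.eq_of_le_of_finrank_eq le_top (by
        rw [← hd, h, ← hrank]; exact (IntermediateField.finrank_top').symm)
    have htF : (t : K) ∈ F := IntermediateField.mem_adjoin_simple_self k _
    have : Fintype F := Fintype.ofFinite F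
    have hcF : Fintype.card F = q ^ d := Module.card_eq_pow_finrank
    have htd : t ^ (q ^ d - 1) = 1 := by
      have h1 := FiniteField.pow_card_sub_one_eq_one (⟨t, htF⟩ : F) (by
        intro h; exact t.ne_zero (congrArg Subtype.val h))
      rw [hcF] at h1
      ext
      exact congrArg Subtype.val h1
    obtain ⟨a, rfl⟩ := mem_powers_iff_mem_zpowers.2 (hγ t)
    simp only at htd ⊢
    rw [← pow_mul, ← orderOf_dvd_iff_pow_eq_one, hγo] at htd
    have h2 := (hN1 d hdd hdlt).trans htd
    have h3 : N ∣ a := by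
      refine Nat.dvd_of_mul_dvd_mul_right ?_ h2
      have : 0 < d := Module.finrank_pos
      have : q ^ 1 ≤ q ^ d := Nat.pow_le_pow_right (by omega) this
      rw [pow_one] at this
      omega
    rw [map_pow, hθγ, (hζ.pow_eq_one_iff_dvd _).2 h3]
  · obtain ⟨⟨i, hi⟩, rfl⟩ := (FiniteField.bijective_frobeniusAlgEquivOfAlgebraic_pow k K).2 σ
    rcases Nat.eq_zero_or_pos i with rfl | hi0
    · simp
    · exfalso
      rw [hrank] at hi
      refine hN3 i hi0 hi ?_
      have h1 : Units.map ((FiniteField.frobeniusAlgEquivOfAlgebraic k K ^ i : K ≃ₐ[k] K) : K →* K)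
          γ = γ ^ (q ^ i) := by
        ext
        simp only [Units.coe_map, Units.val_pow_eq_pow_val]
        change (FiniteField.frobeniusAlgEquivOfAlgebraic k K ^ i) (γ : K) = _
        rw [AlgEquiv.coe_pow, FiniteField.coe_frobeniusAlgEquivOfAlgebraic_iterate]
      have h2 := hσ γ
      simp only at h2
      rw [h1, map_pow, hθγ] at h2
      rw [← hζ.pow_eq_one_iff_dvd]
      have h3 : ζ ^ (q ^ i - 1) * ζ = 1 * ζ := by
        rw [← pow_succ, Nat.sub_add_cancel (hone i), h2, one_mul]
      exact mul_right_cancel h3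
  · refine ⟨FiniteField.frobeniusAlgEquivOfAlgebraic k K ^ m, fun t => ?_⟩
    have h1 : Units.map ((FiniteField.frobeniusAlgEquivOfAlgebraic k K ^ m : K ≃ₐ[k] K) : K →* K)
        t = t ^ (q ^ m) := by
      ext
      simp only [Units.coe_map, Units.val_pow_eq_pow_val]
      change (FiniteField.frobeniusAlgEquivOfAlgebraic k K ^ m) (t : K) = _
      rw [AlgEquiv.coe_pow, FiniteField.coe_frobeniusAlgEquivOfAlgebraic_iterate]
    rw [h1, map_pow, eq_inv_iff_mul_eq_one, ← pow_succ]
    obtain ⟨c, hc⟩ := hN2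
    rw [hc, pow_mul, hθN, one_pow]

end CyclotomicNumber

section CharacterConstructions

open Representation Module

variable {R : Type} [Field R] {G : Type} [Group G]

/-- An idempotent commuting with a representation cuts out a subrepresentation. -/
lemma isVirtualChar_trace_comp_idempotent {V : Type} [AddCommGroup V] [Module R V]
    [FiniteDimensional R V] (ρ : Representation R G V) (e : V →ₗ[R] V) (he : ∀ v, e (e v) = e v)
    (hρ : ∀ g v, e (ρ g v) = ρ g (e v)) :
    IsVirtualChar fun g => LinearMap.trace R V (ρ g ∘ₗ e) := by
  have hI : ∀ g, LinearMap.range e ≤ (LinearMap.range e).comap (ρ g) := by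
    rintro g _ ⟨v, rfl⟩
    exact ⟨ρ g v, hρ g v⟩
  convert IsVirtualChar.of_character (ρ.subrepresentation (LinearMap.range e) hI) using 1
  funext g
  have hIe : LinearMap.range e ≤ (LinearMap.range e).comap (ρ g ∘ₗ e) := by
    rintro _ ⟨v, rfl⟩
    exact ⟨ρ g v, by simp [he, hρ]⟩
  rw [LinearMap.trace_eq_trace_restrict_add_trace_mapQ (LinearMap.range e) (ρ g ∘ₗ e) hIe]
  have h0 : (LinearMap.range e).mapQ (LinearMap.range e) (ρ g ∘ₗ e) hIe = 0 := by
    refine Submodule.linearMap_qext _ (LinearMap.ext fun v => ?_)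
    simp only [LinearMap.comp_apply, Submodule.mapQ_apply, Submodule.mkQ_apply,
      LinearMap.zero_apply]
    rw [Submodule.Quotient.mk_eq_zero]
    exact ⟨ρ g v, hρ g v⟩
  have h1 : (ρ g ∘ₗ e).restrict hIe = (ρ.subrepresentation (LinearMap.range e) hI) g := by
    ext ⟨_, v, rfl⟩
    change ρ g (e (e v)) = ρ g (e v)
    rw [he]
  rw [h0, map_zero, add_zero, h1]
  rfl

lemma trace_pi_eq_sum {X : Type} [Fintype X] [DecidableEq X] (f : (X → R) →ₗ[R] (X → R)) :
    LinearMap.trace R (X → R) f = ∑ x, f (Pi.single x 1) x := by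
  rw [LinearMap.trace_eq_matrix_trace R (Pi.basisFun R X), Matrix.trace]
  simp

/-- The permutation representation on functions. -/
def functionRep (R : Type) [Field R] (G : Type) [Group G] (X : Type) [MulAction G X] :
    Representation R G (X → R) where
  toFun g := LinearMap.funLeft R R fun x => g⁻¹ • x
  map_one' := by ext; simp [LinearMap.funLeft]
  map_mul' g h := by
    refine LinearMap.ext fun f => funext fun x => ?_
    simp [LinearMap.funLeft, mul_smul]

@[simp]
lemma functionRep_apply {X : Type} [MulAction G X] (g : G) (f : X → R) (x : X) :
    functionRep R G X g f x = f (g⁻¹ • x) := rfl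

/-- The number of fixed points, weighted by an invariant weight, is a virtual character. -/
lemma isVirtualChar_sum_fixed {X : Type} [MulAction G X] [Fintype X] [DecidableEq X] (w : X → ℕ)
    (hw : ∀ (g : G) x, w (g • x) = w x) :
    IsVirtualChar fun g : G => ∑ x : X, if g • x = x then (w x : R) else 0 := by
  obtain ⟨N, hN⟩ : ∃ N, ∀ x, w x ≤ N :=
    ⟨∑ x, w x, fun x => Finset.single_le_sum (fun _ _ => Nat.zero_le _) (Finset.mem_univ x)⟩
  let e : ℕ → (X → R) →ₗ[R] (X → R) := fun j =>
    LinearMap.pi fun x => (if j < w x then (1 : R) else 0) • LinearMap.proj x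
  have he : ∀ j f x, e j f x = if j < w x then f x else 0 := by
    intro j f x; by_cases h : j < w x <;> simp [e, h]
  have key : ∀ j ∈ Finset.range N, IsVirtualChar fun g : G =>
      LinearMap.trace R (X → R) (functionRep R G X g ∘ₗ e j) := by
    intro j _
    refine isVirtualChar_trace_comp_idempotent _ _ (fun f => funext fun x => ?_)
      (fun g f => funext fun x => ?_)
    · simp only [he]; split_ifs <;> rfl
    · simp only [he, functionRep_apply, hw]
  convert IsVirtualChar.sum _ key using 1
  funext g
  rw [Finset.sum_apply]
  simp only [trace_pi_eq_sum, LinearMap.comp_apply, functionRep_apply, he]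
  rw [Finset.sum_comm]
  refine Finset.sum_congr rfl fun x _ => ?_
  simp only [hw, Pi.single_apply, inv_smul_eq_iff]
  by_cases hx : x = g • x
  · rw [if_pos hx.symm]
    have : (Finset.range N).filter (fun j => j < w x) = Finset.range (w x) := by
      ext j; have := hN x; simp; omega
    simp only [if_pos hx]
    rw [← Finset.sum_filter, this]
    simp
  · rw [if_neg fun h => hx h.symm]
    simp [hx]

/-- The character induced from a linear character of a subgroup. -/
lemma isVirtualChar_induced [CharZero R] [Fintype G] [DecidableEq G] {H : Type} [Group H]
    [Fintype H]
    (ι : H →* G) (θ : H →* Rˣ) : IsVirtualChar fun g : G =>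
      (Nat.card H : R)⁻¹ * ∑ x : G, ∑ t : H, if x⁻¹ * g * x = ι t then (θ t : R) else 0 := by
  let e : (G → R) →ₗ[R] (G → R) :=
    LinearMap.pi fun x => (Nat.card H : R)⁻¹ • ∑ t : H, (θ t : R) • LinearMap.proj (x * ι t)
  have he : ∀ f x, e f x = (Nat.card H : R)⁻¹ * ∑ t : H, (θ t : R) * f (x * ι t) := by
    intro f x; simp [e]
  convert isVirtualChar_trace_comp_idempotent (functionRep R G G) e (fun f => funext fun x => ?_)
    (fun g f => funext fun x => ?_) using 2 with g
  · simp only [trace_pi_eq_sum, LinearMap.comp_apply, functionRep_apply, he, smul_eq_mul]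
    rw [← Finset.mul_sum]
    congr 1
    refine Finset.sum_congr rfl fun x _ => Finset.sum_congr rfl fun t _ => ?_
    rw [Pi.single_apply, mul_ite, mul_one, mul_zero]
    refine if_congr ?_ rfl rfl
    rw [mul_assoc, inv_mul_eq_iff_eq_mul, mul_assoc, inv_mul_eq_iff_eq_mul, eq_comm]
  · have h1 : ∀ t : H, (θ t : R) * e f (x * ι t) = e f x := by
      intro t
      rw [he, he, mul_left_comm, Finset.mul_sum]
      congr 1
      rw [← Equiv.sum_comp (Equiv.mulLeft t) fun s => (θ s : R) * f (x * ι s)]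
      refine Finset.sum_congr rfl fun s _ => ?_
      simp [mul_assoc]
    rw [he, Finset.sum_congr rfl fun t _ => h1 t]
    simp
  · simp only [he, functionRep_apply, smul_eq_mul, mul_assoc]

end CharacterConstructions

section InducedFunctions

variable {R G H : Type} [Field R] [Group G] [Fintype G] [Group H] [Fintype H]

open Classical in
/-- The class function on `G` induced from a function on a group `H` along `ι : H →* G`. -/
noncomputable def inducedFun (ι : H →* G) (β : H → R) (g : G) : R :=
  (Nat.card H : R)⁻¹ * ∑ x : G, ∑ t : H, if x⁻¹ * g * x = ι t then β t else 0

lemma isVirtualChar_inducedFun_sub_one [CharZero R] (ι : H →* G) (θ : H →* Rˣ) :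
    IsVirtualChar (inducedFun ι fun t => (θ t : R) - 1) := by
  classical
  convert (isVirtualChar_induced ι θ).sub (isVirtualChar_induced ι (1 : H →* Rˣ)) using 1
  funext g
  simp only [inducedFun, Pi.sub_apply, ← mul_sub, ← Finset.sum_sub_distrib]
  congr 1
  refine Finset.sum_congr rfl fun x _ => Finset.sum_congr rfl fun t _ => ?_
  split_ifs <;> simp

lemma inducedFun_conj (ι : H →* G) (β : H → R) (y g : G) :
    inducedFun ι β (y * g * y⁻¹) = inducedFun ι β g := by
  classical
  unfold inducedFun
  congr 1
  rw [← Equiv.sum_comp (Equiv.mulLeft y)]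
  refine Finset.sum_congr rfl fun x _ => Finset.sum_congr rfl fun t _ => ?_
  refine if_congr ?_ rfl rfl
  simp [mul_assoc]

/-- Frobenius reciprocity for `inducedFun`. -/
lemma sum_inducedFun_mul (ι : H →* G) (β : H → R) (f : G → R)
    (hf : ∀ y g, f (y * g * y⁻¹) = f g) :
    ∑ g, inducedFun ι β g * f g = (Nat.card H : R)⁻¹ * Nat.card G * ∑ t, β t * f (ι t) := by
  classical
  have h : ∀ (x : G) (t : H),
      ∑ g : G, (if x⁻¹ * g * x = ι t then β t else 0) * f g = β t * f (ι t) := by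
    intro x t
    have h1 : ∀ g : G, x⁻¹ * g * x = ι t ↔ g = x * ι t * x⁻¹ := by
      intro g
      rw [eq_mul_inv_iff_mul_eq, mul_assoc, inv_mul_eq_iff_eq_mul]
    simp [h1, hf]
  have h2 : ∑ g : G, (∑ x : G, ∑ t : H, if x⁻¹ * g * x = ι t then β t else 0) * f g =
      Nat.card G * ∑ t, β t * f (ι t) := by
    simp only [Finset.sum_mul]
    rw [Finset.sum_comm]
    have h3 : ∀ x : G, ∑ g : G, ∑ t : H, (if x⁻¹ * g * x = ι t then β t else 0) * f g =
        ∑ t, β t * f (ι t) := by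
      intro x
      rw [Finset.sum_comm]
      exact Finset.sum_congr rfl fun t _ => h x t
    rw [Finset.sum_congr rfl fun x _ => h3 x]
    simp
  simp only [inducedFun]
  rw [mul_assoc, ← h2, Finset.mul_sum]
  exact Finset.sum_congr rfl fun g _ => mul_assoc _ _ _

lemma inducedFun_inv (ι : H →* G) (β : H → R) (σ : H ≃ H) (y : G)
    (hσ : ∀ t, ι (σ t) = y * ι t * y⁻¹) (hβ : ∀ t, β (σ t) = β t⁻¹) (g : G) :
    inducedFun ι β g⁻¹ = inducedFun ι β g := by
  classical
  unfold inducedFun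
  congr 1
  rw [← Equiv.sum_comp (Equiv.mulRight y⁻¹) fun x => ∑ t : H, if x⁻¹ * g * x = ι t then β t else 0]
  refine Finset.sum_congr rfl fun x _ => ?_
  refine (Equiv.sum_comp (Equiv.inv H) _).symm.trans (Eq.trans ?_ (Equiv.sum_comp σ _))
  refine Finset.sum_congr rfl fun t _ => ?_
  refine if_congr ?_ (hβ _).symm rfl
  simp only [Equiv.inv_apply, map_inv, hσ, Equiv.coe_mulRight, _root_.mul_inv_rev, inv_inv]
  rw [← _root_.inv_inj]
  simp only [_root_.mul_inv_rev, inv_inv, mul_assoc, mul_left_cancel_iff]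
  simp only [← mul_assoc, mul_left_inj]

lemma inducedFun_eq_zero (ι : H →* G) (β : H → R) (g : G)
    (h : ∀ x t, x⁻¹ * g * x = ι t → β t = 0) : inducedFun ι β g = 0 := by
  classical
  unfold inducedFun
  rw [Finset.sum_eq_zero, mul_zero]
  intro x _
  refine Finset.sum_eq_zero fun t _ => ?_
  split_ifs with h'
  · exact h x t h'
  · rfl

end InducedFunctions

section FieldMultiplication

variable {k K R : Type} [Field k] [Field K] [Algebra k K] [Field R]

/-- Multiplication by units of an extension field, as linear automorphisms. -/
def unitsMul (k K : Type) [Field k] [Field K] [Algebra k K] : Kˣ →* (K ≃ₗ[k] K) :=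
  DistribMulAction.toModuleAut k K

@[simp] lemma unitsMul_apply (t : Kˣ) (v : K) : unitsMul k K t v = t * v := rfl

lemma eq_one_of_conj_eq_unitsMul {g x : K ≃ₗ[k] K} {t : Kˣ} (h : x⁻¹ * g * x = unitsMul k K t)
    {v : K} (hv : v ≠ 0) (hg : g v = v) : t = 1 := by
  have h1 : g * x = x * unitsMul k K t := by rw [← h]; group
  have h2 := LinearEquiv.congr_fun h1 (x⁻¹ v)
  have h3 : x (x⁻¹ v) = v := x.apply_symm_apply v
  simp only [LinearEquiv.mul_apply, h3, hg, unitsMul_apply] at h2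
  have h4 : (x⁻¹ v : K) ≠ 0 := by
    intro h; rw [h, map_zero] at h3; exact hv h3.symm
  have h5 : x⁻¹ v = t * x⁻¹ v := x.injective (h3.trans h2)
  ext
  exact mul_right_cancel₀ h4 (by rw [← h5, Units.val_one, one_mul])

variable [FiniteDimensional k K]

lemma exists_algEquiv_of_conj {t t' : Kˣ} (ht : IntermediateField.adjoin k {(t : K)} = ⊤)
    {x : K ≃ₗ[k] K} (h : x⁻¹ * unitsMul k K t * x = unitsMul k K t') :
    ∃ (a : Kˣ) (σ : K ≃ₐ[k] K), x = unitsMul k K a * σ.toLinearEquiv ∧ σ t' = t := by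
  have h1 : unitsMul k K t * x = x * unitsMul k K t' := by rw [← h]; group
  have h2 : ∀ v, t * x v = x (t' * v) := fun v => LinearEquiv.congr_fun h1 v
  have hx1 : x 1 ≠ 0 := by simp
  let a : Kˣ := Units.mk0 (x 1) hx1
  let y : K ≃ₗ[k] K := (unitsMul k K a)⁻¹ * x
  have hy : ∀ v, x v = a * y v := by
    intro v
    change x v = unitsMul k K a ((unitsMul k K a)⁻¹ (x v))
    exact ((unitsMul k K a).apply_symm_apply _).symm
  have hy1 : y 1 = 1 := mul_left_cancel₀ hx1 (by rw [mul_one]; exact (hy 1).symm)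
  have hyt : ∀ v, y (t' * v) = t * y v := by
    intro v
    refine mul_left_cancel₀ hx1 ?_
    have := h2 v
    rw [hy, hy] at this
    rw [← mul_left_comm]
    exact this.symm
  let S : Subalgebra k K :=
    { carrier := {s | ∃ s', ∀ v, y (s' * v) = s * y v}
      mul_mem' := by
        rintro s r ⟨s', hs⟩ ⟨r', hr⟩
        exact ⟨s' * r', fun v => by rw [mul_assoc, hs, hr, mul_assoc]⟩
      add_mem' := by
        rintro s r ⟨s', hs⟩ ⟨r', hr⟩
        exact ⟨s' + r', fun v => by rw [add_mul, map_add, hs, hr, add_mul]⟩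
      algebraMap_mem' := by
        intro c
        exact ⟨algebraMap k K c, fun v => by
          rw [← Algebra.smul_def, ← Algebra.smul_def, map_smul]⟩ }
  have hS : S = ⊤ := by
    have h3 : Algebra.adjoin k {(t : K)} ≤ S := by
      rw [Algebra.adjoin_le_iff, Set.singleton_subset_iff]
      exact ⟨t', hyt⟩
    rw [← IntermediateField.adjoin_simple_toSubalgebra_of_isAlgebraic
      (Algebra.IsAlgebraic.isAlgebraic _), ht] at h3
    exact top_le_iff.mp h3
  have hmul : ∀ u v, y (u * v) = y u * y v := by
    intro u v
    obtain ⟨s', hs⟩ : y u ∈ S := hS ▸ Algebra.mem_top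
    have h4 := hs 1
    rw [mul_one, hy1, mul_one] at h4
    rw [← hs, y.injective h4]
  refine ⟨a, AlgEquiv.ofLinearEquiv y hy1 hmul, ?_, ?_⟩
  · ext v
    exact hy v
  · have := hyt 1
    rwa [mul_one, hy1, mul_one] at this

variable [Fintype Kˣ] [Fintype (K ≃ₗ[k] K)] [Fintype (K ≃ₐ[k] K)]

/-- The value of a function induced from `Kˣ` at a generator of `K` over `k`. -/
lemma inducedFun_unitsMul [CharZero R] (β : Kˣ → R) {t : Kˣ}
    (ht : IntermediateField.adjoin k {(t : K)} = ⊤) :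
    inducedFun (unitsMul k K) β (unitsMul k K t) =
      ∑ σ : K ≃ₐ[k] K, β (Units.map (σ : K →* K) t) := by
  classical
  unfold inducedFun
  rw [← Finset.sum_product', ← Finset.sum_filter]
  have key : ∑ p ∈ (Finset.univ ×ˢ Finset.univ : Finset ((K ≃ₗ[k] K) × Kˣ)) with
        p.1⁻¹ * unitsMul k K t * p.1 = unitsMul k K p.2, β p.2 =
      ∑ p : Kˣ × (K ≃ₐ[k] K), β (Units.map (p.2 : K →* K) t) := by
    symm
    refine Finset.sum_bij
      (fun p _ => (unitsMul k K p.1 * p.2.symm.toLinearEquiv, Units.map (p.2 : K →* K) t))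
      ?_ ?_ ?_ ?_
    · rintro ⟨a, σ⟩ -
      simp only [Finset.univ_product_univ, Finset.mem_filter, Finset.mem_univ, true_and]
      rw [mul_assoc, inv_mul_eq_iff_eq_mul]
      ext v
      simp
      ring
    · rintro ⟨a, σ⟩ - ⟨b, τ⟩ - h
      simp only [Prod.mk.injEq] at h
      have h1 : ∀ v, (a : K) * σ.symm v = b * τ.symm v := fun v => LinearEquiv.congr_fun h.1 v
      have hab : a = b := by ext; simpa using h1 1
      subst hab
      have : σ.symm = τ.symm := by
        ext v
        exact mul_left_cancel₀ a.ne_zero (h1 v)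
      rw [Prod.mk.injEq]
      exact ⟨rfl, by rw [← σ.symm_symm, this, τ.symm_symm]⟩
    · rintro ⟨x, t'⟩ h
      simp only [Finset.univ_product_univ, Finset.mem_filter, Finset.mem_univ, true_and] at h
      obtain ⟨a, σ, hx, hσ⟩ := exists_algEquiv_of_conj ht h
      refine ⟨(a, σ.symm), Finset.mem_univ _, ?_⟩
      rw [Prod.mk.injEq]
      refine ⟨by rw [hx]; rfl, ?_⟩
      ext
      simp [← hσ]
    · rintro ⟨a, σ⟩ -
      rfl
  rw [key, Fintype.sum_prod_type]
  simp only [Finset.sum_const, Finset.card_univ, nsmul_eq_mul, Nat.card_eq_fintype_card]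
  rw [inv_mul_cancel_left₀]
  exact Nat.cast_ne_zero.mpr Fintype.card_ne_zero

end FieldMultiplication

section TorusFunction

/-- The difference between the functions induced from a selfdual regular character of `Kˣ` and from
the trivial character. -/
lemma exists_torus_function {k K R : Type} [Field k] [Fintype k] [Field K] [Fintype K]
    [Algebra k K] [Fintype (K ≃ₗ[k] K)] [Field R] [IsAlgClosed R] [CharZero R] {m : ℕ}
    (hq : 3 ≤ Fintype.card k) (hm : 0 < m) (hrank : Module.finrank k K = 2 * m) :
    ∃ φ : (K ≃ₗ[k] K) → R, IsVirtualChar φ ∧ (∀ g, φ g⁻¹ = φ g) ∧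
      (∀ g v, v ≠ 0 → g v = v → φ g = 0) ∧
      (∑ g, φ g * φ g = Nat.card (K ≃ₗ[k] K) * (2 * m + 1)) ∧
      ∀ f : (K ≃ₗ[k] K) → R, (∀ y g, f (y * g * y⁻¹) = f g) →
        (∀ t : Kˣ, IntermediateField.adjoin k {(t : K)} = ⊤ → f (unitsMul k K t) = 2 * m) →
        ∑ g, φ g * f g = - (Nat.card (K ≃ₗ[k] K) * (2 * m)) := by
  classical
  obtain ⟨θ, hθ1, hθ2, σ₀, hθ3⟩ := exists_selfdual_regular_character (R := R) hq hm hrank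
  let β : Kˣ → R := fun t => (θ t : R) - 1
  have hβ : ∀ t : Kˣ, IntermediateField.adjoin k {(t : K)} ≠ ⊤ → β t = 0 := by
    intro t ht
    simp [β, hθ1 t ht]
  have hgal : Fintype.card (K ≃ₐ[k] K) = 2 * m := by
    rw [← hrank, ← Nat.card_eq_fintype_card, IsGalois.card_aut_eq_finrank]
  have hsum : ∀ χ : Kˣ →* Rˣ, χ ≠ 1 → ∑ t, (χ t : R) = 0 := by
    intro χ hχ
    have := sum_hom_units ((Units.coeHom R).comp χ)
    rw [if_neg] at this
    · exact this.trans Nat.cast_zero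
    · intro h
      refine hχ (MonoidHom.ext fun t => Units.ext ?_)
      exact DFunLike.congr_fun h t
  have hθ : θ ≠ 1 := by
    rintro rfl
    have h1 : Fintype.card (K ≃ₐ[k] K) ≤ 1 :=
      Fintype.card_le_one_iff_subsingleton.mpr
        ⟨fun a b => (hθ2 a (by simp)).trans (hθ2 b (by simp)).symm⟩
    omega
  have hcard : (Nat.card Kˣ : R) ≠ 0 := Nat.cast_ne_zero.mpr Nat.card_pos.ne'
  have hsumβ : ∑ t, β t = - Nat.card Kˣ := by
    simp [β, Finset.sum_sub_distrib, hsum θ hθ]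
  have hββ : ∀ σ : K ≃ₐ[k] K, ∑ t : Kˣ, β t * β (Units.map (σ : K →* K) t) =
      Nat.card Kˣ * (if σ = σ₀ then 2 else 1) := by
    intro σ
    have h1 : ∀ t, β t * β (Units.map (σ : K →* K) t) =
        ((θ * θ.comp (Units.map (σ : K →* K))) t : R) - β t - β (Units.map (σ : K →* K) t)
          - 1 := by
      intro t
      simp [β]
      ring
    have h2 : ∑ t : Kˣ, β (Units.map (σ : K →* K) t) = ∑ t, β t :=
      Equiv.sum_comp (Units.mapEquiv (σ : K ≃* K)).toEquiv β
    simp only [h1, Finset.sum_sub_distrib, h2, hsumβ]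
    split_ifs with h
    · have h3 : θ * θ.comp (Units.map (σ : K →* K)) = 1 := by
        ext t
        simp [h, hθ3]
      simp only [h3]
      simp
      ring
    · rw [hsum]
      · simp
      · intro h3
        refine h ?_
        have h4 : ∀ t, θ (Units.map (σ : K →* K) t) = (θ t)⁻¹ := fun t =>
          (inv_eq_of_mul_eq_one_right (DFunLike.congr_fun h3 t)).symm
        have h5 := hθ2 (σ * σ₀⁻¹) fun t => by
          have h6 := h4 (Units.map (σ₀⁻¹ : K ≃ₐ[k] K) t)
          have h7 := hθ3 (Units.map (σ₀⁻¹ : K ≃ₐ[k] K) t)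
          have h8 : Units.map (σ₀ : K →* K) (Units.map ((σ₀⁻¹ : K ≃ₐ[k] K) : K →* K) t) = t := by
            ext; exact σ₀.apply_symm_apply _
          rw [← h7, h8] at h6
          exact h6
        rw [← mul_inv_eq_one, h5]
  refine ⟨inducedFun (unitsMul k K) β, isVirtualChar_inducedFun_sub_one _ θ, ?_, ?_, ?_, ?_⟩
  · refine inducedFun_inv _ _ (Units.mapEquiv (σ₀ : K ≃* K)).toEquiv σ₀.toLinearEquiv ?_ ?_
    · intro t
      rw [eq_mul_inv_iff_mul_eq]
      ext v
      exact (map_mul σ₀ (t : K) v).symm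
    · intro t
      have := hθ3 t
      simp only [β]
      rw [map_inv, ← this]
      rfl
  · intro g v hv hg
    refine inducedFun_eq_zero _ _ _ fun x t h => ?_
    simp [β, eq_one_of_conj_eq_unitsMul h hv hg]
  · rw [sum_inducedFun_mul _ _ _ (inducedFun_conj _ _)]
    have h1 : ∀ t, β t * inducedFun (unitsMul k K) β (unitsMul k K t) =
        ∑ σ : K ≃ₐ[k] K, β t * β (Units.map (σ : K →* K) t) := by
      intro t
      by_cases ht : IntermediateField.adjoin k {(t : K)} = ⊤
      · rw [inducedFun_unitsMul _ ht, Finset.mul_sum]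
      · simp [hβ t ht]
    have h2 : ∀ σ : K ≃ₐ[k] K, (if σ = σ₀ then (2 : R) else 1) = (if σ = σ₀ then 1 else 0) + 1 := by
      intro σ; split_ifs <;> norm_num
    rw [Finset.sum_congr rfl fun t _ => h1 t, Finset.sum_comm]
    simp only [hββ, ← Finset.mul_sum, h2, Finset.sum_add_distrib]
    simp only [Finset.sum_ite_eq', Finset.mem_univ, if_true, Finset.sum_const, Finset.card_univ,
      hgal]
    field_simp
    ring
  · intro f hf hf'
    rw [sum_inducedFun_mul _ _ _ hf]
    have h1 : ∀ t, β t * f (unitsMul k K t) = β t * (2 * m) := by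
      intro t
      by_cases ht : IntermediateField.adjoin k {(t : K)} = ⊤
      · rw [hf' t ht]
      · simp [hβ t ht]
    rw [Finset.sum_congr rfl fun t _ => h1 t, ← Finset.sum_mul, hsumβ]
    field_simp

end TorusFunction

section MonotoneChains

variable {α R : Type} [PartialOrder α] [Field R]

open Classical in
/-- The monotone maps `Fin s → α` with values in a finite set `L`. -/
noncomputable def monoChains (L : Finset α) (s : ℕ) : Finset (Fin s → α) :=
  {x ∈ Fintype.piFinset fun _ => L | Monotone x}

lemma mem_monoChains {L : Finset α} {s : ℕ} {x : Fin s → α} :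
    x ∈ monoChains L s ↔ (∀ i, x i ∈ L) ∧ Monotone x := by
  simp [monoChains]

/-- The first member of a finite sequence followed by `t`. -/
def chainHead {α : Type} (t : α) : ∀ {s : ℕ}, (Fin s → α) → α
  | 0, _ => t
  | _ + 1, x => x 0

lemma chainHead_comp {α β : Type} (f : α → β) (t : α) {s : ℕ} (x : Fin s → α) :
    chainHead (f t) (fun i => f (x i)) = f (chainHead t x) := by
  cases s <;> rfl

/-- The sum of `h` over the first members of the monotone chains in `L`. -/
noncomputable def chainSum (L : Finset α) (t : α) (h : α → R) (s : ℕ) : R :=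
  ∑ x ∈ monoChains L s, h (chainHead t x)

open Classical in
/-- Summation over the elements of `L` below a given one. -/
noncomputable def lowerSum (R : Type) [Field R] (L : Finset α) : Module.End R (α → R) :=
  LinearMap.pi fun y => ∑ x ∈ L with x ≤ y, LinearMap.proj x

open Classical in
lemma lowerSum_apply (L : Finset α) (h : α → R) (y : α) :
    lowerSum R L h y = ∑ x ∈ L with x ≤ y, h x := by
  simp [lowerSum]

lemma monotone_cons_iff {s : ℕ} (t y : α) (hy : y ≤ t) (x : Fin s → α) :
    Monotone (Fin.cons y x : Fin (s + 1) → α) ↔ y ≤ chainHead t x ∧ Monotone x := by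
  cases s with
  | zero =>
    simp only [chainHead, hy, true_and]
    exact iff_of_true (Subsingleton.monotone (α := Fin 1) _) (Subsingleton.monotone _)
  | succ s =>
    rw [Fin.monotone_iff_le_succ, Fin.forall_fin_succ, Fin.monotone_iff_le_succ]
    simp [chainHead]

lemma chainSum_eq_lowerSum_pow (L : Finset α) (t : α) (ht : ∀ y ∈ L, y ≤ t) (h : α → R) (s : ℕ) :
    chainSum L t h s = (lowerSum R L ^ s) h t := by
  classical
  induction s generalizing h with
  | zero =>
    have : monoChains L 0 = Finset.univ := by
      ext x
      simp only [mem_monoChains, Subsingleton.monotone, and_true, Finset.mem_univ, iff_true]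
      exact fun i => i.elim0
    simp [chainSum, this, chainHead]
  | succ s ih =>
    rw [pow_succ, Module.End.mul_apply, ← ih, chainSum, chainSum]
    simp only [lowerSum_apply]
    rw [Finset.sum_sigma']
    refine Finset.sum_bij' (fun x _ => ⟨Fin.tail x, x 0⟩) (fun p _ => Fin.cons p.2 p.1) ?_ ?_ ?_ ?_ ?_
    · intro x hx
      rw [mem_monoChains] at hx
      have hx' : Monotone (Fin.cons (x 0) (Fin.tail x) : Fin (s + 1) → α) := by
        rw [Fin.cons_self_tail]
        exact hx.2
      rw [monotone_cons_iff t _ (ht _ (hx.1 0))] at hx'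
      simp only [Finset.mem_sigma, mem_monoChains, Finset.mem_filter]
      exact ⟨⟨fun i => hx.1 i.succ, hx'.2⟩, hx.1 0, hx'.1⟩
    · rintro ⟨x, y⟩ hp
      simp only [Finset.mem_sigma, mem_monoChains, Finset.mem_filter] at hp
      rw [mem_monoChains, monotone_cons_iff t _ (ht _ hp.2.1)]
      refine ⟨Fin.cases hp.2.1 hp.1.1, hp.2.2, hp.1.2⟩
    · intro x _
      exact Fin.cons_self_tail x
    · rintro ⟨x, y⟩ _
      rfl
    · intro x _
      rfl

lemma lowerSum_sub_one_pow_eq_zero (L : Finset α) (rk : α → ℕ)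
    (hrk : ∀ x ∈ L, ∀ y ∈ L, x < y → rk x < rk y) (h : α → R) (e : ℕ)
    (he : ∀ x ∈ L, rk x < e → h x = 0) (j : ℕ) {y : α} (hy : y ∈ L) (hj : rk y < e + j) :
    ((lowerSum R L - 1) ^ j) h y = 0 := by
  classical
  induction j generalizing y with
  | zero => exact he y hy hj
  | succ j ih =>
    rw [pow_succ', Module.End.mul_apply, LinearMap.sub_apply, Pi.sub_apply, lowerSum_apply,
      Module.End.one_apply, ← Finset.sum_erase_add _ _ (a := y) (by simp [hy]), add_sub_cancel_right]
    refine Finset.sum_eq_zero fun x hx => ?_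
    simp only [Finset.mem_erase, Finset.mem_filter] at hx
    have := hrk x hx.2.1 y hy (lt_of_le_of_ne hx.2.2 hx.1)
    exact ih hx.2.1 (by omega)

/-- Powers of `lowerSum` depend polynomially on the exponent. -/
lemma exists_polynomial_lowerSum_pow [CharZero R] (L : Finset α) (rk : α → ℕ)
    (hrk : ∀ x ∈ L, ∀ y ∈ L, x < y → rk x < rk y) (h : α → R) (e : ℕ)
    (he : ∀ x ∈ L, rk x < e → h x = 0) {y : α} (hy : y ∈ L) :
    ∃ P : Polynomial R, P.natDegree ≤ rk y - e ∧ ∀ s : ℕ,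
      (lowerSum R L ^ s) h y = P.eval (s : R) := by
  classical
  let D := rk y - e
  let c : ℕ → R := fun j => ((lowerSum R L - 1) ^ j) h y
  have hc : ∀ j, D < j → c j = 0 := fun j hj =>
    lowerSum_sub_one_pow_eq_zero L rk hrk h e he j hy (by omega)
  refine ⟨∑ j ∈ Finset.range (D + 1), Polynomial.C (c j / j.factorial) * descPochhammer R j,
    Polynomial.natDegree_sum_le_of_forall_le _ _ fun j hj => ?_, fun s => ?_⟩
  · refine (Polynomial.natDegree_C_mul_le _ _).trans ?_
    rw [descPochhammer_natDegree]
    exact Nat.lt_succ_iff.mp (Finset.mem_range.mp hj)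
  · have h1 : lowerSum R L ^ s = ∑ j ∈ Finset.range (s + 1),
        (lowerSum R L - 1) ^ j * ((s.choose j : ℕ) : Module.End R (α → R)) := by
      conv_lhs => rw [← sub_add_cancel (lowerSum R L) 1]
      rw [(Commute.one_right _).add_pow]
      simp
    have h2 : (lowerSum R L ^ s) h y = ∑ j ∈ Finset.range (s + 1), (s.choose j : R) * c j := by
      rw [h1]
      simp only [LinearMap.sum_apply, Finset.sum_apply, Module.End.mul_apply]
      refine Finset.sum_congr rfl fun j _ => ?_
      rw [Module.End.natCast_apply, map_nsmul, Pi.smul_apply, nsmul_eq_mul]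
    rw [h2, Polynomial.eval_finsetSum]
    have h3 : ∑ j ∈ Finset.range (s + 1), (s.choose j : R) * c j =
        ∑ j ∈ Finset.range (max s D + 1), (s.choose j : R) * c j := by
      refine Finset.sum_subset (Finset.range_mono (by omega)) fun j _ hj => ?_
      rw [Nat.choose_eq_zero_of_lt (by simpa using hj)]
      simp
    rw [h3]
    symm
    have h4 : ∀ j, (Polynomial.C (c j / j.factorial) * descPochhammer R j).eval (s : R) =
        s.choose j * c j := by
      intro j
      rw [Nat.cast_choose_eq_descPochhammer_div, Polynomial.eval_mul, Polynomial.eval_C]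
      ring
    simp only [h4]
    refine Finset.sum_subset (Finset.range_mono (by omega)) fun j _ hj => ?_
    rw [hc j (by simpa using hj), mul_zero]

end MonotoneChains

section AlternatingSums

variable {R : Type} [Field R]

/-- Extrapolation of a sequence of polynomial growth to the exponent `-1`. -/
def alternatingSum (n : ℕ) (f : ℕ → R) : R :=
  ∑ s ∈ Finset.range n, (-1) ^ s * (n.choose (s + 1) : R) * f s

lemma alternatingSum_polynomial {n : ℕ} (f : ℕ → R) (P : Polynomial R)
    (hP : P.natDegree < n) (hf : ∀ s, f s = P.eval ((s + 1 : ℕ) : R)) :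
    alternatingSum n f = P.eval 0 := by
  have h1 := fwdDiff_iter_eq_sum_shift (1 : R) P.eval n 0
  rw [Polynomial.fwdDiff_iter_eq_zero_of_degree_lt hP, Finset.sum_range_succ'] at h1
  have h2 : alternatingSum n f = (-1) ^ (n + 1) * ∑ s ∈ Finset.range n,
      ((-1 : ℤ) ^ (n - (s + 1)) * (n.choose (s + 1) : ℤ)) • P.eval (0 + (s + 1) • (1 : R)) := by
    rw [alternatingSum, Finset.mul_sum]
    refine Finset.sum_congr rfl fun s hs => ?_
    rw [hf, zero_add, nsmul_one, zsmul_eq_mul]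
    push_cast
    rw [← mul_assoc, ← mul_assoc, ← pow_add]
    congr 2
    have : s < n := Finset.mem_range.mp hs
    rw [show n + 1 + (n - (s + 1)) = s + 2 * (n - s) by omega, pow_add, pow_mul]
    simp
  have h3 : ∑ s ∈ Finset.range n,
      ((-1 : ℤ) ^ (n - (s + 1)) * (n.choose (s + 1) : ℤ)) • P.eval (0 + (s + 1) • (1 : R)) =
      - ((-1) ^ n * P.eval 0) := by
    rw [eq_neg_iff_add_eq_zero]
    simpa using h1.symm
  rw [h2, h3, pow_succ, mul_neg, mul_neg_one, neg_mul, neg_neg, ← mul_assoc, ← mul_pow]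
  simp

lemma alternatingSum_const_mul {n : ℕ} (c : R) (f : ℕ → R) :
    alternatingSum n (fun s => c * f s) = c * alternatingSum n f := by
  rw [alternatingSum, alternatingSum, Finset.mul_sum]
  exact Finset.sum_congr rfl fun s _ => by ring

lemma alternatingSum_const [CharZero R] {n : ℕ} (hn : 0 < n) (c : R) :
    alternatingSum n (fun _ => c) = c := by
  rw [alternatingSum_polynomial _ (Polynomial.C c) (by simpa using hn) (by simp)]
  simp

end AlternatingSums

section ChainCounts

variable {α β R : Type} [PartialOrder α] [PartialOrder β] [Field R]

lemma chainSum_pair {b t : α} (hbt : b < t) [DecidableEq α] (h : α → R) (hb : h b = 0) (s : ℕ) :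
    chainSum {b, t} t h s = h t := by
  classical
  rw [chainSum_eq_lowerSum_pow _ _ (by simp [hbt.le])]
  have hT : ∀ f : α → R, f b = 0 → lowerSum R {b, t} f b = 0 ∧ lowerSum R {b, t} f t = f t := by
    intro f hf
    simp only [lowerSum_apply]
    constructor
    · refine Finset.sum_eq_zero fun x hx => ?_
      simp only [Finset.mem_filter, Finset.mem_insert, Finset.mem_singleton] at hx
      rcases hx.1 with rfl | rfl
      · exact hf
      · exact absurd hx.2 hbt.not_ge
    · rw [Finset.filter_true_of_mem (by simp [hbt.le]), Finset.sum_pair hbt.ne, hf, zero_add]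
  have : (lowerSum R {b, t} ^ s) h b = 0 ∧ (lowerSum R {b, t} ^ s) h t = h t := by
    induction s with
    | zero => exact ⟨hb, rfl⟩
    | succ s ih =>
      rw [pow_succ', Module.End.mul_apply]
      have := hT _ ih.1
      exact ⟨this.1, this.2.trans ih.2⟩
  exact this.2

variable [CharZero R]

lemma alternatingSum_chainSum_range {n : ℕ} (hn : 0 < n) :
    alternatingSum n (chainSum (R := R) (Finset.range (n + 1)) n fun y => (y : R)) = 1 := by
  classical
  have h1 : ∀ s y, y ≤ n → (lowerSum R (Finset.range (n + 1)) ^ s) (fun y => (y : R)) y =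
      ((y + s).choose (s + 1) : ℕ) := by
    intro s
    induction s with
    | zero => simp
    | succ s ih =>
      intro y hy
      rw [pow_succ', Module.End.mul_apply, lowerSum_apply]
      refine (Finset.sum_congr (s₂ := Finset.range (y + 1)) (by ext x; simp; omega)
        fun _ _ => rfl).trans ?_
      induction y with
      | zero => simp [ih]
      | succ y ihy =>
        rw [Finset.sum_range_succ, ihy (by omega), ih _ hy, ← Nat.cast_add,
          show y + 1 + (s + 1) = (y + (s + 1)) + 1 by omega, Nat.choose_succ_succ, add_comm,
          show y + (s + 1) = y + 1 + s by omega]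
  obtain ⟨m, rfl⟩ : ∃ m, n = m + 1 := ⟨n - 1, by omega⟩
  let P : Polynomial R := Polynomial.C (1 / (m.factorial : R)) *
    (descPochhammer R m).comp (Polynomial.X + Polynomial.C (m : R))
  have hP : ∀ r : ℕ, P.eval (r : R) = ((r + m).choose m : ℕ) := by
    intro r
    rw [Nat.cast_choose_eq_descPochhammer_div]
    simp [P]
    ring
  rw [alternatingSum_polynomial _ P]
  · have := hP 0
    simpa using this
  · refine Nat.lt_succ_iff.mpr ((Polynomial.natDegree_C_mul_le _ _).trans ?_)
    rw [Polynomial.natDegree_comp, descPochhammer_natDegree, Polynomial.natDegree_X_add_C, mul_one]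
  · intro s
    rw [hP, chainSum_eq_lowerSum_pow _ _ (fun y hy => by simpa [Nat.lt_succ_iff] using hy),
      h1 _ _ le_rfl, show m + 1 + s = (s + 1) + m by omega, Nat.choose_symm_add]

lemma exists_polynomial_chainSum {L : Finset α} {b t : α} (hbL : b ∈ L) (htL : t ∈ L)
    (hbt : b ≠ t) (hb : ∀ y ∈ L, b ≤ y) (ht : ∀ y ∈ L, y ≤ t) (rk : α → ℕ)
    (hrk : ∀ x ∈ L, ∀ y ∈ L, x < y → rk x < rk y) :
    ∃ P Q : Polynomial R, P.natDegree ≤ rk t - 1 ∧ Q.natDegree ≤ rk t ∧ Q.eval 0 = 0 ∧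
      (∀ s, chainSum L t (fun y => (rk y : R)) s = P.eval ((s + 1 : ℕ) : R)) ∧
      ∀ s, chainSum L t (fun _ => (1 : R)) s = Q.eval ((s + 1 : ℕ) : R) := by
  classical
  obtain ⟨P, hP, hP'⟩ := exists_polynomial_lowerSum_pow (R := R) L rk hrk (fun y => (rk y : R)) 1
    (fun x _ hx => by simp [Nat.lt_one_iff.mp hx]) htL
  obtain ⟨Q, hQ, hQ'⟩ := exists_polynomial_lowerSum_pow (R := R) L rk hrk (Pi.single b 1) 0
    (fun x _ hx => absurd hx (by simp)) htL
  refine ⟨P.comp (Polynomial.X - Polynomial.C 1), Q, ?_, hQ, ?_, fun s => ?_, fun s => ?_⟩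
  · rw [Polynomial.natDegree_comp, Polynomial.natDegree_X_sub_C, mul_one]
    exact hP
  · have := hQ' 0
    rw [Nat.cast_zero, pow_zero, Module.End.one_apply, Pi.single_eq_of_ne hbt.symm] at this
    exact this.symm
  · rw [chainSum_eq_lowerSum_pow _ _ ht, hP']
    simp
  · rw [chainSum_eq_lowerSum_pow _ _ ht, ← hQ']
    have h1 : ∀ y ∈ L, lowerSum R L (Pi.single b 1) y = 1 := by
      intro y hy
      rw [lowerSum_apply]
      simp [Pi.single_apply, hbL, hb y hy]
    have h2 : ∀ s, ∀ y ∈ L, (lowerSum R L ^ s) (fun _ => 1) y =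
        (lowerSum R L ^ (s + 1)) (Pi.single b 1) y := by
      intro s
      induction s with
      | zero => intro y hy; simpa using (h1 y hy).symm
      | succ s ih =>
        intro y _
        rw [pow_succ', Module.End.mul_apply, lowerSum_apply, pow_succ' _ (s + 1),
          Module.End.mul_apply, lowerSum_apply]
        exact Finset.sum_congr rfl fun x hx => ih x (Finset.mem_filter.mp hx).1
    exact h2 s t htL

lemma alternatingSum_chainSum_mul {n : ℕ} {L : Finset α} {b t : α} (hbL : b ∈ L) (htL : t ∈ L)
    (hbt : b ≠ t) (hb : ∀ y ∈ L, b ≤ y) (ht : ∀ y ∈ L, y ≤ t) (rk : α → ℕ)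
    (hrk : ∀ x ∈ L, ∀ y ∈ L, x < y → rk x < rk y)
    {L' : Finset β} {b' t' : β} (hbL' : b' ∈ L') (htL' : t' ∈ L')
    (hbt' : b' ≠ t') (hb' : ∀ y ∈ L', b' ≤ y) (ht' : ∀ y ∈ L', y ≤ t') (rk' : β → ℕ)
    (hrk' : ∀ x ∈ L', ∀ y ∈ L', x < y → rk' x < rk' y) (hn : rk t + rk' t' ≤ n) :
    alternatingSum n (fun s => chainSum L t (fun y => (rk y : R)) s *
      chainSum L' t' (fun _ => (1 : R)) s + chainSum L t (fun _ => (1 : R)) s *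
      chainSum L' t' (fun y => (rk' y : R)) s) = 0 := by
  obtain ⟨P, Q, hP, hQ, hQ0, hP', hQ'⟩ := exists_polynomial_chainSum (R := R) hbL htL hbt hb ht rk
    hrk
  obtain ⟨P₁, Q₁, hP₁, hQ₁, hQ₁0, hP₁', hQ₁'⟩ := exists_polynomial_chainSum (R := R) hbL' htL' hbt'
    hb' ht' rk' hrk'
  have h1 := hrk b hbL t htL (lt_of_le_of_ne (hb t htL) hbt)
  have h2 := hrk' b' hbL' t' htL' (lt_of_le_of_ne (hb' t' htL') hbt')
  rw [alternatingSum_polynomial _ (P * Q₁ + Q * P₁)]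
  · simp [hQ0, hQ₁0]
  · refine (Polynomial.natDegree_add_le _ _).trans_lt (max_lt ?_ ?_)
    · refine Polynomial.natDegree_mul_le.trans_lt (by omega)
    · refine Polynomial.natDegree_mul_le.trans_lt (by omega)
  · intro s
    rw [hP', hQ', hP₁', hQ₁']
    simp

end ChainCounts

section OrbitCounting

variable {H X Y R : Type} [Group H] [Fintype H] [MulAction H X] [DecidableEq X] [DecidableEq Y]
  [Field R]

/-- A twisted Burnside count: `π` classifies the orbits of `H` on `A`. -/
lemma sum_sum_smul_eq (A : Finset X) (hA : ∀ (h : H), ∀ x ∈ A, h • x ∈ A) (τ : X → X)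
    (hτ : ∀ x ∈ A, τ x ∈ A) (π : X → Y)
    (hπ : ∀ x ∈ A, ∀ x' ∈ A, π x = π x' ↔ ∃ h : H, h • x = x')
    (hτπ : ∀ x ∈ A, ∀ x' ∈ A, π x = π x' → π (τ x) = π (τ x'))
    (S : Finset Y) (hS : ∀ y, y ∈ S ↔ ∃ x ∈ A, π x = y ∧ π (τ x) = y) (F : Y → R) :
    ∑ h : H, ∑ x ∈ A, (if h • x = τ x then F (π x) else 0) = Nat.card H * ∑ y ∈ S, F y := by
  classical
  have h1 : ∀ x ∈ A, ∑ h : H, (if h • x = τ x then F (π x) else 0) =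
      if π x ∈ S then ∑ h : H, (if h • x = τ x then F (π x) else 0) else 0 := by
    intro x hx
    split_ifs with hxS
    · rfl
    · refine Finset.sum_eq_zero fun h _ => if_neg fun h' => hxS ?_
      exact (hS _).mpr ⟨x, hx, rfl, ((hπ x hx _ (hτ x hx)).mpr ⟨h, h'⟩).symm⟩
  rw [Finset.sum_comm, Finset.sum_congr rfl h1, ← Finset.sum_filter,
    ← Finset.sum_fiberwise_of_maps_to (t := S) (g := π) (fun x hx => (Finset.mem_filter.mp hx).2),
    Finset.mul_sum]
  refine Finset.sum_congr rfl fun y hy => ?_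
  obtain ⟨x₀, hx₀, hx₀y, hx₀τ⟩ := (hS y).mp hy
  have h2 : ∀ x ∈ {x ∈ {x ∈ A | π x ∈ S} | π x = y},
      ∑ h : H, (if h • x = τ x then F (π x) else 0) =
        ∑ h : H, if h • x = x₀ then F y else 0 := by
    intro x hx
    simp only [Finset.mem_filter] at hx
    obtain ⟨⟨hxA, -⟩, hxy⟩ := hx
    obtain ⟨a, ha⟩ := (hπ x hxA (τ x) (hτ x hxA)).mp (by
      rw [hτπ x hxA x₀ hx₀ (hxy.trans hx₀y.symm), hx₀τ, hxy])
    obtain ⟨b, hb⟩ := (hπ x hxA x₀ hx₀).mp (hxy.trans hx₀y.symm)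
    rw [← Equiv.sum_comp (Equiv.mulLeft (b * a⁻¹)) fun h => if h • x = x₀ then F y else 0, hxy]
    refine Finset.sum_congr rfl fun h _ => if_congr ?_ rfl rfl
    rw [← ha, ← hb, Equiv.coe_mulLeft, mul_smul, mul_smul, smul_left_cancel_iff, inv_smul_eq_iff]
  rw [Finset.sum_congr rfl h2, Finset.sum_comm]
  have h3 : ∀ h : H, ∑ x ∈ {x ∈ {x ∈ A | π x ∈ S} | π x = y}, (if h • x = x₀ then F y else 0) =
      F y := by
    intro h
    have h4 : ∀ x, h • x = x₀ ↔ x = h⁻¹ • x₀ := fun x => eq_inv_smul_iff.symm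
    have h5 : π (h⁻¹ • x₀) = y :=
      ((hπ x₀ hx₀ _ (hA _ _ hx₀)).mpr ⟨h⁻¹, rfl⟩).symm.trans hx₀y
    simp only [h4, Finset.sum_ite_eq', Finset.mem_filter, h5, hy, hA _ _ hx₀, and_self, if_true]
  rw [Finset.sum_congr rfl fun h _ => h3 h]
  simp

end OrbitCounting

section SubspaceAction

open scoped Pointwise

variable {k V : Type} [Field k] [AddCommGroup V] [Module k V]

lemma smul_submodule_eq_map (g : V ≃ₗ[k] V) (A : Submodule k V) :
    g • A = A.map (g : V →ₗ[k] V) := rfl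

lemma smul_submodule_le_smul_iff (g : V ≃ₗ[k] V) {A B : Submodule k V} :
    g • A ≤ g • B ↔ A ≤ B :=
  Submodule.map_le_map_iff_of_injective g.injective A B

lemma finrank_smul_submodule (g : V ≃ₗ[k] V) (A : Submodule k V) :
    Module.finrank k (g • A : Submodule k V) = Module.finrank k A :=
  LinearEquiv.finrank_map_eq g A

lemma smul_submodule_inf (g : V ≃ₗ[k] V) (A B : Submodule k V) : g • (A ⊓ B) = g • A ⊓ g • B :=
  Submodule.map_inf _ g.injective

lemma smul_submodule_sup (g : V ≃ₗ[k] V) (A B : Submodule k V) : g • (A ⊔ B) = g • A ⊔ g • B :=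
  Submodule.map_sup _ _ _

lemma smul_submodule_top (g : V ≃ₗ[k] V) : g • (⊤ : Submodule k V) = ⊤ :=
  (Submodule.map_top _).trans g.range

lemma smul_submodule_of_forall {g : V ≃ₗ[k] V} {A : Submodule k V} (h : ∀ v ∈ A, g v = v) :
    g • A = A := by
  ext v
  rw [smul_submodule_eq_map, Submodule.mem_map]
  constructor
  · rintro ⟨w, hw, rfl⟩
    change g w ∈ A
    rwa [h w hw]
  · exact fun hv => ⟨v, hv, h v hv⟩

lemma smul_inf_eq_of_mem_unipotentRadical {W : Submodule k V} {u : V ≃ₗ[k] V}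
    (hu : u ∈ unipotentRadical W) (A : Submodule k V) : u • A ⊓ W = A ⊓ W := by
  have h1 : u • W = W := smul_submodule_of_forall hu.2
  conv_lhs => rw [← h1]
  rw [← smul_submodule_inf]
  exact smul_submodule_of_forall fun v hv => hu.2 v hv.2

lemma smul_submodule_eq_of_le [FiniteDimensional k V] {g : V ≃ₗ[k] V} {A B : Submodule k V}
    (h : ∀ v ∈ A, g v ∈ B) (hAB : Module.finrank k B = Module.finrank k A) :
    g • A = B := by
  refine Submodule.eq_of_le_of_finrank_eq (Submodule.map_le_iff_le_comap.mpr h) ?_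
  rw [finrank_smul_submodule, hAB]

/-- Chains of subspaces are conjugate under a group of automorphisms as soon as subspaces with the
same invariant are, relative to a common subspace. -/
lemma exists_smul_chain_eq {α : Type} (U : Subgroup (V ≃ₗ[k] V)) (f : Submodule k V → α)
    (hf : ∀ u ∈ U, ∀ A, f (u • A) = f A)
    (hU : ∀ E A B : Submodule k V, E ≤ A → E ≤ B → f A = f B →
      ∃ u ∈ U, (∀ v ∈ E, u v = v) ∧ u • A = B)
    {s : ℕ} (x x' : Fin s → Submodule k V) (hx : Monotone x) (hx' : Monotone x')
    (h : ∀ i, f (x i) = f (x' i)) : ∃ u : U, u • x = x' := by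
  have key : ∀ j ≤ s, ∃ u ∈ U, ∀ i : Fin s, (i : ℕ) < j → u • x i = x' i := by
    intro j hj
    induction j with
    | zero => exact ⟨1, U.one_mem, fun i hi => absurd hi (Nat.not_lt_zero _)⟩
    | succ j ih =>
      obtain ⟨u, huU, hu⟩ := ih (by omega)
      let jj : Fin s := ⟨j, by omega⟩
      obtain ⟨E, hE, hE', hE''⟩ : ∃ E, E ≤ u • x jj ∧ E ≤ x' jj ∧
          ∀ i : Fin s, (i : ℕ) < j → x' i ≤ E := by
        rcases Nat.eq_zero_or_pos j with rfl | hj0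
        · exact ⟨⊥, bot_le, bot_le, fun i hi => absurd hi (Nat.not_lt_zero _)⟩
        · let jp : Fin s := ⟨j - 1, by omega⟩
          have hjp : jp ≤ jj := Nat.sub_le j 1
          refine ⟨x' jp, ?_, hx' hjp, fun i hi => hx' (Nat.le_sub_one_of_lt hi)⟩
          rw [← hu jp (Nat.sub_lt hj0 one_pos)]
          exact (smul_submodule_le_smul_iff u).mpr (hx hjp)
      obtain ⟨u', hu'U, hu'E, hu'⟩ := hU E (u • x jj) (x' jj) hE hE' (by rw [hf u huU, h])
      refine ⟨u' * u, U.mul_mem hu'U huU, fun i hi => ?_⟩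
      rw [mul_smul]
      rcases Nat.lt_succ_iff_lt_or_eq.mp hi with hi | hi
      · rw [hu i hi]
        exact smul_submodule_of_forall fun v hv => hu'E v (hE'' i hi hv)
      · have : i = jj := Fin.ext hi
        rw [this, hu']
  obtain ⟨u, huU, hu⟩ := key s le_rfl
  exact ⟨⟨u, huU⟩, funext fun i => hu i i.2⟩

variable [FiniteDimensional k V]

lemma exists_linearEquiv_extend {V' : Type} [AddCommGroup V'] [Module k V']
    [FiniteDimensional k V'] (hV : Module.finrank k V = Module.finrank k V') (A : Submodule k V)
    (A' : Submodule k V') (e : A ≃ₗ[k] A') : ∃ g : V ≃ₗ[k] V', ∀ a : A, g a = e a := by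
  obtain ⟨D, hD⟩ := A.exists_isCompl
  obtain ⟨D', hD'⟩ := A'.exists_isCompl
  have h1 := Submodule.finrank_add_eq_of_isCompl hD
  have h2 := Submodule.finrank_add_eq_of_isCompl hD'
  have h3 := e.finrank_eq
  let f : D ≃ₗ[k] D' := LinearEquiv.ofFinrankEq _ _ (by omega)
  refine ⟨(Submodule.prodEquivOfIsCompl A D hD).symm ≪≫ₗ (e.prodCongr f) ≪≫ₗ
    Submodule.prodEquivOfIsCompl A' D' hD', fun a => ?_⟩
  simp

lemma exists_linearEquiv_smul_eq (E A B : Submodule k V) (hA : E ≤ A) (hB : E ≤ B)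
    (h : Module.finrank k A = Module.finrank k B) :
    ∃ g : V ≃ₗ[k] V, (∀ v ∈ E, g v = v) ∧ g • A = B := by
  obtain ⟨e, he⟩ := exists_linearEquiv_extend h (E.submoduleOf A) (E.submoduleOf B)
    (Submodule.submoduleOfEquivOfLe hA ≪≫ₗ (Submodule.submoduleOfEquivOfLe hB).symm)
  obtain ⟨g, hg⟩ := exists_linearEquiv_extend rfl A B e
  refine ⟨g, fun v hv => ?_, smul_submodule_eq_of_le (fun v hv => ?_) h.symm⟩
  · have h1 := he ⟨⟨v, hA hv⟩, hv⟩
    have h2 := hg ⟨v, hA hv⟩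
    rw [h1] at h2
    exact h2
  · have h2 := hg ⟨v, hv⟩
    change g v = _ at h2
    rw [h2]
    exact (e _).2

lemma smul_eq_of_le_of_mem_unipotentRadical {W : Submodule k V} {u : V ≃ₗ[k] V}
    (hu : u ∈ unipotentRadical W) {A : Submodule k V} (hA : W ≤ A) : u • A = A := by
  refine smul_submodule_eq_of_le (fun v hv => ?_) rfl
  have := A.add_mem (hA (hu.1 v)) hv
  rwa [sub_add_cancel] at this

lemma smul_sup_eq_of_mem_unipotentRadical {W : Submodule k V} {u : V ≃ₗ[k] V}
    (hu : u ∈ unipotentRadical W) (A : Submodule k V) : u • A ⊔ W = A ⊔ W := by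
  have h1 : u • W = W := smul_submodule_of_forall hu.2
  conv_lhs => rw [← h1]
  rw [← smul_submodule_sup]
  exact smul_eq_of_le_of_mem_unipotentRadical hu le_sup_right

lemma exists_unipotentRadical_smul_eq (W E A B : Submodule k V) (hA : E ≤ A) (hB : E ≤ B)
    (hinf : A ⊓ W = B ⊓ W) (hsup : A ⊔ W = B ⊔ W) :
    ∃ u ∈ unipotentRadical W, (∀ v ∈ E, u v = v) ∧ u • A = B := by
  obtain ⟨D', hD'⟩ := (E ⊔ A ⊓ W).exists_isCompl
  let D := D' ⊓ A
  have hEA : E ⊔ A ⊓ W ≤ A := sup_le hA inf_le_left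
  have hDA : (E ⊔ A ⊓ W) ⊔ D = A := by
    change (E ⊔ A ⊓ W) ⊔ (D' ⊓ A) = A
    rw [← sup_inf_assoc_of_le _ hEA, hD'.sup_eq_top, top_inf_eq]
  have hdisj : Disjoint D (W ⊔ E) := by
    rw [Submodule.disjoint_def]
    intro d hd hd'
    obtain ⟨w, hw, e, he, rfl⟩ := Submodule.mem_sup.mp hd'
    refine Submodule.disjoint_def.mp hD'.disjoint _ ?_ hd.1
    refine Submodule.add_mem _ (Submodule.mem_sup_right ⟨?_, hw⟩) (Submodule.mem_sup_left he)
    have := A.sub_mem hd.2 (hA he)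
    rwa [add_sub_cancel_right] at this
  obtain ⟨C, hC, hCD⟩ := hdisj.symm.exists_isCompl
  have hDC := hCD.symm
  obtain ⟨h, hh⟩ : ∃ h : D →ₗ[k] B, ∀ d : D, (h d : V) - d ∈ W := by
    let f : B →ₗ[k] (B.map W.mkQ) := W.mkQ.restrict fun b hb => Submodule.mem_map_of_mem hb
    have hmap : A.map W.mkQ = B.map W.mkQ := by
      have := congrArg (Submodule.map W.mkQ) hsup
      simpa [Submodule.map_sup] using this
    let g : D →ₗ[k] (B.map W.mkQ) := W.mkQ.restrict fun d hd => by
      rw [← hmap]; exact Submodule.mem_map_of_mem hd.2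
    obtain ⟨h, hh⟩ := Module.projective_lifting_property f g (by
      rintro ⟨_, b, hb, rfl⟩
      exact ⟨⟨b, hb⟩, rfl⟩)
    refine ⟨h, fun d => ?_⟩
    rw [← Submodule.Quotient.eq]
    exact congrArg Subtype.val (LinearMap.congr_fun hh d)
  let N : V →ₗ[k] V := (B.subtype ∘ₗ h - D.subtype) ∘ₗ D.projectionOnto C hDC
  have hN1 : ∀ v, N v ∈ W := fun v => hh _
  have hN2 : ∀ v ∈ C, N v = 0 := by
    intro v hv
    simp only [N, LinearMap.comp_apply]
    rw [(Submodule.projectionOnto_apply_eq_zero_iff hDC).mpr hv, map_zero]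
  have hNW : ∀ v ∈ W, N v = 0 := fun v hv => hN2 v (hC (Submodule.mem_sup_left hv))
  have hNE : ∀ v ∈ E, N v = 0 := fun v hv => hN2 v (hC (Submodule.mem_sup_right hv))
  have hND : ∀ d (hd : d ∈ D), d + N d = h ⟨d, hd⟩ := by
    intro d hd
    have : D.projectionOnto C hDC d = ⟨d, hd⟩ :=
      Submodule.projectionOnto_apply_left hDC ⟨d, hd⟩
    simp [N, this]
  have hNN : N ∘ₗ N = 0 := LinearMap.ext fun v => hNW _ (hN1 v)
  let u : V ≃ₗ[k] V := LinearEquiv.ofLinearMap (LinearMap.id + N) (LinearMap.id - N)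
    (by simp [LinearMap.add_comp, LinearMap.comp_sub, hNN])
    (by simp [LinearMap.sub_comp, LinearMap.comp_add, hNN])
  have hu : ∀ v, u v = v + N v := fun v => rfl
  refine ⟨u, ⟨fun v => ?_, fun v hv => ?_⟩, fun v hv => ?_, ?_⟩
  · rw [hu, add_sub_cancel_left]
    exact hN1 v
  · rw [hu, hNW v hv, add_zero]
  · rw [hu, hNE v hv, add_zero]
  · refine smul_submodule_eq_of_le ?_ ?_
    · intro v hv
      rw [← hDA] at hv
      obtain ⟨y, hy, d, hd, rfl⟩ := Submodule.mem_sup.mp hv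
      obtain ⟨e, he, w, hw, rfl⟩ := Submodule.mem_sup.mp hy
      rw [map_add, map_add, hu e, hNE e he, hu w, hNW w hw.2, hu d, hND d hd, add_zero, add_zero]
      rw [hinf] at hw
      exact B.add_mem (B.add_mem (hB he) hw.1) (h ⟨d, hd⟩).2
    · have h1 := Submodule.finrank_sup_add_finrank_inf_eq A W
      have h2 := Submodule.finrank_sup_add_finrank_inf_eq B W
      rw [hinf, hsup] at h1
      omega

lemma exists_monotone_finrank_eq : ∃ F : ℕ → Submodule k V, Monotone F ∧
    ∀ d ≤ Module.finrank k V, Module.finrank k (F d) = d := by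
  classical
  let b := Module.finBasis k V
  refine ⟨fun d => Submodule.span k (Set.range fun i : {i : Fin (Module.finrank k V) // (i : ℕ) < d} =>
    b i), fun d d' hd => Submodule.span_mono ?_, fun d hd => ?_⟩
  · rintro _ ⟨⟨i, hi⟩, rfl⟩
    exact ⟨⟨i, hi.trans_le hd⟩, rfl⟩
  · refine (finrank_span_eq_card (b.linearIndependent.comp _ Subtype.val_injective)).trans ?_
    rw [Fintype.card_subtype, Fin.card_filter_val_lt]
    simpa using hd

end SubspaceAction

lemma sum_alternatingSum {ι R : Type} [Field R] (s : Finset ι) (n : ℕ) (f : ι → ℕ → R) :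
    ∑ i ∈ s, alternatingSum n (f i) = alternatingSum n fun j => ∑ i ∈ s, f i j := by
  simp only [alternatingSum, Finset.mul_sum]
  exact Finset.sum_comm

section ChainFunction

open scoped Pointwise

variable {k V : Type} [Field k] [AddCommGroup V] [Module k V] [Fintype (Submodule k V)]

lemma smul_mem_monoChains_univ (g : V ≃ₗ[k] V) {s : ℕ} {x : Fin s → Submodule k V}
    (hx : x ∈ monoChains Finset.univ s) : g • x ∈ monoChains Finset.univ s := by
  rw [mem_monoChains] at hx ⊢
  exact ⟨fun _ => Finset.mem_univ _, fun i j hij => (smul_submodule_le_smul_iff g).mpr (hx.2 hij)⟩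

variable (R : Type) [Field R]

open Classical in
/-- The number of flags fixed by `g`, weighted by the dimension of the first member. -/
noncomputable def fixedChainSum (s : ℕ) (g : V ≃ₗ[k] V) : R :=
  ∑ x ∈ monoChains (Finset.univ : Finset (Submodule k V)) s,
    if g • x = x then (Module.finrank k (chainHead ⊤ x) : R) else 0

/-- An alternating sum of weighted counts of fixed flags. -/
noncomputable def chainFun (g : V ≃ₗ[k] V) : R :=
  alternatingSum (Module.finrank k V) fun s => fixedChainSum R s g

lemma fixedChainSum_conj (s : ℕ) (y g : V ≃ₗ[k] V) :
    fixedChainSum R s (y * g * y⁻¹) = fixedChainSum R s g := by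
  classical
  unfold fixedChainSum
  symm
  refine Finset.sum_bij' (fun x _ => y • x) (fun x _ => y⁻¹ • x)
    (fun x hx => smul_mem_monoChains_univ y hx) (fun x hx => smul_mem_monoChains_univ y⁻¹ hx)
    (fun x _ => inv_smul_smul y x) (fun x _ => smul_inv_smul y x) fun x _ => ?_
  have h1 : chainHead ⊤ (y • x) = y • chainHead ⊤ x := by
    have := chainHead_comp (fun A : Submodule k V => y • A) ⊤ x
    rw [smul_submodule_top] at this
    exact this
  rw [h1, finrank_smul_submodule]
  refine if_congr ?_ rfl rfl
  rw [mul_smul, mul_smul, inv_smul_smul, smul_left_cancel_iff]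

lemma chainFun_conj (y g : V ≃ₗ[k] V) : chainFun R (y * g * y⁻¹) = chainFun R g := by
  simp only [chainFun, fixedChainSum_conj]

lemma chainFun_inv (g : V ≃ₗ[k] V) : chainFun R g⁻¹ = chainFun R g := by
  classical
  unfold chainFun fixedChainSum
  congr 1
  funext s
  exact Finset.sum_congr rfl fun x _ => if_congr (by rw [inv_smul_eq_iff, eq_comm]) rfl rfl

lemma isVirtualChar_chainFun : IsVirtualChar (chainFun R : (V ≃ₗ[k] V) → R) := by
  classical
  have h1 : ∀ s, IsVirtualChar (fixedChainSum R s : (V ≃ₗ[k] V) → R) := by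
    intro s
    convert isVirtualChar_sum_fixed (R := R) (G := V ≃ₗ[k] V) (X := Fin s → Submodule k V)
      (fun x => if Monotone x then Module.finrank k (chainHead ⊤ x) else 0) ?_ using 1
    · funext g
      have : monoChains (Finset.univ : Finset (Submodule k V)) s =
          Finset.univ.filter fun x => Monotone x := by
        ext x; simp [mem_monoChains]
      rw [fixedChainSum, this, Finset.sum_filter]
      refine Finset.sum_congr rfl fun x _ => ?_
      split_ifs <;> simp
    · intro g x
      have h2 : chainHead ⊤ (g • x) = g • chainHead ⊤ x := by
        have := chainHead_comp (fun A : Submodule k V => g • A) ⊤ x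
        rw [smul_submodule_top] at this
        exact this
      rw [h2, finrank_smul_submodule]
      refine if_congr ?_ rfl rfl
      exact ⟨fun h i j hij => (smul_submodule_le_smul_iff g).mp (h hij),
        fun h i j hij => (smul_submodule_le_smul_iff g).mpr (h hij)⟩
  convert IsVirtualChar.sum (Finset.range (Module.finrank k V)) (fun s _ =>
    (h1 s).zsmul ((-1) ^ s * ((Module.finrank k V).choose (s + 1) : ℤ))) using 1
  funext g
  simp [chainFun, alternatingSum]

variable [CharZero R]

lemma chainFun_eq_finrank (hV : 0 < Module.finrank k V) {g : V ≃ₗ[k] V}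
    (hg : ∀ A : Submodule k V, g • A = A ↔ A = ⊥ ∨ A = ⊤) :
    chainFun R g = Module.finrank k V := by
  classical
  have := Module.nontrivial_of_finrank_pos hV
  have h1 : ∀ s, fixedChainSum R s g = Module.finrank k V := by
    intro s
    have h2 := chainSum_pair (R := R) (bot_lt_top (α := Submodule k V))
      (fun A => (Module.finrank k A : R)) (by simp) s
    rw [finrank_top] at h2
    rw [← h2, fixedChainSum, ← Finset.sum_filter, chainSum]
    refine Finset.sum_congr ?_ fun _ _ => rfl
    ext x
    simp only [Finset.mem_filter, mem_monoChains, Finset.mem_univ, true_and, implies_true,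
      Finset.mem_insert, Finset.mem_singleton, ← hg]
    rw [and_comm, funext_iff]
    rfl
  rw [chainFun, funext h1, alternatingSum_const hV]

variable [FiniteDimensional k V]

lemma sum_unipotentRadical_chainFun {W : Submodule k V} (hW : W ≠ ⊥) (hW' : W ≠ ⊤)
    [Fintype (unipotentRadical W)] {m : V ≃ₗ[k] V} (hm : m • W = W) :
    ∑ u : unipotentRadical W, chainFun R (m * (u : V ≃ₗ[k] V)) = 0 := by
  classical
  let P : Finset (Submodule k V) := {A | A ≤ W ∧ m • A = A}
  let Q : Finset (Submodule k V) := {A | W ≤ A ∧ m • A = A}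
  have hmP : ∀ A, A ∈ P ↔ A ≤ W ∧ m • A = A := fun A => by simp [P]
  have hmQ : ∀ A, A ∈ Q ↔ W ≤ A ∧ m • A = A := fun A => by simp [Q]
  have hm' : m⁻¹ • W = W := by rw [inv_smul_eq_iff, hm]
  let rk : Submodule k V → ℕ := fun A => Module.finrank k A
  let rk' : Submodule k V → ℕ := fun A => Module.finrank k A - Module.finrank k W
  let π : ∀ s, (Fin s → Submodule k V) → (Fin s → Submodule k V) × (Fin s → Submodule k V) :=
    fun s x => (fun i => x i ⊓ W, fun i => x i ⊔ W)
  let F : ∀ s, (Fin s → Submodule k V) × (Fin s → Submodule k V) → R := fun s y =>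
    (rk (chainHead W y.1) : R) + (rk' (chainHead ⊤ y.2) : R)
  have hF : ∀ s x, (Module.finrank k (chainHead (⊤ : Submodule k V) x) : R) = F s (π s x) := by
    intro s x
    have h1 : chainHead W (fun i => x i ⊓ W) = chainHead ⊤ x ⊓ W := by
      have := chainHead_comp (fun A : Submodule k V => A ⊓ W) ⊤ x
      rwa [top_inf_eq] at this
    have h2 : chainHead ⊤ (fun i => x i ⊔ W) = chainHead ⊤ x ⊔ W := by
      have := chainHead_comp (fun A : Submodule k V => A ⊔ W) ⊤ x
      rwa [top_sup_eq] at this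
    change _ = (rk (chainHead W fun i => x i ⊓ W) : R) + (rk' (chainHead ⊤ fun i => x i ⊔ W) : R)
    rw [h1, h2]
    simp only [rk, rk']
    have h3 := Submodule.finrank_sup_add_finrank_inf_eq (chainHead ⊤ x) W
    rw [← Nat.cast_add]
    congr 1
    have h4 : Module.finrank k W ≤ Module.finrank k (chainHead ⊤ x ⊔ W : Submodule k V) :=
      Submodule.finrank_mono le_sup_right
    omega
  have h1 : ∀ s, ∑ u : unipotentRadical W, fixedChainSum R s (m * (u : V ≃ₗ[k] V)) =
      Nat.card (unipotentRadical W) * (chainSum P W (fun y => (rk y : R)) s *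
      chainSum Q ⊤ (fun _ => (1 : R)) s + chainSum P W (fun _ => (1 : R)) s *
      chainSum Q ⊤ (fun y => (rk' y : R)) s) := by
    intro s
    have h2 := sum_sum_smul_eq (H := unipotentRadical W) (R := R)
      (monoChains (Finset.univ : Finset (Submodule k V)) s)
      (fun h x hx => smul_mem_monoChains_univ h.1 hx) (fun x => m⁻¹ • x)
      (fun x hx => smul_mem_monoChains_univ m⁻¹ hx) (π s) ?_ ?_
      (monoChains P s ×ˢ monoChains Q s) ?_ (F s)
    · have h3 : ∀ u : unipotentRadical W, fixedChainSum R s (m * (u : V ≃ₗ[k] V)) =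
          ∑ x ∈ monoChains Finset.univ s, if u • x = m⁻¹ • x then F s (π s x) else 0 := by
        intro u
        refine Finset.sum_congr rfl fun x _ => ?_
        rw [hF]
        refine if_congr ?_ rfl rfl
        rw [mul_smul, ← eq_inv_smul_iff]
        rfl
      rw [Finset.sum_congr rfl fun u _ => h3 u, h2]
      congr 1
      rw [Finset.sum_product]
      simp only [F, Finset.sum_add_distrib, chainSum, Finset.sum_const, nsmul_eq_mul, mul_one,
        ← Finset.mul_sum]
      ring
    · intro x hx x' hx'
      rw [mem_monoChains] at hx hx'
      constructor
      · intro h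
        refine exists_smul_chain_eq (unipotentRadical W) (fun A => (A ⊓ W, A ⊔ W)) ?_ ?_ x x' hx.2
          hx'.2 ?_
        · intro u hu A
          rw [smul_inf_eq_of_mem_unipotentRadical hu, smul_sup_eq_of_mem_unipotentRadical hu]
        · intro E A B hA hB hAB
          rw [Prod.mk.injEq] at hAB
          exact exists_unipotentRadical_smul_eq W E A B hA hB hAB.1 hAB.2
        · intro i
          have h1 := congrFun (congrArg Prod.fst h) i
          have h2 := congrFun (congrArg Prod.snd h) i
          exact Prod.ext h1 h2
      · rintro ⟨u, rfl⟩
        refine Prod.ext (funext fun i => ?_) (funext fun i => ?_)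
        · exact (smul_inf_eq_of_mem_unipotentRadical u.2 (x i)).symm
        · exact (smul_sup_eq_of_mem_unipotentRadical u.2 (x i)).symm
    · have h4 : ∀ x, π s (m⁻¹ • x) = (m⁻¹ • (π s x).1, m⁻¹ • (π s x).2) := by
        intro x
        refine Prod.ext (funext fun i => ?_) (funext fun i => ?_)
        · change m⁻¹ • x i ⊓ W = m⁻¹ • (x i ⊓ W)
          rw [smul_submodule_inf, hm']
        · change m⁻¹ • x i ⊔ W = m⁻¹ • (x i ⊔ W)
          rw [smul_submodule_sup, hm']
      intro x _ x' _ h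
      rw [h4, h4, h]
    · rintro ⟨a, c⟩
      simp only [Finset.mem_product, mem_monoChains, hmP, hmQ, Finset.mem_univ, true_and,
        implies_true]
      constructor
      · rintro ⟨⟨ha, ha'⟩, hc, hc'⟩
        obtain ⟨W', hW'⟩ := W.exists_isCompl
        let x : Fin s → Submodule k V := fun i => a i ⊔ (c i ⊓ W')
        have hx1 : ∀ i, x i ⊓ W = a i := by
          intro i
          change (a i ⊔ (c i ⊓ W')) ⊓ W = a i
          rw [sup_inf_assoc_of_le _ (ha i).1, inf_assoc, inf_comm W', hW'.inf_eq_bot, inf_bot_eq,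
            sup_bot_eq]
        have hx2 : ∀ i, x i ⊔ W = c i := by
          intro i
          change (a i ⊔ (c i ⊓ W')) ⊔ W = c i
          rw [sup_comm (a i), sup_assoc, sup_eq_right.mpr (ha i).1, inf_sup_assoc_of_le _ (hc i).1,
            sup_comm W', hW'.sup_eq_top, inf_top_eq]
        refine ⟨x, fun i j hij => sup_le_sup (ha' hij) (inf_le_inf_right _ (hc' hij)),
          Prod.ext (funext hx1) (funext hx2), Prod.ext (funext fun i => ?_) (funext fun i => ?_)⟩
        · change m⁻¹ • x i ⊓ W = a i
          rw [← hm', ← smul_submodule_inf, hx1, inv_smul_eq_iff, (ha i).2]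
        · change m⁻¹ • x i ⊔ W = c i
          rw [← hm', ← smul_submodule_sup, hx2, inv_smul_eq_iff, (hc i).2]
      · rintro ⟨x, hx, h, h'⟩
        have hx1 : ∀ i, x i ⊓ W = a i := fun i => congrFun (congrArg Prod.fst h) i
        have hx2 : ∀ i, x i ⊔ W = c i := fun i => congrFun (congrArg Prod.snd h) i
        have hx3 : ∀ i, m⁻¹ • x i ⊓ W = a i := fun i => congrFun (congrArg Prod.fst h') i
        have hx4 : ∀ i, m⁻¹ • x i ⊔ W = c i := fun i => congrFun (congrArg Prod.snd h') i
        refine ⟨⟨fun i => ⟨hx1 i ▸ inf_le_right, ?_⟩, fun i j hij => ?_⟩,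
          fun i => ⟨hx2 i ▸ le_sup_right, ?_⟩, fun i j hij => ?_⟩
        · have := hx3 i
          rw [← hm', ← smul_submodule_inf, hx1, inv_smul_eq_iff] at this
          exact this.symm
        · rw [← hx1, ← hx1]
          exact inf_le_inf_right _ (hx hij)
        · have := hx4 i
          rw [← hm', ← smul_submodule_sup, hx2, inv_smul_eq_iff] at this
          exact this.symm
        · rw [← hx2, ← hx2]
          exact sup_le_sup_right (hx hij) _
  simp only [chainFun]
  rw [sum_alternatingSum, funext h1, alternatingSum_const_mul]
  rw [alternatingSum_chainSum_mul (b := ⊥) (b' := W), mul_zero]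
  · rw [hmP]; exact ⟨bot_le, Submodule.map_bot _⟩
  · rw [hmP]; exact ⟨le_rfl, hm⟩
  · exact hW.symm
  · exact fun _ _ => bot_le
  · exact fun y hy => ((hmP y).mp hy).1
  · exact fun x _ y _ h => Submodule.finrank_lt_finrank_of_lt h
  · rw [hmQ]; exact ⟨le_rfl, hm⟩
  · rw [hmQ]; exact ⟨le_top, smul_submodule_top m⟩
  · exact hW'
  · exact fun y hy => ((hmQ y).mp hy).1
  · exact fun _ _ => le_top
  · intro x hx y _ h
    have h3 := Submodule.finrank_lt_finrank_of_lt h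
    have h4 := Submodule.finrank_mono ((hmQ x).mp hx).1
    simp only [rk']
    omega
  · have := Submodule.finrank_le W
    simp only [rk, rk', finrank_top]
    omega

variable [Fintype (V ≃ₗ[k] V)]

lemma sum_chainFun (hV : 0 < Module.finrank k V) :
    ∑ g : V ≃ₗ[k] V, chainFun R g = Nat.card (V ≃ₗ[k] V) := by
  classical
  obtain ⟨E, hE, hE'⟩ := exists_monotone_finrank_eq (k := k) (V := V)
  have h1 : ∀ s, ∑ g : V ≃ₗ[k] V, fixedChainSum R s g =
      Nat.card (V ≃ₗ[k] V) * chainSum (Finset.range (Module.finrank k V + 1))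
        (Module.finrank k V) (fun y => (y : R)) s := by
    intro s
    have h2 := sum_sum_smul_eq (H := V ≃ₗ[k] V) (R := R)
      (monoChains (Finset.univ : Finset (Submodule k V)) s)
      (fun h x hx => smul_mem_monoChains_univ h hx) id (fun x hx => hx)
      (fun x i => Module.finrank k (x i)) ?_ (fun _ _ _ _ h => h)
      (monoChains (Finset.range (Module.finrank k V + 1)) s) ?_
      (fun y : Fin s → ℕ => ((chainHead (Module.finrank k V) y : ℕ) : R))
    · rw [chainSum, ← h2]
      refine Finset.sum_congr rfl fun g _ => Finset.sum_congr rfl fun x _ => ?_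
      have h3 := chainHead_comp (fun A : Submodule k V => Module.finrank k A) ⊤ x
      rw [finrank_top] at h3
      rw [h3]
      rfl
    · intro x hx x' hx'
      rw [mem_monoChains] at hx hx'
      constructor
      · intro h
        obtain ⟨u, hu⟩ := exists_smul_chain_eq (⊤ : Subgroup (V ≃ₗ[k] V))
          (fun A => Module.finrank k A) (fun u _ A => finrank_smul_submodule u A)
          (fun E A B hA hB hAB => by
            obtain ⟨g, hg⟩ := exists_linearEquiv_smul_eq E A B hA hB hAB
            exact ⟨g, Subgroup.mem_top g, hg⟩) x x' hx.2 hx'.2 (fun i => congrFun h i)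
        exact ⟨u, hu⟩
      · rintro ⟨g, rfl⟩
        exact funext fun i => (finrank_smul_submodule g (x i)).symm
    · intro y
      simp only [mem_monoChains, Finset.mem_univ, implies_true, true_and, id, and_self,
        Finset.mem_range, Nat.lt_succ_iff]
      constructor
      · rintro ⟨hy, hy'⟩
        exact ⟨fun i => E (y i), fun i j hij => hE (hy' hij), funext fun i => hE' _ (hy i)⟩
      · rintro ⟨x, hx, rfl⟩
        exact ⟨fun i => Submodule.finrank_le _, fun i j hij => Submodule.finrank_mono (hx hij)⟩
  simp only [chainFun]
  rw [sum_alternatingSum, funext h1, alternatingSum_const_mul, alternatingSum_chainSum_range hV,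
    mul_one]

lemma sum_stabilizer_chainFun [DecidableEq (Submodule k V)] {s : ℕ} {x : Fin s → Submodule k V}
    (hx : Monotone x) {i : Fin s} (hi : x i ≠ ⊥) (hi' : x i ≠ ⊤) :
    ∑ g : V ≃ₗ[k] V, (if g • x = x then chainFun R g else 0) = 0 := by
  classical
  let := Fintype.ofFinite (unipotentRadical (x i))
  have hu : ∀ u : unipotentRadical (x i), (u : V ≃ₗ[k] V) • x = x := by
    intro u
    funext j
    change (u : V ≃ₗ[k] V) • x j = x j
    rcases le_total i j with h | h
    · exact smul_eq_of_le_of_mem_unipotentRadical u.2 (hx h)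
    · exact smul_submodule_of_forall fun v hv => u.2.2 v (hx h hv)
  have h1 : ∀ u : unipotentRadical (x i), ∑ g : V ≃ₗ[k] V, (if g • x = x then chainFun R g else 0) =
      ∑ g : V ≃ₗ[k] V, if g • x = x then chainFun R (g * (u : V ≃ₗ[k] V)) else 0 := by
    intro u
    rw [← Equiv.sum_comp (Equiv.mulRight (u : V ≃ₗ[k] V))]
    refine Finset.sum_congr rfl fun g _ => ?_
    simp only [Equiv.coe_mulRight, mul_smul, hu]
  have h2 : (Nat.card (unipotentRadical (x i)) : R) *
      ∑ g : V ≃ₗ[k] V, (if g • x = x then chainFun R g else 0) = 0 := by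
    calc _ = ∑ u : unipotentRadical (x i), ∑ g : V ≃ₗ[k] V,
          (if g • x = x then chainFun R (g * (u : V ≃ₗ[k] V)) else 0) := by
            rw [← Finset.sum_congr rfl fun u _ => h1 u]
            simp
      _ = 0 := by
            rw [Finset.sum_comm]
            refine Finset.sum_eq_zero fun g _ => ?_
            by_cases hg : g • x = x
            · simp only [hg, if_true]
              exact sum_unipotentRadical_chainFun R hi hi' (congrFun hg i)
            · simp [hg]
  exact (mul_eq_zero.mp h2).resolve_left (Nat.cast_ne_zero.mpr Nat.card_pos.ne')

lemma sum_chainFun_mul_self (hV : 0 < Module.finrank k V) :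
    ∑ g : V ≃ₗ[k] V, chainFun R g * chainFun R g =
      Module.finrank k V * Nat.card (V ≃ₗ[k] V) := by
  classical
  have h1 : ∀ s, ∑ g : V ≃ₗ[k] V, chainFun R g * fixedChainSum R s g =
      Module.finrank k V * Nat.card (V ≃ₗ[k] V) := by
    intro s
    have h2 : ∀ g : V ≃ₗ[k] V, chainFun R g * fixedChainSum R s g =
        ∑ x ∈ monoChains (Finset.univ : Finset (Submodule k V)) s,
          (Module.finrank k (chainHead ⊤ x) : R) * if g • x = x then chainFun R g else 0 := by
      intro g
      rw [fixedChainSum, Finset.mul_sum]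
      refine Finset.sum_congr rfl fun x _ => ?_
      split_ifs <;> ring
    rw [Finset.sum_congr rfl fun g _ => h2 g, Finset.sum_comm,
      Finset.sum_eq_single (fun _ => ⊤)]
    · have h3 : chainHead ⊤ (fun _ : Fin s => (⊤ : Submodule k V)) = ⊤ := by cases s <;> rfl
      have h4 : ∀ g : V ≃ₗ[k] V, g • (fun _ : Fin s => (⊤ : Submodule k V)) = fun _ => ⊤ :=
        fun g => funext fun i => smul_submodule_top g
      simp only [h4, if_true]
      rw [← Finset.mul_sum, sum_chainFun R hV, h3, finrank_top]
    · intro x hx hx'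
      rw [mem_monoChains] at hx
      rw [← Finset.mul_sum]
      by_cases hi : ∃ i, x i ≠ ⊥ ∧ x i ≠ ⊤
      · obtain ⟨i, hi, hi'⟩ := hi
        rw [sum_stabilizer_chainFun R hx.2 hi hi', mul_zero]
      · push Not at hi
        obtain ⟨j, hj⟩ : ∃ j, x j = ⊥ := by
          by_contra! h
          exact hx' (funext fun i => hi i (h i))
        have h5 : chainHead ⊤ x = ⊥ := by
          cases s with
          | zero => exact j.elim0
          | succ s => exact le_bot_iff.mp ((hx.2 (Fin.zero_le j)).trans hj.le)
        rw [h5, finrank_bot, Nat.cast_zero, zero_mul]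
    · intro h
      exact absurd (mem_monoChains.mpr ⟨fun _ => Finset.mem_univ _, monotone_const⟩) h
  have h6 : ∀ g : V ≃ₗ[k] V, chainFun R g * chainFun R g =
      alternatingSum (Module.finrank k V) fun s => chainFun R g * fixedChainSum R s g := by
    intro g
    rw [alternatingSum_const_mul]
    rfl
  rw [Finset.sum_congr rfl fun g _ => h6 g, sum_alternatingSum, funext h1, alternatingSum_const hV]

end ChainFunction

section SelfdualSupercuspidal

open scoped Pointwise

lemma smul_unitsMul_eq_iff {k K : Type} [Field k] [Field K] [Algebra k K] [FiniteDimensional k K]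
    {t : Kˣ} (ht : IntermediateField.adjoin k {(t : K)} = ⊤) (A : Submodule k K) :
    unitsMul k K t • A = A ↔ A = ⊥ ∨ A = ⊤ := by
  constructor
  · intro h
    let S : Subalgebra k K :=
      { carrier := {s | ∀ a ∈ A, s * a ∈ A}
        mul_mem' := fun {x y} hx hy a ha => by
          rw [mul_assoc]
          exact hx _ (hy a ha)
        add_mem' := fun {x y} hx hy a ha => by
          rw [add_mul]
          exact A.add_mem (hx a ha) (hy a ha)
        algebraMap_mem' := fun c a ha => by
          rw [← Algebra.smul_def]
          exact A.smul_mem c ha }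
    have hS : S = ⊤ := by
      rw [eq_top_iff, ← IntermediateField.top_toSubalgebra, ← ht,
        IntermediateField.adjoin_simple_toSubalgebra_of_isAlgebraic
          (Algebra.IsAlgebraic.isAlgebraic (t : K)), Algebra.adjoin_le_iff,
        Set.singleton_subset_iff]
      intro a ha
      rw [← h]
      exact ⟨a, ha, unitsMul_apply ..⟩
    refine or_iff_not_imp_left.mpr fun hA => ?_
    obtain ⟨a, ha, ha0⟩ := A.exists_mem_ne_zero_of_ne_bot hA
    refine eq_top_iff.mpr fun x _ => ?_
    have hx : x / a ∈ S := hS ▸ Algebra.mem_top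
    simpa [ha0] using hx a ha
  · rintro (rfl | rfl)
    · exact Submodule.map_bot _
    · exact smul_submodule_top _

/-- A virtual character of norm one giving a selfdual supercuspidal representation. -/
lemma exists_cuspidal_virtualChar {k K R : Type} [Field k] [Fintype k] [Field K] [Fintype K]
    [Algebra k K] [Fintype (K ≃ₗ[k] K)] [Field R] [IsAlgClosed R] [CharZero R] {m : ℕ}
    (hq : 3 ≤ Fintype.card k) (hm : 0 < m) (hrank : Module.finrank k K = 2 * m) :
    ∃ ψ : (K ≃ₗ[k] K) → R, IsVirtualChar ψ ∧ (∀ g, ψ g⁻¹ = ψ g) ∧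
      ∑ g, ψ g * ψ g⁻¹ = Nat.card (K ≃ₗ[k] K) ∧
      ∀ W : Submodule k K, W ≠ ⊥ → W ≠ ⊤ → ∀ [Fintype (unipotentRadical W)],
        ∑ u : unipotentRadical W, ψ u = 0 := by
  let := Fintype.ofFinite (Submodule k K)
  obtain ⟨φ, hφ, hinv, hfix, hsq, hprod⟩ := exists_torus_function (R := R) hq hm hrank
  have hV : 0 < Module.finrank k K := by omega
  have h1 := hprod (chainFun R) (chainFun_conj R) fun t ht => by
    rw [chainFun_eq_finrank R hV (smul_unitsMul_eq_iff ht), hrank]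
    push_cast
    rfl
  have h2 := sum_chainFun_mul_self (k := k) (V := K) R hV
  refine ⟨φ + chainFun R, hφ.add (isVirtualChar_chainFun R), fun g => ?_, ?_, ?_⟩
  · simp only [Pi.add_apply, hinv, chainFun_inv]
  · have h3 : ∀ g : K ≃ₗ[k] K, (φ g + chainFun R g) * (φ g⁻¹ + chainFun R g⁻¹) =
        φ g * φ g + 2 * (φ g * chainFun R g) + chainFun R g * chainFun R g := by
      intro g
      simp only [hinv, chainFun_inv]
      ring
    simp only [Pi.add_apply]
    rw [Finset.sum_congr rfl fun g _ => h3 g, Finset.sum_add_distrib, Finset.sum_add_distrib,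
      ← Finset.mul_sum, hsq, h1, h2, hrank]
    push_cast
    ring
  · intro W hW hW' _
    have h4 := sum_unipotentRadical_chainFun R hW hW' (m := 1) (one_smul _ W)
    simp only [one_mul] at h4
    simp only [Pi.add_apply, Finset.sum_add_distrib, h4, add_zero]
    obtain ⟨w, hw, hw0⟩ := W.exists_mem_ne_zero_of_ne_bot hW
    exact Finset.sum_eq_zero fun u _ => hfix u w hw0 (u.2.2 w hw)

lemma exists_selfdual_supercuspidal_of_even {k R : Type} [Field k] [Fintype k] [Field R]
    [IsAlgClosed R] [CharZero R] {m : ℕ} (hq : 3 ≤ Fintype.card k) (hm : 0 < m) :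
    ∃ (M : ModuleCat R) (ρ : Representation R (GL (Fin (2 * m)) k) ↥M),
      IsIrreducibleRep ρ ∧ IsSupercuspidal k ρ ∧ RepIso ρ ρ.dual := by
  obtain ⟨p, hp⟩ := CharP.exists k
  have : Fact p.Prime := ⟨CharP.char_is_prime k p⟩
  have : NeZero (2 * m) := ⟨by omega⟩
  let K := FiniteField.Extension k p (2 * m)
  let := Fintype.ofFinite K
  have : Finite (K ≃ₗ[k] K) := Finite.of_injective _ DFunLike.coe_injective
  let := Fintype.ofFinite (K ≃ₗ[k] K)
  have hrank : Module.finrank k K = 2 * m := FiniteField.finrank_extension k p (2 * m)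
  obtain ⟨ψ, hψ, hinv, hnorm, hcusp⟩ := exists_cuspidal_virtualChar (R := R) hq hm hrank
  obtain ⟨V, _, _, _, ρ, hρ, hchar⟩ := hψ.exists_irreducible hnorm
  let b : Module.Basis (Fin (2 * m)) k K := (Module.finBasis k K).reindex (finCongr hrank)
  refine ⟨ModuleCat.of R V, ρ.comp (glEquivOfBasis b).toMonoidHom, hρ.comp_mulEquiv _, ?_, ?_⟩
  · refine isSupercuspidal_of_sum_char b ρ hρ fun W hW hW' _ => ?_
    rcases hchar with h | h
    · rw [h]
      exact hcusp W hW hW'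
    · simp only [h, Pi.neg_apply, Finset.sum_neg_distrib, hcusp W hW hW', neg_zero]
  · obtain ⟨e, he⟩ := repIso_dual_of_character_inv hρ fun g => by
      rcases hchar with h | h <;> simp only [h, Pi.neg_apply, hinv]
    refine ⟨e, fun g v => ?_⟩
    rw [Representation.dual_apply]
    change e (ρ (glEquivOfBasis b g) v) = Module.Dual.transpose (ρ (glEquivOfBasis b g⁻¹)) (e v)
    rw [map_inv]
    exact he _ v

lemma exists_selfdual_supercuspidal_of_le_one (k R : Type) [Field k] [Field R] {n : ℕ}
    (hn : n ≤ 1) :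
    ∃ (M : ModuleCat R) (ρ : Representation R (GL (Fin n) k) ↥M),
      IsIrreducibleRep ρ ∧ IsSupercuspidal k ρ ∧ RepIso ρ ρ.dual := by
  refine ⟨ModuleCat.of R R, 1, ⟨bot_ne_top, fun W _ => eq_bot_or_eq_top W⟩, ?_, ?_⟩
  · intro r hr B _ hB
    have := Fintype.card_le_of_surjective B hB
    simp only [Fintype.card_fin] at this
    omega
  · refine ⟨(LinearMap.ringLmapEquivSelf R R R).symm, fun g v => ?_⟩
    rw [Representation.dual_apply]
    rfl

end SelfdualSupercuspidal

/-- In characteristic `0`, if `n = 1` or `n` is even then `GL n k` (`p ≠ 2`)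
has a selfdual supercuspidal irreducible representation. -/
theorem exists_selfdual_supercuspidal
    (p : ℕ) [Fact p.Prime] (hp : p ≠ 2)
    (k : Type) [Field k] [Fintype k] [CharP k p]
    (R : Type) [Field R] [IsAlgClosed R] [CharZero R]
    (n : ℕ) (hn : n = 1 ∨ Even n) :
    ∃ (M : ModuleCat R) (ρ : Representation R (GL (Fin n) k) ↥M),
      IsIrreducibleRep ρ ∧ IsSupercuspidal k ρ ∧ RepIso ρ ρ.dual := by
  have hcard : 3 ≤ Fintype.card k := by
    obtain ⟨d, hp', hd⟩ := FiniteField.card k p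
    rw [hd]
    calc 3 ≤ p := by have := hp'.two_le; omega
      _ ≤ p ^ (d : ℕ) := Nat.le_self_pow d.ne_zero p
  rcases le_or_gt n 1 with h | h
  · exact exists_selfdual_supercuspidal_of_le_one k R h
  · obtain ⟨m, rfl⟩ := hn.resolve_left h.ne'
    rw [← two_mul]
    exact exists_selfdual_supercuspidal_of_even hcard (by omega)
end

section
/- Let l be a finite field of characteristic p ≠ 2, let m ≥ 1, let i be an integer with 0 ≤ i ≤ ⌊m/2⌋, and let R be an algebraically closed field of characteristic different from p. Let χ be a character (one-dimensional R-representation) of the block-diagonal subgroup (GL_i × GL_{m−i})(l) of GL_m(l). If there exists a cuspidal irreducible R-representation ρ of GL_m(l) with Hom_{(GL_i × GL_{m−i})(l)}(ρ, χ) ≠ 0, then either m = 1 or m = 2i. -/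
open Matrix

section Cuspidal

variable (k : Type) [Field k]

/-- A representation of `GL n k` is cuspidal if it has no nonzero vector invariant under the
unipotent radical of a proper (maximal) parabolic subgroup. -/
def IsCuspidal {R : Type} [CommRing R] {n : ℕ} {V : Type} [AddCommGroup V] [Module R V]
    (ρ : Representation R (GL (Fin n) k) V) : Prop :=
  ∀ a b : ℕ, 0 < a → 0 < b → a + b = n →
    ∀ v : V,
      (∀ g : GL (Fin n) k,
        (∀ i j : Fin n, ¬((i : ℕ) < a ∧ a ≤ (j : ℕ)) →
          (g : Matrix (Fin n) (Fin n) k) i j = (1 : Matrix (Fin n) (Fin n) k) i j) →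
        ρ g v = v) → v = 0

end Cuspidal
section Levi

variable (k : Type) [Field k]

lemma levi_mem_iff {n r : ℕ} (B : Fin n → Fin r) (M : Matrix (Fin n) (Fin n) k) :
    (∀ i j, B i ≠ B j → M i j = 0) ↔
      (Matrix.BlockTriangular M B ∧ Matrix.BlockTriangular M (OrderDual.toDual ∘ B)) := by
  constructor
  · intro h
    refine ⟨fun i j hij => h i j (ne_of_gt hij), fun i j hij => h i j (ne_of_lt ?_)⟩
    exact OrderDual.toDual_lt_toDual.mp hij
  · rintro ⟨h₁, h₂⟩ i j hij
    rcases lt_or_gt_of_ne hij with hlt | hgt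
    · exact h₂ (by simpa using hlt)
    · exact h₁ hgt

/-- The block-diagonal Levi subgroup of `GL n k` attached to a block function `B`. -/
def levi (n r : ℕ) (B : Fin n → Fin r) : Subgroup (GL (Fin n) k) where
  carrier := {g | ∀ i j, B i ≠ B j → (g : Matrix (Fin n) (Fin n) k) i j = 0}
  one_mem' := by
    intro i j hij
    have hne : i ≠ j := fun h => hij (by rw [h])
    simp [Matrix.one_apply, hne]
  mul_mem' := by
    intro a b ha hb
    have h : ((a * b : GL (Fin n) k) : Matrix (Fin n) (Fin n) k)
        = (a : Matrix (Fin n) (Fin n) k) * (b : Matrix (Fin n) (Fin n) k) := rfl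
    rw [Set.mem_setOf_eq] at ha hb ⊢
    rw [levi_mem_iff] at ha hb ⊢
    rw [h]
    exact ⟨ha.1.mul hb.1, ha.2.mul hb.2⟩
  inv_mem' := by
    intro a ha
    have h : ((a⁻¹ : GL (Fin n) k) : Matrix (Fin n) (Fin n) k)
        = (a : Matrix (Fin n) (Fin n) k)⁻¹ := by
      simp [Matrix.coe_units_inv]
    rw [Set.mem_setOf_eq] at ha ⊢
    rw [levi_mem_iff] at ha ⊢
    rw [h]
    haveI : Invertible (a : Matrix (Fin n) (Fin n) k) := a.invertible
    exact ⟨Matrix.blockTriangular_inv_of_blockTriangular ha.1,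
      Matrix.blockTriangular_inv_of_blockTriangular ha.2⟩

end Levi
/-- The block function on `Fin n` describing two consecutive blocks, the first of size `r`. -/
def twoBlocks (n r : ℕ) : Fin n → Fin 2 := fun i => if (i : ℕ) < r then 0 else 1

/-! ### Additive characters of a finite field and Fourier inversion -/

section Fourier

lemma exists_nontrivial_addChar (l R : Type) [Field l] [Fintype l] [Field R] [IsAlgClosed R]
    (h : ringChar R ≠ ringChar l) :
    ∃ ψ : AddChar l R, ∀ y : l, (∀ t, ψ (y * t) = 1) → y = 0 := by
  let P := AddChar.FiniteField.primitiveChar l R h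
  have : FiniteDimensional R (CyclotomicField P.n R) :=
    inferInstanceAs (FiniteDimensional R (Polynomial.cyclotomic P.n R).SplittingField)
  let f : CyclotomicField P.n R →ₐ[R] R := IsAlgClosed.lift
  refine ⟨(f : CyclotomicField P.n R →* R).compAddChar P.char, fun y hy => ?_⟩
  by_contra hne
  refine P.prim hne (DFunLike.ext _ _ fun t => ?_)
  have ht : f (P.char (y * t)) = f 1 := by simpa using hy t
  simpa using (f : CyclotomicField P.n R →+* R).injective ht

lemma natCast_card_ne_zero (p : ℕ) [Fact p.Prime] (l R ι : Type) [Field l] [Fintype l] [CharP l p]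
    [Field R] [Fintype ι] [DecidableEq ι] (h : ringChar R ≠ p) :
    (Fintype.card (ι → l) : R) ≠ 0 := by
  obtain ⟨n, hp, hn⟩ := FiniteField.card l p
  have hp0 : (p : R) ≠ 0 := by
    intro h0
    have hdvd := (ringChar.spec R p).1 h0
    rcases (Nat.dvd_prime hp).1 hdvd with h1 | h1
    · exact CharP.ringChar_ne_one h1
    · exact h h1
  rw [Fintype.card_fun, hn]
  push_cast
  exact pow_ne_zero _ (pow_ne_zero _ hp0)

variable {l R ι : Type} [Field l] [Fintype l] [Field R] [Fintype ι] [DecidableEq ι]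

lemma sum_addChar_dotProduct (ψ : AddChar l R)
    (hψ : ∀ y : l, (∀ t, ψ (y * t) = 1) → y = 0) {x : ι → l} (hx : x ≠ 0) :
    ∑ y : ι → l, ψ (-(y ⬝ᵥ x)) = 0 := by
  let χ : AddChar (ι → l) R :=
    { toFun := fun y => ψ (-(y ⬝ᵥ x))
      map_zero_eq_one' := by simp
      map_add_eq_mul' := fun a b => by
        rw [add_dotProduct, neg_add, AddChar.map_add_eq_mul] }
  have hχ : χ ≠ 1 := by
    intro h1
    refine hx (funext fun j => hψ _ fun t => ?_)
    have := DFunLike.congr_fun h1 (Pi.single j (-t))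
    simpa [χ, single_dotProduct, mul_comm] using this
  exact AddChar.sum_eq_zero_of_ne_one hχ

lemma exists_fourier_coeff_ne_zero (ψ : AddChar l R)
    (hψ : ∀ y : l, (∀ t, ψ (y * t) = 1) → y = 0) (hcard : (Fintype.card (ι → l) : R) ≠ 0)
    (f : (ι → l) → R) (hf : f 0 ≠ 0) : ∃ y : ι → l, ∑ x, ψ (-(y ⬝ᵥ x)) * f x ≠ 0 := by
  by_contra! h
  have hs : ∑ y : ι → l, ∑ x, ψ (-(y ⬝ᵥ x)) * f x = 0 := Finset.sum_eq_zero fun y _ => h y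
  rw [Finset.sum_comm, Finset.sum_eq_single 0] at hs
  · simp only [dotProduct_zero, neg_zero, AddChar.map_zero_eq_one, one_mul, Finset.sum_const,
      Finset.card_univ, nsmul_eq_mul] at hs
    exact mul_ne_zero hcard hf hs
  · intro x _ hx
    rw [← Finset.sum_mul, sum_addChar_dotProduct ψ hψ hx, zero_mul]
  · simp

end Fourier

/-! ### Matrices -/

section MatrixLemmas

variable {l : Type} [Field l]

/-- A nonzero vector supported on `S` is a row of an invertible matrix which differs from the
identity only inside the block `S × S`. -/
lemma exists_GL_row_eq {ι : Type} [Fintype ι] [DecidableEq ι] (S : Set ι) (r : ι) (hr : r ∈ S)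
    (y : ι → l) (hy : y ≠ 0) (hyS : ∀ j, j ∉ S → y j = 0) :
    ∃ h : GL ι l, (∀ b, (h : Matrix ι ι l) r b = y b) ∧
      ∀ a b, a ∉ S ∨ b ∉ S → (h : Matrix ι ι l) a b = (1 : Matrix ι ι l) a b := by
  have key : ∀ z : ι → l, z r ≠ 0 → (∀ j, j ∉ S → z j = 0) →
      ∃ h : GL ι l, (∀ b, (h : Matrix ι ι l) r b = z b) ∧
        ∀ a b, a ∉ S ∨ b ∉ S → (h : Matrix ι ι l) a b = (1 : Matrix ι ι l) a b := by
    intro z hz hzS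
    have hdet : ((1 : Matrix ι ι l).updateRow r z).det ≠ 0 := by
      have h := Matrix.cramer_transpose_apply (1 : Matrix ι ι l) z r
      rw [transpose_one, Matrix.cramer_one] at h
      rw [← h]
      exact hz
    refine ⟨GeneralLinearGroup.mkOfDetNeZero _ hdet, fun b => ?_, fun a b hab => ?_⟩
    · simp [GeneralLinearGroup.mkOfDetNeZero]
    · change (1 : Matrix ι ι l).updateRow r z a b = _
      rw [updateRow_apply]
      split_ifs with har
      · subst har
        have hb : b ∉ S := hab.resolve_left (fun h => h hr)
        have hne : a ≠ b := fun h => hb (h ▸ hr)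
        rw [hzS b hb, one_apply_ne hne]
      · rfl
  by_cases hyr : y r = 0
  · obtain ⟨j, hj⟩ : ∃ j, y j ≠ 0 := by
      by_contra! h
      exact hy (funext h)
    have hjr : j ≠ r := fun h => hj (h ▸ hyr)
    have hjS : j ∈ S := by
      by_contra h
      exact hj (hyS j h)
    obtain ⟨h, hrow, hout⟩ := key (y + Pi.single r (y j)) (by simpa [hyr] using hj) (by
      intro b hb
      have hbr : b ≠ r := fun h => hb (h ▸ hr)
      simp [hyS b hb, hbr])
    have hdet : (transvection j r (-1 : l)).det ≠ 0 := by
      rw [det_transvection_of_ne j r hjr]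
      exact one_ne_zero
    have hmul : ∀ a b, ((h * GeneralLinearGroup.mkOfDetNeZero _ hdet : GL ι l) : Matrix ι ι l) a b
        = (h : Matrix ι ι l) a b + if b = r then -(h : Matrix ι ι l) a j else 0 := by
      intro a b
      change ((h : Matrix ι ι l) * transvection j r (-1 : l)) a b = _
      split_ifs with hb
      · subst hb
        rw [mul_transvection_apply_same]
        ring
      · rw [mul_transvection_apply_of_ne _ _ _ _ hb, add_zero]
    refine ⟨h * GeneralLinearGroup.mkOfDetNeZero _ hdet, fun b => ?_, fun a b hab => ?_⟩
    · rw [hmul, hrow, hrow]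
      by_cases hb : b = r
      · subst hb
        simp [hjr]
      · simp [hb]
    · rw [hmul, hout a b hab]
      split_ifs with hb
      · have ha : a ∉ S := hab.resolve_right (fun h => h (hb ▸ hr))
        have haj : a ≠ j := fun h => ha (h ▸ hjS)
        rw [hout a j (Or.inl ha), one_apply_ne haj]
        simp
      · simp
  · exact key y hyr hyS

variable {m : ℕ}

/-- The strictly upper triangular matrix with column `k` given by the entries of `x` above `k`. -/
def colNilp (k : Fin m) (x : Fin m → l) : Matrix (Fin m) (Fin m) l :=
  Matrix.of fun a b => if b = k ∧ a < k then x a else 0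

lemma mul_colNilp_apply (k : Fin m) (x : Fin m → l) (A : Matrix (Fin m) (Fin m) l) (a b : Fin m) :
    (A * colNilp k x) a b = if b = k then ∑ c, if c < k then A a c * x c else 0 else 0 := by
  rw [Matrix.mul_apply]
  split_ifs with hb
  · exact Finset.sum_congr rfl fun c _ => by simp [colNilp, hb]
  · exact Finset.sum_eq_zero fun c _ => by simp [colNilp, hb]

lemma colNilp_mul_colNilp (k : Fin m) (x y : Fin m → l) : colNilp k x * colNilp k y = 0 := by
  ext a b
  rw [mul_colNilp_apply]
  split_ifs
  · refine Finset.sum_eq_zero fun c _ => ?_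
    split_ifs with hc
    · simp [colNilp, hc.ne]
    · rfl
  · rfl

lemma colNilp_add (k : Fin m) (x y : Fin m → l) :
    colNilp k (x + y) = colNilp k x + colNilp k y := by
  ext a b
  simp only [colNilp, of_apply, Matrix.add_apply, Pi.add_apply]
  split_ifs <;> simp

lemma one_add_colNilp_mul (k : Fin m) (x y : Fin m → l) :
    (1 + colNilp k x) * (1 + colNilp k y) = 1 + colNilp k (x + y) := by
  rw [add_mul, mul_add, mul_add, colNilp_mul_colNilp, colNilp_add]
  simp only [one_mul, mul_one, add_zero]
  abel

lemma colNilp_zero (k : Fin m) : colNilp k (0 : Fin m → l) = 0 := by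
  ext a b
  simp [colNilp]

/-- The unipotent matrix whose column `k` is given by the entries of `x` above the diagonal. -/
def colUnip (k : Fin m) (x : Fin m → l) : GL (Fin m) l where
  val := 1 + colNilp k x
  inv := 1 + colNilp k (-x)
  val_inv := by rw [one_add_colNilp_mul, add_neg_cancel, colNilp_zero, add_zero]
  inv_val := by rw [one_add_colNilp_mul, neg_add_cancel, colNilp_zero, add_zero]

lemma coe_colUnip (k : Fin m) (x : Fin m → l) :
    (colUnip k x : Matrix (Fin m) (Fin m) l) = 1 + colNilp k x := rfl

lemma colUnip_mul (k : Fin m) (x y : Fin m → l) :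
    colUnip k x * colUnip k y = colUnip k (x + y) :=
  Units.ext (one_add_colNilp_mul k x y)

lemma colUnip_zero (k : Fin m) : colUnip k (0 : Fin m → l) = 1 :=
  Units.ext (by rw [coe_colUnip, colNilp_zero, add_zero]; rfl)

lemma colUnip_row (k : Fin m) (x : Fin m → l) {a : Fin m} (ha : k ≤ a) (b : Fin m) :
    (colUnip k x : Matrix (Fin m) (Fin m) l) a b = (1 : Matrix (Fin m) (Fin m) l) a b := by
  simp [coe_colUnip, colNilp, ha.not_gt]

/-- The upper unitriangular matrices whose first `κ` columns are those of the identity. -/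
def IsTailUnip (κ : ℕ) (g : GL (Fin m) l) : Prop :=
  ∀ a b : Fin m, (b : ℕ) < κ ∨ b ≤ a →
    (g : Matrix (Fin m) (Fin m) l) a b = (1 : Matrix (Fin m) (Fin m) l) a b

/-- The sum of the entries just above the diagonal. -/
def superdiagSum (A : Matrix (Fin m) (Fin m) l) : l :=
  ∑ a : Fin m, ∑ b : Fin m, if (a : ℕ) + 1 = b then A a b else 0

lemma coe_inv_row {h : GL (Fin m) l} {a : Fin m}
    (hh : ∀ b, (h : Matrix (Fin m) (Fin m) l) a b = (1 : Matrix (Fin m) (Fin m) l) a b)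
    (b : Fin m) :
    ((h⁻¹ : GL (Fin m) l) : Matrix (Fin m) (Fin m) l) a b
      = (1 : Matrix (Fin m) (Fin m) l) a b := by
  have hmul : (h : Matrix (Fin m) (Fin m) l) * ((h⁻¹ : GL (Fin m) l) : Matrix (Fin m) (Fin m) l)
      = 1 := Units.mul_inv h
  rw [← hmul, Matrix.mul_apply, Finset.sum_eq_single a]
  · rw [hh a, one_apply_eq, one_mul]
  · intro c _ hc
    rw [hh c, one_apply_ne hc.symm, zero_mul]
  · simp

lemma inv_mul_mul_apply {k : Fin m} {n h : GL (Fin m) l} (hn : IsTailUnip ((k : ℕ) + 1) n)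
    (hh : ∀ a b : Fin m, k ≤ a →
      (h : Matrix (Fin m) (Fin m) l) a b = (1 : Matrix (Fin m) (Fin m) l) a b) (a b : Fin m) :
    ((h⁻¹ * n * h : GL (Fin m) l) : Matrix (Fin m) (Fin m) l) a b
      = (1 : Matrix (Fin m) (Fin m) l) a b
        + (((h⁻¹ : GL (Fin m) l) : Matrix (Fin m) (Fin m) l)
          * ((n : Matrix (Fin m) (Fin m) l) - 1)) a b := by
  have hE : ((n : Matrix (Fin m) (Fin m) l) - 1) * (h : Matrix (Fin m) (Fin m) l)
      = (n : Matrix (Fin m) (Fin m) l) - 1 := by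
    conv_rhs => rw [← mul_one ((n : Matrix (Fin m) (Fin m) l) - 1)]
    ext i j
    rw [Matrix.mul_apply, Matrix.mul_apply]
    refine Finset.sum_congr rfl fun c _ => ?_
    by_cases hc : k ≤ c
    · rw [hh c j hc]
    · have hc' : (c : ℕ) < (k : ℕ) + 1 := by
        have := Fin.lt_def.1 (not_le.1 hc)
        omega
      rw [Matrix.sub_apply, hn i c (Or.inl hc'), sub_self, zero_mul, zero_mul]
  have hinv : ((h⁻¹ : GL (Fin m) l) : Matrix (Fin m) (Fin m) l) * (h : Matrix (Fin m) (Fin m) l)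
      = 1 := Units.inv_mul h
  have : ((h⁻¹ * n * h : GL (Fin m) l) : Matrix (Fin m) (Fin m) l)
      = 1 + ((h⁻¹ : GL (Fin m) l) : Matrix (Fin m) (Fin m) l)
          * ((n : Matrix (Fin m) (Fin m) l) - 1) := by
    rw [← hE, mul_sub_right_distrib, one_mul, mul_sub, hinv, Units.val_mul, Units.val_mul,
      mul_assoc, add_sub_cancel]
  rw [this, Matrix.add_apply]

lemma inv_mul_mul_tailUnip {k : Fin m} {n h : GL (Fin m) l} (hn : IsTailUnip ((k : ℕ) + 1) n)
    (hh : ∀ a b : Fin m, k ≤ a →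
      (h : Matrix (Fin m) (Fin m) l) a b = (1 : Matrix (Fin m) (Fin m) l) a b) :
    IsTailUnip ((k : ℕ) + 1) (h⁻¹ * n * h) ∧
      superdiagSum ((h⁻¹ * n * h : GL (Fin m) l) : Matrix (Fin m) (Fin m) l)
        = superdiagSum (n : Matrix (Fin m) (Fin m) l) := by
  have hcol : ∀ a b : Fin m, (b : ℕ) < (k : ℕ) + 1 →
      ((h⁻¹ * n * h : GL (Fin m) l) : Matrix (Fin m) (Fin m) l) a b
        = (1 : Matrix (Fin m) (Fin m) l) a b := by
    intro a b hb
    rw [inv_mul_mul_apply hn hh, Matrix.mul_apply, Finset.sum_eq_zero, add_zero]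
    intro c _
    rw [Matrix.sub_apply, hn c b (Or.inl hb), sub_self, mul_zero]
  have hrow : ∀ a b : Fin m, k ≤ a →
      ((h⁻¹ * n * h : GL (Fin m) l) : Matrix (Fin m) (Fin m) l) a b
        = (n : Matrix (Fin m) (Fin m) l) a b := by
    intro a b ha
    rw [inv_mul_mul_apply hn hh, Matrix.mul_apply, Finset.sum_eq_single a]
    · rw [coe_inv_row (fun b => hh a b ha), one_apply_eq, one_mul, Matrix.sub_apply]
      ring
    · intro c _ hc
      rw [coe_inv_row (fun b => hh a b ha), one_apply_ne hc.symm, zero_mul]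
    · simp
  constructor
  · intro a b hab
    by_cases hb : (b : ℕ) < (k : ℕ) + 1
    · exact hcol a b hb
    · have hba : b ≤ a := hab.resolve_left hb
      have hka : k ≤ a := by
        rw [Fin.le_def] at hba ⊢
        omega
      rw [hrow a b hka]
      exact hn a b hab
  · refine Finset.sum_congr rfl fun a _ => Finset.sum_congr rfl fun b _ => ?_
    split_ifs with hab
    · by_cases hb : (b : ℕ) < (k : ℕ) + 1
      · rw [hcol a b hb, hn a b (Or.inl hb)]
      · refine hrow a b ?_
        rw [Fin.le_def]
        omega
    · rfl

lemma mul_colUnip_neg_apply {k : Fin m} {g : GL (Fin m) l} (hg : IsTailUnip (k : ℕ) g)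
    (a b : Fin m) :
    ((g * colUnip k (-fun c => (g : Matrix (Fin m) (Fin m) l) c k) : GL (Fin m) l) :
        Matrix (Fin m) (Fin m) l) a b
      = if b = k then (1 : Matrix (Fin m) (Fin m) l) a b
        else (g : Matrix (Fin m) (Fin m) l) a b := by
  rw [Units.val_mul, coe_colUnip, mul_add, mul_one, Matrix.add_apply, mul_colNilp_apply]
  split_ifs with hb
  · subst hb
    have hs : (∑ c, if c < b then (g : Matrix (Fin m) (Fin m) l) a c
        * (-fun c => (g : Matrix (Fin m) (Fin m) l) c b) c else 0)
        = if a < b then -(g : Matrix (Fin m) (Fin m) l) a b else 0 := by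
      rw [Finset.sum_eq_single a]
      · split_ifs with hab
        · rw [hg a a (Or.inr le_rfl), one_apply_eq, one_mul]
          rfl
        · rfl
      · intro c _ hc
        split_ifs with hcb
        · rw [hg a c (Or.inl (Fin.lt_def.1 hcb)), one_apply_ne hc.symm, zero_mul]
        · rfl
      · simp
    rw [hs]
    split_ifs with hab
    · rw [add_neg_cancel, one_apply_ne hab.ne]
    · rw [add_zero, hg a b (Or.inr (not_lt.1 hab))]
  · rw [add_zero]

lemma mul_colUnip_neg_tailUnip {k : Fin m} {g : GL (Fin m) l} (hg : IsTailUnip (k : ℕ) g) :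
    IsTailUnip ((k : ℕ) + 1) (g * colUnip k (-fun c => (g : Matrix (Fin m) (Fin m) l) c k)) := by
  intro a b hab
  rw [mul_colUnip_neg_apply hg]
  split_ifs with hb
  · rfl
  · refine hg a b (hab.imp_left fun h => ?_)
    have : (b : ℕ) ≠ k := fun h' => hb (Fin.ext h')
    omega

lemma superdiagSum_mul_colUnip_neg {k r : Fin m} (hr : (r : ℕ) + 1 = k) {g : GL (Fin m) l}
    (hg : IsTailUnip (k : ℕ) g) :
    (g : Matrix (Fin m) (Fin m) l) r k
      + superdiagSum ((g * colUnip k (-fun c => (g : Matrix (Fin m) (Fin m) l) c k) :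
        GL (Fin m) l) : Matrix (Fin m) (Fin m) l)
      = superdiagSum (g : Matrix (Fin m) (Fin m) l) := by
  have hsingle : (∑ a : Fin m, ∑ b : Fin m, if a = r ∧ b = k then
      (g : Matrix (Fin m) (Fin m) l) a b else 0) = (g : Matrix (Fin m) (Fin m) l) r k := by
    rw [Finset.sum_eq_single r, Finset.sum_eq_single k]
    · simp
    · intro b _ hb
      simp [hb]
    · simp
    · intro a _ ha
      simp [ha]
    · simp
  rw [← hsingle, superdiagSum, superdiagSum, ← Finset.sum_add_distrib]
  refine Finset.sum_congr rfl fun a _ => ?_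
  rw [← Finset.sum_add_distrib]
  refine Finset.sum_congr rfl fun b _ => ?_
  rw [mul_colUnip_neg_apply hg]
  by_cases hb : b = k
  · subst hb
    by_cases ha : a = r
    · subst ha
      have hne : a ≠ b := fun h => by
        rw [h] at hr
        omega
      simp [hr, one_apply_ne hne]
    · have hne : (a : ℕ) + 1 ≠ b := fun h => ha (Fin.ext (by omega))
      simp [ha, hne]
  · simp [hb]

lemma colUnip_mulVec_mul {k : Fin m} {h : GL (Fin m) l}
    (hh : ∀ a b : Fin m, k ≤ a →
      (h : Matrix (Fin m) (Fin m) l) a b = (1 : Matrix (Fin m) (Fin m) l) a b) (x : Fin m → l)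
    (hx : ∀ a, k ≤ a → x a = 0) :
    colUnip k (((h : GL (Fin m) l) : Matrix (Fin m) (Fin m) l) *ᵥ x) * h = h * colUnip k x := by
  refine Units.ext ?_
  rw [Units.val_mul, Units.val_mul, coe_colUnip, coe_colUnip, add_mul, mul_add, one_mul, mul_one]
  congr 1
  ext a b
  rw [mul_colNilp_apply, Matrix.mul_apply, Finset.sum_eq_single k]
  · rw [hh k b le_rfl]
    by_cases hb : b = k
    · subst hb
      have hs : (∑ c, if c < b then (h : Matrix (Fin m) (Fin m) l) a c * x c else 0)
          = ((h : Matrix (Fin m) (Fin m) l) *ᵥ x) a := by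
        refine Finset.sum_congr rfl fun c _ => ?_
        split_ifs with hc
        · rfl
        · rw [hx c (not_lt.1 hc), mul_zero]
      rw [if_pos rfl, hs, one_apply_eq, mul_one]
      by_cases ha : a < b
      · simp [colNilp, ha]
      · have h0 : ((h : Matrix (Fin m) (Fin m) l) *ᵥ x) a = 0 := by
          rw [mulVec, dotProduct]
          refine Finset.sum_eq_zero fun c _ => ?_
          rw [hh a c (not_lt.1 ha)]
          by_cases hac : a = c
          · rw [← hac, hx a (not_lt.1 ha), mul_zero]
          · rw [one_apply_ne hac, zero_mul]
        simp [colNilp, ha, h0]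
    · rw [if_neg hb, one_apply_ne (Ne.symm hb), mul_zero]
  · intro c _ hc
    simp [colNilp, hc]
  · simp

end MatrixLemmas

/-! ### Whittaker-type descent for representations of `GL (Fin m) l` -/

section Descent

variable {l R V : Type} [Field l] [Field R] [AddCommGroup V] [Module R V] {m : ℕ}

/-- The vectors on which the matrices satisfying `IsTailUnip κ` act through the character `ψ` of
the sum of their superdiagonal entries. -/
def tailEigenspace (ρ : Representation R (GL (Fin m) l) V) (ψ : AddChar l R) (κ : ℕ) :
    Submodule R V where
  carrier := {v | ∀ g, IsTailUnip κ g →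
    ρ g v = ψ (superdiagSum (g : Matrix (Fin m) (Fin m) l)) • v}
  add_mem' := by
    intro v w hv hw g hg
    rw [map_add, hv g hg, hw g hg, smul_add]
  zero_mem' := by
    intro g _
    rw [map_zero, smul_zero]
  smul_mem' := by
    intro c v hv g hg
    rw [map_smul, hv g hg, smul_comm]

variable {ρ : Representation R (GL (Fin m) l) V} {ψ : AddChar l R}

lemma tailEigenspace_last (v : V) : v ∈ tailEigenspace ρ ψ m := by
  intro g hg
  have h1 : g = 1 := Units.ext (Matrix.ext fun a b => hg a b (Or.inl b.2))
  have h0 : superdiagSum (1 : Matrix (Fin m) (Fin m) l) = 0 := by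
    refine Finset.sum_eq_zero fun a _ => Finset.sum_eq_zero fun b _ => ?_
    split_ifs with hab
    · exact one_apply_ne fun h => by
        rw [h] at hab
        omega
    · rfl
  rw [h1, Units.val_one, h0, map_one, AddChar.map_zero_eq_one, one_smul]
  rfl

lemma map_mem_tailEigenspace {k : Fin m} {h : GL (Fin m) l} {v : V}
    (hv : v ∈ tailEigenspace ρ ψ ((k : ℕ) + 1))
    (hh : ∀ a b : Fin m, k ≤ a →
      (h : Matrix (Fin m) (Fin m) l) a b = (1 : Matrix (Fin m) (Fin m) l) a b) :
    ρ h v ∈ tailEigenspace ρ ψ ((k : ℕ) + 1) := by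
  intro n hn
  obtain ⟨h1, h2⟩ := inv_mul_mul_tailUnip hn hh
  have hmul : n * h = h * (h⁻¹ * n * h) := by group
  rw [← Module.End.mul_apply, ← map_mul, hmul, map_mul, Module.End.mul_apply, hv _ h1, map_smul, h2]

lemma exists_colUnip_eigenvector [Fintype l] {k : Fin m}
    (hψ : ∀ y : l, (∀ t, ψ (y * t) = 1) → y = 0) (hcard : (Fintype.card (Fin m → l) : R) ≠ 0)
    (φ : V →ₗ[R] R) {v : V} (hv : v ∈ tailEigenspace ρ ψ ((k : ℕ) + 1)) (hφv : φ v ≠ 0) :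
    ∃ (y : Fin m → l) (w : V), w ∈ tailEigenspace ρ ψ ((k : ℕ) + 1) ∧ φ w ≠ 0 ∧
      ∀ x, ρ (colUnip k x) w = ψ (y ⬝ᵥ x) • w := by
  obtain ⟨y, hy⟩ := exists_fourier_coeff_ne_zero ψ hψ hcard (fun x => φ (ρ (colUnip k x) v))
    (by simpa [colUnip_zero] using hφv)
  refine ⟨y, ∑ x, ψ (-(y ⬝ᵥ x)) • ρ (colUnip k x) v, ?_, ?_, fun z => ?_⟩
  · exact Submodule.sum_mem _ fun x _ => Submodule.smul_mem _ _
      (map_mem_tailEigenspace hv fun a b ha => colUnip_row k x ha b)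
  · simpa using hy
  · rw [map_sum, Finset.smul_sum]
    refine (Finset.sum_congr rfl fun x _ => ?_).trans (Equiv.sum_comp (Equiv.addLeft z) _)
    rw [map_smul, ← Module.End.mul_apply, ← map_mul, colUnip_mul, smul_smul,
      ← AddChar.map_add_eq_mul, Equiv.coe_addLeft, dotProduct_add, neg_add, add_neg_cancel_left]

lemma apply_eq_smul_of_tailUnip {k : Fin m} {y : Fin m → l} {w : V}
    (hw : w ∈ tailEigenspace ρ ψ ((k : ℕ) + 1)) (hy : ∀ x, ρ (colUnip k x) w = ψ (y ⬝ᵥ x) • w)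
    {g : GL (Fin m) l} (hg : IsTailUnip (k : ℕ) g) :
    ρ g w = ψ ((y ⬝ᵥ fun c => (g : Matrix (Fin m) (Fin m) l) c k) +
      superdiagSum ((g * colUnip k (-fun c => (g : Matrix (Fin m) (Fin m) l) c k) :
        GL (Fin m) l) : Matrix (Fin m) (Fin m) l)) • w := by
  set x : Fin m → l := fun c => (g : Matrix (Fin m) (Fin m) l) c k with hx
  have hfac : g = g * colUnip k (-x) * colUnip k x := by
    rw [mul_assoc, colUnip_mul, neg_add_cancel, colUnip_zero, mul_one]
  conv_lhs => rw [hfac]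
  rw [map_mul, Module.End.mul_apply, hy, map_smul, hw _ (mul_colUnip_neg_tailUnip hg), smul_smul,
    AddChar.map_add_eq_mul]

lemma eq_zero_of_colUnip_invariant (hcusp : IsCuspidal l ρ) {k : Fin m} (hk : 0 < (k : ℕ)) {w : V}
    (hw : w ∈ tailEigenspace ρ ψ ((k : ℕ) + 1)) (hy : ∀ x, ρ (colUnip k x) w = w) : w = 0 := by
  refine hcusp k (m - k) hk (by omega) (by omega) w fun g hg => ?_
  have hg' : IsTailUnip (k : ℕ) g := fun a b hab => hg a b fun h => by
    rw [Fin.le_def] at hab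
    omega
  rw [apply_eq_smul_of_tailUnip (y := 0) hw (by simpa using hy) hg']
  have h0 : superdiagSum ((g * colUnip k (-fun c => (g : Matrix (Fin m) (Fin m) l) c k) :
        GL (Fin m) l) : Matrix (Fin m) (Fin m) l) = 0 := by
    refine Finset.sum_eq_zero fun a _ => Finset.sum_eq_zero fun b _ => ?_
    split_ifs with hab
    · have hne : a ≠ b := fun h => by
        rw [h] at hab
        omega
      rw [mul_colUnip_neg_apply hg']
      split_ifs with hb
      · exact one_apply_ne hne
      · rw [hg a b, one_apply_ne hne]
        have : (b : ℕ) ≠ k := fun h => hb (Fin.ext h)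
        omega
    · rfl
  rw [h0]
  simp

lemma map_mem_tailEigenspace_of_row {k r : Fin m} (hr : (r : ℕ) + 1 = k) {y : Fin m → l} {w : V}
    (hw : w ∈ tailEigenspace ρ ψ ((k : ℕ) + 1)) (hy : ∀ x, ρ (colUnip k x) w = ψ (y ⬝ᵥ x) • w)
    {h : GL (Fin m) l} (hrow : ∀ b, (h : Matrix (Fin m) (Fin m) l) r b = y b)
    (hh : ∀ a b : Fin m, k ≤ a →
      (h : Matrix (Fin m) (Fin m) l) a b = (1 : Matrix (Fin m) (Fin m) l) a b) :
    ρ h w ∈ tailEigenspace ρ ψ (k : ℕ) := by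
  intro g hg
  have hcol : ∀ z, ρ (colUnip k z) (ρ h w) = ψ (Pi.single r 1 ⬝ᵥ z) • ρ h w := by
    intro z
    let z' : Fin m → l := fun a => if a < k then z a else 0
    have hz' : colUnip k z = colUnip k z' := by
      refine Units.ext ?_
      rw [coe_colUnip, coe_colUnip]
      congr 1
      ext a b
      simp only [colNilp, of_apply, z']
      split_ifs with h1 h2
      · rfl
      · exact absurd h1.2 h2
      · rfl
    let x := ((h⁻¹ : GL (Fin m) l) : Matrix (Fin m) (Fin m) l) *ᵥ z'
    have hx : ∀ a, k ≤ a → x a = 0 := by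
      intro a ha
      simp only [x, mulVec, dotProduct]
      refine Finset.sum_eq_zero fun b _ => ?_
      rw [coe_inv_row (fun b => hh a b ha)]
      by_cases hab : a = b
      · simp [z', ← hab, ha.not_gt]
      · rw [one_apply_ne hab, zero_mul]
    have hhx : (h : Matrix (Fin m) (Fin m) l) *ᵥ x = z' := by
      have hinv : (h : Matrix (Fin m) (Fin m) l) *
          ((h⁻¹ : GL (Fin m) l) : Matrix (Fin m) (Fin m) l) = 1 := Units.mul_inv h
      rw [mulVec_mulVec, hinv, one_mulVec]
    have hyx : y ⬝ᵥ x = z r := by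
      have : y ⬝ᵥ x = ((h : Matrix (Fin m) (Fin m) l) *ᵥ x) r := by
        simp only [mulVec, dotProduct, hrow]
      rw [this, hhx]
      simp only [z']
      rw [if_pos (Fin.lt_def.2 (by omega))]
    rw [← Module.End.mul_apply, ← map_mul, hz', ← hhx, colUnip_mulVec_mul hh x hx, map_mul,
      Module.End.mul_apply, hy, map_smul, hyx, single_dotProduct, one_mul]
  rw [apply_eq_smul_of_tailUnip (map_mem_tailEigenspace hw hh) hcol hg, single_dotProduct, one_mul,
    superdiagSum_mul_colUnip_neg hr hg]

/-- A cuspidal representation has no nonzero linear form which is semi-invariant under the Levi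
subgroup given by a labelling that is constant up to `K`, with `0 < K`, and alternating beyond. -/
lemma linearForm_eq_zero_of_alternating [Fintype l] (hcusp : IsCuspidal l ρ)
    (hψ : ∀ y : l, (∀ t, ψ (y * t) = 1) → y = 0) (hcard : (Fintype.card (Fin m → l) : R) ≠ 0)
    (c : Fin m → Fin 2) (K : ℕ) (hK : 0 < K) (hKm : K < m)
    (hconst : ∀ j k : Fin m, (k : ℕ) = K → j ≤ k → c j = c k)
    (halt : ∀ r k : Fin m, K < (k : ℕ) → (r : ℕ) + 1 = k → c r ≠ c k)
    (φ : V →ₗ[R] R)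
    (hlevi : ∀ g ∈ levi l m 2 c, ∀ v, φ v ≠ 0 → φ (ρ g v) ≠ 0)
    (hunip : ∀ a b : Fin m, a < b → c a = c b → ∀ (t : l) (v : V),
      φ (ρ (colUnip b (Pi.single a t)) v) = φ v) : φ = 0 := by
  have hsupp : ∀ (k : Fin m) (y : Fin m → l) (w : V), φ w ≠ 0 →
      (∀ x, ρ (colUnip k x) w = ψ (y ⬝ᵥ x) • w) → ∀ j, (k ≤ j ∨ c j = c k) → y j = 0 := by
    intro k y w hφw hy j hj
    refine hψ _ fun t => ?_
    have heq : φ (ρ (colUnip k (Pi.single j t)) w) = φ w := by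
      by_cases hkj : k ≤ j
      · have h1 : colUnip k (Pi.single j t) = 1 := by
          rw [← colUnip_zero k]
          refine Units.ext ?_
          rw [coe_colUnip, coe_colUnip]
          congr 1
          ext a b
          simp only [colNilp, of_apply]
          split_ifs with hab
          · have haj : a ≠ j := fun h => hkj.not_gt (h ▸ hab.2)
            simp [haj]
          · rfl
        rw [h1, map_one]
        rfl
      · exact hunip j k (not_le.1 hkj) (hj.resolve_left hkj) t w
    rw [hy, map_smul, dotProduct_single, smul_eq_mul] at heq
    exact mul_right_cancel₀ hφw (heq.trans (one_mul _).symm)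
  have hdescent : ∀ d κ : ℕ, κ + d = m → K < κ →
      (∃ v ∈ tailEigenspace ρ ψ κ, φ v ≠ 0) ∨ φ = 0 := by
    intro d
    induction d with
    | zero =>
      intro κ hκ _
      by_cases h0 : φ = 0
      · exact Or.inr h0
      · obtain ⟨v, hv⟩ := DFunLike.ne_iff.1 h0
        refine Or.inl ⟨v, ?_, hv⟩
        rw [show κ = m by omega]
        exact tailEigenspace_last v
    | succ d ih =>
      intro κ hκ hKκ
      refine (ih (κ + 1) (by omega) (by omega)).imp_left ?_
      rintro ⟨v, hv, hφv⟩
      let k : Fin m := ⟨κ, by omega⟩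
      let r : Fin m := ⟨κ - 1, by omega⟩
      have hrk : (r : ℕ) + 1 = k := by
        simp only [k, r]
        omega
      obtain ⟨y, w, hw, hφw, hy⟩ := exists_colUnip_eigenvector (k := k) hψ hcard φ hv hφv
      have hy0 : y ≠ 0 := by
        rintro rfl
        have := eq_zero_of_colUnip_invariant hcusp (by simp only [k]; omega) hw (by simpa using hy)
        exact hφw (by rw [this, map_zero])
      have hcr := halt r k hKκ hrk
      obtain ⟨h, hrow, hout⟩ := exists_GL_row_eq {j | j < k ∧ c j = c r} r
        ⟨Fin.lt_def.2 (by omega), rfl⟩ y hy0 (by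
          intro j hj
          refine hsupp k y w hφw hy j ?_
          by_contra! hcon
          exact hj ⟨hcon.1, by have := hcon.2; omega⟩)
      refine ⟨ρ h w, map_mem_tailEigenspace_of_row hrk hw hy hrow ?_, hlevi h ?_ w hφw⟩
      · exact fun a b ha => hout a b (Or.inl fun hS => ha.not_gt hS.1)
      · intro a b hab
        rw [hout a b, one_apply_ne fun h => hab (by rw [h])]
        by_contra! hcon
        exact hab (hcon.1.2.trans hcon.2.2.symm)
  rcases hdescent (m - (K + 1)) (K + 1) (by omega) (by omega) with ⟨v, hv, hφv⟩ | h0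
  · exfalso
    let k : Fin m := ⟨K, hKm⟩
    obtain ⟨y, w, hw, hφw, hy⟩ := exists_colUnip_eigenvector (k := k) hψ hcard φ hv hφv
    have hy0 : y = 0 := funext fun j => hsupp k y w hφw hy j
      ((le_total k j).imp_right fun hj => hconst j k rfl hj)
    subst hy0
    have := eq_zero_of_colUnip_invariant hcusp hK hw (by simpa using hy)
    exact hφw (by rw [this, map_zero])
  · exact h0

end Descent

/-! ### Characters of Levi subgroups -/

section LeviCharacters

variable {l R : Type} [Field l] [Field R] {m : ℕ}

lemma colUnip_single_mem_levi {r : ℕ} (c : Fin m → Fin r) {a b : Fin m} (hab : c a = c b) (t : l) :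
    colUnip b (Pi.single a t) ∈ levi l m r c := by
  intro i j hij
  have hne : i ≠ j := fun h => hij (by rw [h])
  rw [coe_colUnip, Matrix.add_apply, one_apply_ne hne, zero_add, colNilp, of_apply]
  split_ifs with h
  · have : i ≠ a := fun hia => hij (by rw [hia, h.1, hab])
    simp [this]
  · rfl

lemma map_colUnip_single_eq_one {r : ℕ} (h2 : (2 : l) ≠ 0) (c : Fin m → Fin r)
    (χ : ↥(levi l m r c) →* R) {a b : Fin m} (hlt : a < b) (hab : c a = c b) (t : l) :
    χ ⟨colUnip b (Pi.single a t), colUnip_single_mem_levi c hab t⟩ = 1 := by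
  let D : Fin m → l := fun j => if j = a then 2 else 1
  have hdet : (Matrix.diagonal D).det ≠ 0 := by
    rw [det_diagonal, Finset.prod_ne_zero_iff]
    intro j _
    simp only [D]
    split_ifs
    · exact h2
    · exact one_ne_zero
  let d := GeneralLinearGroup.mkOfDetNeZero _ hdet
  have hd : d ∈ levi l m r c := fun i j hij => diagonal_apply_ne _ fun h => hij (by rw [h])
  have hDx : (d : Matrix (Fin m) (Fin m) l) *ᵥ Pi.single a t = Pi.single a t + Pi.single a t := by
    change Matrix.diagonal D *ᵥ Pi.single a t = _
    ext j
    rw [mulVec_diagonal]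
    by_cases hj : j = a
    · subst hj
      simp [D, two_mul]
    · simp [hj]
  have hcomm := colUnip_mulVec_mul (k := b) (h := d) (by
    intro i j hi
    change Matrix.diagonal D i j = _
    by_cases hij : i = j
    · subst hij
      have hia : i ≠ a := fun h => (h ▸ hi).not_gt hlt
      simp [D, hia]
    · rw [diagonal_apply_ne _ hij, one_apply_ne hij]) (Pi.single a t) (by
    intro i hi
    have hia : i ≠ a := fun h => (h ▸ hi).not_gt hlt
    simp [hia])
  rw [hDx, ← colUnip_mul] at hcomm
  let u : ↥(levi l m r c) := ⟨_, colUnip_single_mem_levi c hab t⟩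
  have hcomm' : u * u * ⟨d, hd⟩ = ⟨d, hd⟩ * u := Subtype.ext hcomm
  have hχ := congrArg χ hcomm'
  rw [map_mul, map_mul, map_mul, mul_comm (χ ⟨d, hd⟩)] at hχ
  have hunit : ∀ x, χ x ≠ 0 := fun x => ((Group.isUnit x).map χ).ne_zero
  have hχ' := mul_right_cancel₀ (hunit _) hχ
  exact mul_right_cancel₀ (hunit u) (hχ'.trans (one_mul _).symm)

/-- The matrix of the permutation `τ` as an element of `GL`. -/
def permGL (l : Type) [Field l] (τ : Equiv.Perm (Fin m)) : GL (Fin m) l where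
  val := τ.permMatrix l
  inv := (τ⁻¹).permMatrix l
  val_inv := by rw [← permMatrix_mul, inv_mul_cancel, permMatrix_one]
  inv_val := by rw [← permMatrix_mul, mul_inv_cancel, permMatrix_one]

lemma permGL_conj_apply (τ : Equiv.Perm (Fin m)) (g : GL (Fin m) l) (a b : Fin m) :
    ((permGL l τ * g * (permGL l τ)⁻¹ : GL (Fin m) l) : Matrix (Fin m) (Fin m) l) a b
      = (g : Matrix (Fin m) (Fin m) l) (τ a) (τ b) := by
  change (τ.toPEquiv.toMatrix * (g : Matrix (Fin m) (Fin m) l) *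
    (τ⁻¹).toPEquiv.toMatrix : Matrix (Fin m) (Fin m) l) a b = _
  rw [PEquiv.toMatrix_toPEquiv_mul, PEquiv.mul_toMatrix_toPEquiv]
  rfl

/-- Conjugation by a permutation matrix, from the Levi subgroup of the permuted labelling. -/
def leviPermConj {r : ℕ} (τ : Equiv.Perm (Fin m)) (B c : Fin m → Fin r)
    (hc : ∀ a, c (τ a) = B a) : ↥(levi l m r c) →* ↥(levi l m r B) :=
  ((MulAut.conj (permGL l τ)).toMonoidHom.comp (levi l m r c).subtype).codRestrict (levi l m r B)
    fun g a b hab => (permGL_conj_apply τ (g : GL (Fin m) l) a b).trans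
      (g.2 _ _ (by rwa [hc, hc]))

/-- For `2 * i < m`, the labelling with `i` zeros which alternates from the end of `Fin m` until
the zeros are exhausted is a permutation of `twoBlocks m i`. -/
lemma exists_perm_alternating {m i : ℕ} (h : 2 * i < m) :
    ∃ τ : Equiv.Perm (Fin m), ∀ a,
      (if (m - 1 - (τ a : ℕ)) % 2 = 0 ∧ m - 1 - (τ a : ℕ) < 2 * i then (0 : Fin 2) else 1)
        = twoBlocks m i a := by
  let e : {a : Fin m // (a : ℕ) < i} ≃
      {j : Fin m // (m - 1 - (j : ℕ)) % 2 = 0 ∧ m - 1 - (j : ℕ) < 2 * i} :=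
    { toFun := fun a => ⟨⟨m - 1 - 2 * a, by omega⟩, by
        have := a.2
        constructor <;> dsimp only <;> omega⟩
      invFun := fun j => ⟨⟨(m - 1 - j) / 2, by omega⟩, by
        have := j.2
        dsimp only
        omega⟩
      left_inv := fun a => by
        have := a.2
        ext
        dsimp only
        omega
      right_inv := fun j => by
        have := j.2
        ext
        dsimp only
        omega }
  refine ⟨e.extendSubtype, fun a => ?_⟩
  rw [twoBlocks]
  by_cases ha : (a : ℕ) < i
  · rw [if_pos ha, if_pos (e.extendSubtype_mem a ha)]
  · rw [if_neg ha, if_neg (e.extendSubtype_not_mem a ha)]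

end LeviCharacters

/-- If a cuspidal irreducible representation of `GL m l` (`p ≠ 2`) is
`χ`-distinguished by the Levi subgroup `(GL i × GL (m-i))(l)` with `i ≤ m/2`, then `m = 1`
or `m = 2 i`. -/
theorem cuspidal_distinguished_levi_index
    (p : ℕ) [Fact p.Prime] (hp : p ≠ 2)
    (l : Type) [Field l] [Fintype l] [CharP l p]
    (R : Type) [Field R] [IsAlgClosed R] (hchar : ringChar R ≠ p)
    (m i : ℕ) (hm : 1 ≤ m) (hi : i ≤ m / 2)
    (V : Type) [AddCommGroup V] [Module R V]
    (ρ : Representation R (GL (Fin m) l) V)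
    (hirr : IsIrreducibleRep ρ) (hcusp : IsCuspidal l ρ)
    (χ : ↥(levi l m 2 (twoBlocks m i)) →* R)
    (φ : V →ₗ[R] R) (hφ : φ ≠ 0)
    (hrel : ∀ (x : ↥(levi l m 2 (twoBlocks m i))) (v : V), φ (ρ (↑x) v) = χ x * φ v) :
    m = 1 ∨ m = 2 * i := by
  by_contra! hcon
  obtain ⟨hm1, hm2⟩ := hcon
  have him : 2 * i < m := by omega
  have hringl : ringChar l = p := ringChar.eq_iff.2 inferInstance
  have h2 : (2 : l) ≠ 0 := Ring.two_ne_zero (hringl ▸ hp)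
  obtain ⟨ψ, hψ⟩ := exists_nontrivial_addChar l R (hringl ▸ hchar)
  obtain ⟨τ, hτ⟩ := exists_perm_alternating him
  let c : Fin m → Fin 2 := fun j =>
    if (m - 1 - (j : ℕ)) % 2 = 0 ∧ m - 1 - (j : ℕ) < 2 * i then 0 else 1
  let χ' : ↥(levi l m 2 c) →* R := χ.comp (leviPermConj τ (twoBlocks m i) c hτ)
  let φ' : V →ₗ[R] R := φ ∘ₗ ρ (permGL l τ)
  have hrel' : ∀ (x : ↥(levi l m 2 c)) (v : V), φ' (ρ (↑x) v) = χ' x * φ' v := by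
    intro x v
    have h := hrel (leviPermConj τ (twoBlocks m i) c hτ x) (ρ (permGL l τ) v)
    change φ (ρ (permGL l τ * (x : GL (Fin m) l) * (permGL l τ)⁻¹) (ρ (permGL l τ) v)) = _ at h
    rw [← Module.End.mul_apply, ← map_mul, inv_mul_cancel_right, map_mul] at h
    exact h
  have hφ' : φ' = 0 := by
    refine linearForm_eq_zero_of_alternating hcusp hψ (natCast_card_ne_zero p l R (Fin m) hchar)
      c (min (m - 1) (m - 2 * i)) (by omega) (by omega) ?_ ?_ φ' ?_ ?_
    · intro j k hk hj
      rw [Fin.le_def] at hj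
      simp only [c]
      rw [if_neg (by omega), if_neg (by omega)]
    · intro r k hk hrk
      simp only [c]
      split_ifs <;> omega
    · intro g hg v hv
      rw [hrel' ⟨g, hg⟩ v]
      exact mul_ne_zero ((Group.isUnit _).map χ').ne_zero hv
    · intro a b hlt hab t v
      rw [hrel' ⟨_, colUnip_single_mem_levi c hab t⟩ v, map_colUnip_single_eq_one h2 c χ' hlt hab t,
        one_mul]
  refine hφ (LinearMap.ext fun v => ?_)
  have h := LinearMap.congr_fun hφ' (ρ (permGL l τ)⁻¹ v)
  change φ (ρ (permGL l τ) (ρ (permGL l τ)⁻¹ v)) = 0 at h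
  rwa [← Module.End.mul_apply, ← map_mul, mul_inv_cancel, map_one] at h
end

section
/- Let E₀ ⊆ E be fields with [E : E₀] = 2 and let σ be the nontrivial E₀-automorphism of E. Let K/E be a finite cyclic Galois extension and let R be an algebraically closed field. Let ξ : K^× → R^× be a group homomorphism such that for every intermediate field L with E ⊆ L ⊊ K, ξ does not factor through the norm map N_{K/L} : K^× → L^× (i.e. there is no homomorphism χ : L^× → R^× with ξ = χ ∘ N_{K/L}). Suppose g is a field automorphism of K fixing E₀ pointwise, restricting to σ on E, and satisfying ξ ∘ g = ξ^{−1}. Then g ∘ g = id_K, and g is the unique field automorphism of K fixing E₀ pointwise whose restriction to E is σ and which satisfies ξ ∘ g = ξ^{−1}. -/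
/-- A homomorphism of commutative groups into the units of an algebraically closed field extends
along any injective homomorphism. -/
theorem MonoidHom.exists_extension_units_of_isAlgClosed {A B R : Type*} [CommGroup A] [CommGroup B]
    [Field R] [IsAlgClosed R] (f : A →* B) (hf : Function.Injective f) (φ : A →* Rˣ) :
    ∃ χ : B →* Rˣ, ∀ a, χ (f a) = φ a := by
  have hroot : ∀ {n : ℤ}, n ≠ 0 →
      Function.Surjective (fun a : Additive Rˣ => n • a) := by
    intro n hn a
    have key : ∀ m : ℕ, m ≠ 0 → ∀ b : Rˣ, ∃ c : Rˣ, c ^ m = b := by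
      intro m hm b
      obtain ⟨z, hz⟩ := IsAlgClosed.exists_pow_nat_eq (b : R) (Nat.pos_of_ne_zero hm)
      have hz0 : z ≠ 0 := by
        rintro rfl
        rw [zero_pow hm] at hz
        exact b.ne_zero hz.symm
      exact ⟨Units.mk0 z hz0, Units.ext (by simpa using hz)⟩
    obtain ⟨c, hc⟩ := key n.natAbs (by simpa using hn) a.toMul
    rcases Int.natAbs_eq n with h | h
    · refine ⟨Additive.ofMul c, ?_⟩
      change Additive.ofMul (c ^ n) = a
      rw [h, zpow_natCast, hc, ofMul_toMul]
    · refine ⟨Additive.ofMul c⁻¹, ?_⟩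
      change Additive.ofMul (c⁻¹ ^ n) = a
      rw [h, zpow_neg, inv_zpow, inv_inv, zpow_natCast, hc, ofMul_toMul]
  let _ : DivisibleBy (Additive Rˣ) ℤ := divisibleByOfSMulRightSurj _ _ hroot
  obtain ⟨h, hh⟩ := (Module.Baer.of_divisible (Additive Rˣ)).extension_property_addMonoidHom
    (MonoidHom.toAdditive f) hf (MonoidHom.toAdditive φ)
  exact ⟨MonoidHom.toAdditive.symm h, fun a => congrArg Additive.toMul (DFunLike.congr_fun hh a)⟩

/-- If a homomorphism is trivial on the kernel of `f`, and takes values in the units of an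
algebraically closed field, then it factors through `f`. -/
theorem MonoidHom.exists_factor_units_of_ker_le {A B R : Type*} [CommGroup A] [CommGroup B]
    [Field R] [IsAlgClosed R] (f : A →* B) (φ : A →* Rˣ) (hker : f.ker ≤ φ.ker) :
    ∃ χ : B →* Rˣ, ∀ a, φ a = χ (f a) := by
  obtain ⟨χ, hχ⟩ := MonoidHom.exists_extension_units_of_isAlgClosed
    (QuotientGroup.kerLift f) (QuotientGroup.kerLift_injective f) (QuotientGroup.lift f.ker φ hker)
  exact ⟨χ, fun a => (hχ (QuotientGroup.mk a)).symm⟩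

/-- If `ξ` is invariant under an automorphism `τ` of a finite Galois extension `K/E`, then `ξ`
factors through the norm to the fixed field of `τ`. -/
theorem exists_factor_norm_fixedField_zpowers {E K R : Type} [Field E] [Field K] [Algebra E K]
    [FiniteDimensional E K] [IsGalois E K] [Field R] [IsAlgClosed R]
    (ξ : Kˣ →* Rˣ) (τ : K ≃ₐ[E] K)
    (hτ : ∀ x : Kˣ, ξ (Units.map (τ : K →* K) x) = ξ x) :
    ∃ χ : (↥(IntermediateField.fixedField (Subgroup.zpowers τ)))ˣ →* Rˣ, ∀ x : Kˣ,
      ξ x = χ (Units.map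
        (Algebra.norm ↥(IntermediateField.fixedField (Subgroup.zpowers τ)) : K →* _) x) := by
  set L := IntermediateField.fixedField (Subgroup.zpowers τ)
  have hfix : L.fixingSubgroup = Subgroup.zpowers τ :=
    IntermediateField.fixingSubgroup_fixedField _
  let e : L.fixingSubgroup ≃* (K ≃ₐ[L] K) := IntermediateField.fixingSubgroupEquiv L
  have hτL : τ ∈ L.fixingSubgroup := hfix ▸ Subgroup.mem_zpowers τ
  have hgen : ∀ s, s ∈ Subgroup.zpowers (e ⟨τ, hτL⟩) := by
    intro s
    obtain ⟨⟨t, ht⟩, rfl⟩ := e.surjective s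
    obtain ⟨n, rfl⟩ := Subgroup.mem_zpowers_iff.1 (hfix ▸ ht)
    exact Subgroup.mem_zpowers_iff.2 ⟨n, by rw [← map_zpow]; rfl⟩
  have : IsCyclic (K ≃ₐ[L] K) := ⟨_, hgen⟩
  refine MonoidHom.exists_factor_units_of_ker_le _ ξ fun x hx => ?_
  obtain ⟨y, hy⟩ := groupCohomology.exists_div_of_norm_eq_one hgen
    (x := (x : K)) (congrArg Units.val (MonoidHom.mem_ker.1 hx))
  have hxy : x = y / Units.map (τ : K →* K) y := by
    ext
    rw [← hy, Units.val_div_eq_div_val]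
    rfl
  rw [MonoidHom.mem_ker, hxy, map_div, hτ, div_self']

/-- Every automorphism of a quadratic field extension squares to the identity. -/
theorem AlgEquiv.apply_apply_of_finrank_eq_two {F E : Type*} [Field F] [Field E] [Algebra F E]
    (h : Module.finrank F E = 2) (σ : E ≃ₐ[F] E) (x : E) : σ (σ x) = x := by
  have : FiniteDimensional F E := Module.finite_of_finrank_pos (by omega)
  have hcard : Fintype.card (E ≃ₐ[F] E) ≤ 2 := h ▸ AlgEquiv.card_le
  have hsq : σ * σ = 1 := by
    by_contra hne
    have h1 : σ ≠ 1 := fun h1 => hne (by rw [h1, one_mul])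
    have h2 : σ * σ ≠ σ := fun h2 => h1 (mul_eq_left.1 h2)
    classical
    have hle := Finset.card_le_univ ({1, σ, σ * σ} : Finset (E ≃ₐ[F] E))
    rw [Finset.card_eq_three.2 ⟨1, σ, σ * σ, h1.symm, Ne.symm hne, h2.symm, rfl⟩] at hle
    omega
  exact DFunLike.congr_fun hsq x


/-- Let `E/E₀` be quadratic with nontrivial automorphism `σ`, `K/E` a finite
cyclic Galois extension, and `ξ : Kˣ → Rˣ` a homomorphism not factoring through any proper
relative norm (admissibility).  If `g` is an `E₀`-automorphism of `K` restricting to `σ` on `E`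
with `ξ ∘ g = ξ⁻¹`, then `g` is an involution, and it is the unique such automorphism. -/
theorem admissible_pair_involution_unique
    (E₀ E K : Type) [Field E₀] [Field E] [Field K]
    [Algebra E₀ E] [Algebra E K] [Algebra E₀ K] [IsScalarTower E₀ E K]
    (hquad : Module.finrank E₀ E = 2)
    (σ : E ≃ₐ[E₀] E) (hσ : σ ≠ AlgEquiv.refl)
    [FiniteDimensional E K] [IsGalois E K] [IsCyclic (K ≃ₐ[E] K)]
    (R : Type) [Field R] [IsAlgClosed R]
    (ξ : Kˣ →* Rˣ)
    (hadm : ∀ L : IntermediateField E K, L ≠ ⊤ →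
      ¬ ∃ χ : (↥L)ˣ →* Rˣ, ∀ x : Kˣ, ξ x = χ (Units.map (Algebra.norm ↥L : K →* ↥L) x))
    (g : K ≃ₐ[E₀] K)
    (hgE : ∀ x : E, g (algebraMap E K x) = algebraMap E K (σ x))
    (hgξ : ∀ x : Kˣ, ξ (Units.map (g : K →* K) x) = (ξ x)⁻¹) :
    (∀ x : K, g (g x) = x) ∧
      ∀ g' : K ≃ₐ[E₀] K,
        (∀ x : E, g' (algebraMap E K x) = algebraMap E K (σ x)) →
        (∀ x : Kˣ, ξ (Units.map (g' : K →* K) x) = (ξ x)⁻¹) →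
        g' = g := by
  have hid : ∀ h : K ≃ₐ[E₀] K, (∀ x : E, h (algebraMap E K x) = algebraMap E K (σ x)) →
      (∀ x : Kˣ, ξ (Units.map (h : K →* K) x) = (ξ x)⁻¹) → ∀ x : K, h (g x) = x := by
    intro h hhE hhξ
    let τ : K ≃ₐ[E] K := AlgEquiv.ofRingEquiv (f := (g.trans h).toRingEquiv) fun x => by
      change h (g (algebraMap E K x)) = algebraMap E K x
      rw [hgE, hhE, AlgEquiv.apply_apply_of_finrank_eq_two hquad]
    have hτ : ∀ x : Kˣ, ξ (Units.map (τ : K →* K) x) = ξ x := fun x => by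
      have hx : Units.map (τ : K →* K) x = Units.map (h : K →* K) (Units.map (g : K →* K) x) :=
        Units.ext rfl
      rw [hx, hhξ, hgξ, inv_inv]
    have htop : IntermediateField.fixedField (Subgroup.zpowers τ) = ⊤ := by
      by_contra hne
      exact hadm _ hne (exists_factor_norm_fixedField_zpowers ξ τ hτ)
    have hone : τ = 1 := by
      rw [← Subgroup.mem_bot, ← IntermediateField.fixingSubgroup_top, ← htop,
        IntermediateField.fixingSubgroup_fixedField]
      exact Subgroup.mem_zpowers τ
    exact fun x => DFunLike.congr_fun hone x
  refine ⟨hid g hgE hgξ, fun g' hg'E hg'ξ => AlgEquiv.ext fun x => ?_⟩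
  obtain ⟨y, rfl⟩ := g.surjective x
  rw [hid g' hg'E hg'ξ, hid g hgE hgξ]
end
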